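/- arXiv:1010.1077 — 2 statements merged into one kernel-verified Lean document; each statement's English description precedes it below -/
import Mathlib

section
/- Let P ∈ 𝓜³ be a maximal lattice-free integral polytope with exactly six facets. Then P is a parallelepiped; more precisely, there exist a matrix U ∈ ℤ^{3×3} with |det U| = 1 and a vector v ∈ ℤ³ such that P = U·M₁₂ + v, where M₁₂ = {σ₁u₁ + σ₂u₂ + σ₃u₃ : σ₁, σ₂, σ₃ ∈ [0,1]} with u₁ = (−1,1,0), u₂ = (1,1,0), u₃ = (1,1,2). -/
open Set

/-- The set of integer points `ℤ^d` inside `ℝ^d`. -/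
def intPts (d : ℕ) : Set (Fin d → ℝ) := {x | ∀ i, ∃ z : ℤ, x i = (z : ℝ)}

/-- The lattice `Λ = s·ℤ^d` inside `ℝ^d`. -/
def sLat (d s : ℕ) : Set (Fin d → ℝ) := {x | ∀ i, ∃ z : ℤ, x i = (s : ℝ) * (z : ℝ)}

/-- A polyhedron: a finite intersection of closed halfspaces. -/
def IsPolyhedron {d : ℕ} (P : Set (Fin d → ℝ)) : Prop :=
  ∃ (n : ℕ) (A : Fin n → Fin d → ℝ) (b : Fin n → ℝ),
    P = {x | ∀ i, (∑ j, A i j * x j) ≤ b i}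

/-- An integral set: it equals the convex hull of its integer points. -/
def IsIntegralPoly {d : ℕ} (P : Set (Fin d → ℝ)) : Prop :=
  P = convexHull ℝ (P ∩ intPts d)

/-- The affine map `x ↦ U·x + t` with integer matrix `U` and translation `t : ℝ^d`. -/
noncomputable def affMap {d : ℕ} (U : Matrix (Fin d) (Fin d) ℤ) (t : Fin d → ℝ)
    (x : Fin d → ℝ) : Fin d → ℝ := fun i => (∑ j, (U i j : ℝ) * x j) + t i

/-- Membership in `𝓜³`: a maximal lattice-free integral polytope in `ℝ³`, i.e. a bounded
integral polyhedron with nonempty interior, whose interior contains no integer point, and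
which is not properly contained in any convex set whose interior contains no integer point. -/
def MemM3 (P : Set (Fin 3 → ℝ)) : Prop :=
  IsPolyhedron P ∧ Bornology.IsBounded P ∧ IsIntegralPoly P ∧ (interior P).Nonempty ∧
    interior P ∩ intPts 3 = ∅ ∧
    ∀ K : Set (Fin 3 → ℝ), Convex ℝ K → interior K ∩ intPts 3 = ∅ → P ⊆ K → P = K

/-- A facet of a three-dimensional polytope `P`: a two-dimensional face, i.e. a nonempty
convex extreme subset whose affine hull is two-dimensional. -/
def IsFacet (P F : Set (Fin 3 → ℝ)) : Prop :=
  IsExtreme ℝ P F ∧ Convex ℝ F ∧ Module.finrank ℝ (vectorSpan ℝ F) = 2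

def M12 : Set (Fin 3 → ℝ) :=
  {x | ∃ σ₁ σ₂ σ₃ : ℝ, σ₁ ∈ Icc (0:ℝ) 1 ∧ σ₂ ∈ Icc (0:ℝ) 1 ∧ σ₃ ∈ Icc (0:ℝ) 1 ∧
    x = σ₁ • ![(-1:ℝ),1,0] + σ₂ • ![(1:ℝ),1,0] + σ₃ • ![(1:ℝ),1,2]}

open scoped Matrix

/-- The real vector with the given integer coordinates. -/
def toReal (z : Fin 3 → ℤ) : Fin 3 → ℝ := fun j => (z j : ℝ)

/-- The residue class modulo two of an integer vector. -/
def parity (z : Fin 3 → ℤ) : Fin 3 → ZMod 2 := fun j => (z j : ZMod 2)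

/-- A lattice-free integral polytope given by six inequalities `N i ⬝ᵥ x ≤ b i`, together with an
integer point `p i` in the relative interior of each of its facets. -/
structure SixFacets where
  N : Fin 6 → Fin 3 → ℝ
  b : Fin 6 → ℝ
  p : Fin 6 → Fin 3 → ℤ
  tight : ∀ i, b i - N i ⬝ᵥ toReal (p i) = 0
  slack : ∀ i j, j ≠ i → 0 < b j - N j ⬝ᵥ toReal (p i)
  free : ∀ z, ∃ i, b i - N i ⬝ᵥ toReal z ≤ 0
  finite : {z | ∀ i, 0 ≤ b i - N i ⬝ᵥ toReal z}.Finite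
  hull : {x | ∀ i, 0 ≤ b i - N i ⬝ᵥ x} ⊆
    convexHull ℝ (toReal '' {z | ∀ i, 0 ≤ b i - N i ⬝ᵥ toReal z})

theorem parity_eq_iff {x y : Fin 3 → ℤ} : parity x = parity y ↔ ∀ j, x j % 2 = y j % 2 := by
  simp only [funext_iff, parity, ZMod.intCast_eq_intCast_iff]
  rfl

theorem exists_midpoint {x y : Fin 3 → ℤ} (h : parity x = parity y) : ∃ m, x + y = m + m := by
  rw [parity_eq_iff] at h
  refine ⟨fun j => (x j + y j) / 2, funext fun j => ?_⟩
  have := h j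
  simp only [Pi.add_apply]
  omega

theorem eq_zero_of_halving (Q : (Fin 3 → ℤ) → Prop) (μ : (Fin 3 → ℤ) → Fin 3 → ℤ)
    (h : ∀ x, Q x → ∃ y, Q y ∧ μ x = μ y + μ y) {x : Fin 3 → ℤ} (hx : Q x) : μ x = 0 := by
  have key : ∀ n : ℕ, ∀ x, Q x → ∀ j, (2 : ℤ) ^ n ∣ μ x j := by
    intro n
    induction n with
    | zero => simp
    | succ n ih =>
      intro x hx j
      obtain ⟨y, hy, e⟩ := h x hx
      rw [e, Pi.add_apply, ← two_mul, pow_succ']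
      exact mul_dvd_mul_left 2 (ih y hy j)
  funext j
  refine Int.eq_zero_of_abs_lt_dvd (key (μ x j).natAbs x hx j) ?_
  rw [Int.abs_eq_natAbs]
  exact_mod_cast Nat.lt_two_pow_self

/-- Nonzero parallel integer vectors are annihilated by the same linear forms. -/
theorem dotProduct_eq_zero_of_cross {a c : Fin 3 → ℤ} (n : Fin 3 → ℝ) (h : a ⨯₃ c = 0) (ha : a ≠ 0)
    (hn : n ⬝ᵥ toReal a = 0) : n ⬝ᵥ toReal c = 0 := by
  have h0 := congrFun h 0
  have h1 := congrFun h 1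
  have h2 := congrFun h 2
  simp only [cross_apply, Matrix.cons_val_zero, Matrix.cons_val_one, Matrix.cons_val,
    Pi.zero_apply] at h0 h1 h2
  simp only [Matrix.vec3_dotProduct, toReal] at hn ⊢
  have h0' : (a 1 : ℝ) * c 2 - a 2 * c 1 = 0 := by exact_mod_cast h0
  have h1' : (a 2 : ℝ) * c 0 - a 0 * c 2 = 0 := by exact_mod_cast h1
  have h2' : (a 0 : ℝ) * c 1 - a 1 * c 0 = 0 := by exact_mod_cast h2
  obtain ⟨j, hj⟩ := Function.ne_iff.mp ha
  have hj' : (a j : ℝ) ≠ 0 := by exact_mod_cast hj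
  apply (mul_eq_zero.mp _).resolve_left hj'
  fin_cases j
  · simp only [Fin.zero_eta]
    linear_combination c 0 * hn + n 1 * h2' - n 2 * h1'
  · simp only [Fin.mk_one]
    linear_combination c 1 * hn - n 0 * h2' + n 2 * h0'
  · simp only [Fin.reduceFinMk]
    linear_combination c 2 * hn + n 0 * h1' - n 1 * h0'

theorem eq_zero_of_cross_eq_zero {a c d : Fin 3 → ℤ} (ha : a ⨯₃ d = 0) (hc : c ⨯₃ d = 0)
    (h : a ⨯₃ c ≠ 0) : d = 0 := by
  by_contra hd
  apply h
  have e : ∀ {u v : Fin 3 → ℤ}, u ⨯₃ v = 0 →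
      u 1 * v 2 - u 2 * v 1 = 0 ∧ u 2 * v 0 - u 0 * v 2 = 0 ∧ u 0 * v 1 - u 1 * v 0 = 0 := by
    intro u v h
    have h0 := congrFun h 0
    have h1 := congrFun h 1
    have h2 := congrFun h 2
    simpa [cross_apply] using And.intro h0 (And.intro h1 h2)
  obtain ⟨a0, a1, a2⟩ := e ha
  obtain ⟨c0, c1, c2⟩ := e hc
  obtain ⟨j, hj⟩ := Function.ne_iff.mp hd
  have hj2 : d j * d j ≠ 0 := mul_ne_zero hj hj
  have key : ∀ k, (a ⨯₃ c) k = 0 := by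
    intro k
    apply (mul_eq_zero.mp _).resolve_left hj2
    fin_cases j <;> fin_cases k <;>
      simp only [cross_apply, Matrix.cons_val_zero, Matrix.cons_val_one, Matrix.cons_val,
        Fin.zero_eta, Fin.mk_one, Fin.reduceFinMk]
    all_goals grind
  exact funext key

namespace SixFacets

variable (S : SixFacets)

/-- The slack of the `i`-th inequality at an integer point. -/
def gap (i : Fin 6) (z : Fin 3 → ℤ) : ℝ := S.b i - S.N i ⬝ᵥ toReal z

/-- The integer points of the polytope. -/
def V : Set (Fin 3 → ℤ) := {z | ∀ i, 0 ≤ S.gap i z}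

/-- The integer points in the relative interior of the `i`-th facet. -/
def RelInt (i : Fin 6) (z : Fin 3 → ℤ) : Prop := S.gap i z = 0 ∧ ∀ j, j ≠ i → 0 < S.gap j z

variable {S}

theorem gap_add {x y m : Fin 3 → ℤ} (h : x + y = m + m) (i : Fin 6) :
    S.gap i x + S.gap i y = 2 * S.gap i m := by
  have e : ∀ j, (x j : ℝ) + y j = m j + m j := fun j => by exact_mod_cast congrFun h j
  simp only [gap, Matrix.vec3_dotProduct, toReal]
  linear_combination -S.N i 0 * e 0 - S.N i 1 * e 1 - S.N i 2 * e 2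

theorem mem_V_of_add {x y m : Fin 3 → ℤ} (h : x + y = m + m) (hx : x ∈ S.V) (hy : y ∈ S.V) :
    m ∈ S.V := fun i => by linarith [gap_add (S := S) h i, hx i, hy i]

theorem gap_mid_eq_zero {x y m : Fin 3 → ℤ} (h : x + y = m + m) {i : Fin 6} (hx : S.gap i x = 0)
    (hy : S.gap i y = 0) : S.gap i m = 0 := by linarith [gap_add (S := S) h i]

theorem gap_eq_zero_left {x y m : Fin 3 → ℤ} (h : x + y = m + m) (hx : x ∈ S.V) (hy : y ∈ S.V)
    {i : Fin 6} (hm : S.gap i m = 0) : S.gap i x = 0 := by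
  linarith [gap_add (S := S) h i, hx i, hy i]

theorem gap_eq_zero_right {x y m : Fin 3 → ℤ} (h : x + y = m + m) (hx : x ∈ S.V) (hy : y ∈ S.V)
    {i : Fin 6} (hm : S.gap i m = 0) : S.gap i y = 0 := by
  linarith [gap_add (S := S) h i, hx i, hy i]

theorem exists_gap_eq_zero {z : Fin 3 → ℤ} (hz : z ∈ S.V) : ∃ i, S.gap i z = 0 := by
  obtain ⟨i, hi⟩ := S.free z
  exact ⟨i, le_antisymm hi (hz i)⟩

theorem RelInt.mem_V {i : Fin 6} {z : Fin 3 → ℤ} (h : S.RelInt i z) : z ∈ S.V := fun j => by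
  by_cases e : j = i
  · rw [e, h.1]
  · exact (h.2 j e).le

theorem relInt_p (i : Fin 6) : S.RelInt i (S.p i) := ⟨S.tight i, S.slack i⟩

theorem p_mem_V (i : Fin 6) : S.p i ∈ S.V := (relInt_p i).mem_V

theorem gap_p_eq_zero_iff {i j : Fin 6} : S.gap i (S.p j) = 0 ↔ i = j := by
  refine ⟨fun h => by_contra fun e => ?_, fun h => h ▸ S.tight i⟩
  exact (S.slack j i e).ne' h

theorem p_injective : Function.Injective S.p := fun i _ h =>
  gap_p_eq_zero_iff.mp (h ▸ S.tight i)

theorem RelInt.mid {i : Fin 6} {x y m : Fin 3 → ℤ} (hy : S.RelInt i y) (h : x + y = m + m)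
    (hx : x ∈ S.V) (hxi : S.gap i x = 0) : S.RelInt i m :=
  ⟨gap_mid_eq_zero h hxi hy.1, fun j hj => by
    linarith [gap_add (S := S) h j, hx j, hy.2 j hj]⟩

/-- An integer point congruent modulo two to a relative interior point of a facet lies on that
facet. -/
theorem RelInt.gap_eq_zero {i : Fin 6} {r q : Fin 3 → ℤ} (hr : S.RelInt i r) (hq : q ∈ S.V)
    (h : parity q = parity r) : S.gap i q = 0 := by
  obtain ⟨m, hm⟩ := exists_midpoint h
  obtain ⟨k, hk⟩ := exists_gap_eq_zero (mem_V_of_add hm hq hr.mem_V)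
  have hkr := gap_eq_zero_right hm hq hr.mem_V hk
  by_cases e : k = i
  · exact e ▸ gap_eq_zero_left hm hq hr.mem_V hk
  · exact absurd hkr (hr.2 k e).ne'

theorem parity_p_injective : Function.Injective fun i => parity (S.p i) := fun i j h =>
  gap_p_eq_zero_iff.mp ((relInt_p i).gap_eq_zero (p_mem_V j) h.symm)

theorem N_dotProduct_sub {i : Fin 6} {x y : Fin 3 → ℤ} :
    S.N i ⬝ᵥ toReal (x - y) = S.gap i y - S.gap i x := by
  simp only [gap, Matrix.vec3_dotProduct, toReal, Pi.sub_apply]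
  push_cast
  ring

theorem gap_eq_zero_of_cross {i : Fin 6} {x y z : Fin 3 → ℤ} (h : (y - x) ⨯₃ (z - x) = 0)
    (hxy : x ≠ y) (hx : S.gap i x = 0) (hy : S.gap i y = 0) : S.gap i z = 0 := by
  have := dotProduct_eq_zero_of_cross (S.N i) h (sub_ne_zero.mpr hxy.symm)
    (by rw [N_dotProduct_sub, hx, hy, sub_zero])
  rw [N_dotProduct_sub, hx] at this
  linarith

theorem N_ne_zero (i : Fin 6) : S.N i ≠ 0 := by
  intro h
  obtain ⟨j, hj⟩ := exists_ne i
  have h1 := S.tight i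
  have h2 := S.slack j i hj.symm
  rw [h, zero_dotProduct] at h1 h2
  linarith

/-- Three facets do not share a line. -/
theorem eq_of_three_facets {i j k : Fin 6} (hij : i ≠ j) (hik : i ≠ k) (hjk : j ≠ k)
    {x y : Fin 3 → ℤ} (xi : S.gap i x = 0) (xj : S.gap j x = 0) (xk : S.gap k x = 0)
    (yi : S.gap i y = 0) (yj : S.gap j y = 0) (yk : S.gap k y = 0) : x = y := by
  by_contra hxy
  let M : Matrix (Fin 3) (Fin 3) ℝ := Matrix.of ![S.N i, S.N j, S.N k]
  have hd : toReal (y - x) ≠ 0 := by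
    intro h
    apply hxy
    funext l
    have := congrFun h l
    simp only [toReal, Pi.sub_apply, Pi.zero_apply, Int.cast_eq_zero] at this
    omega
  have hM : M *ᵥ toReal (y - x) = 0 := by
    funext l
    fin_cases l
    · exact N_dotProduct_sub.trans (by rw [xi, yi, sub_zero]; rfl)
    · exact N_dotProduct_sub.trans (by rw [xj, yj, sub_zero]; rfl)
    · exact N_dotProduct_sub.trans (by rw [xk, yk, sub_zero]; rfl)
  have hdet : M.det = 0 := Matrix.exists_mulVec_eq_zero_iff.mp ⟨_, hd, hM⟩
  obtain ⟨w, hw, hw0⟩ := Matrix.exists_vecMul_eq_zero_iff.mpr hdet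
  have hc : ∀ l, w 0 * S.N i l + w 1 * S.N j l + w 2 * S.N k l = 0 := by
    intro l
    have := congrFun hw0 l
    simp only [Matrix.vecMul, Matrix.vec3_dotProduct] at this
    exact this
  have key : ∀ q, w 0 * S.gap i q + w 1 * S.gap j q + w 2 * S.gap k q = 0 := by
    intro q
    simp only [gap, Matrix.vec3_dotProduct, toReal] at xi xj xk ⊢
    linear_combination w 0 * xi + w 1 * xj + w 2 * xk + (x 0 - q 0 : ℝ) * hc 0
      + (x 1 - q 1 : ℝ) * hc 1 + (x 2 - q 2 : ℝ) * hc 2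
  have ki := key (S.p i)
  have kj := key (S.p j)
  have kk := key (S.p k)
  rw [(relInt_p i).1] at ki
  rw [(relInt_p j).1] at kj
  rw [(relInt_p k).1] at kk
  have s1 := (relInt_p (S := S) i).2 j hij.symm
  have s2 := (relInt_p (S := S) i).2 k hik.symm
  have s3 := (relInt_p (S := S) j).2 i hij
  have s4 := (relInt_p (S := S) j).2 k hjk.symm
  have s5 := (relInt_p (S := S) k).2 i hik
  have s6 := (relInt_p (S := S) k).2 j hjk
  have sgn : ∀ {a c u v : ℝ}, 0 < u → 0 < v → a * u + c * v = 0 → a * c ≤ 0 ∧ (a = 0 ↔ c = 0) := by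
    intro a c u v hu hv h
    have ha : a = -(c * v / u) := by field_simp; linarith
    constructor
    · rw [ha, show -(c * v / u) * c = -(c ^ 2 * (v / u)) by ring]
      have : 0 < v / u := by positivity
      nlinarith [sq_nonneg c]
    · constructor
      · rintro rfl
        have : c * v = 0 := by linarith
        exact (mul_eq_zero.mp this).resolve_right hv.ne'
      · rintro rfl
        simpa using ha
  obtain ⟨a1, a2⟩ := sgn s1 s2 (by linarith : w 1 * _ + w 2 * _ = 0)
  obtain ⟨b1, b2⟩ := sgn s3 s4 (by linarith : w 0 * _ + w 2 * _ = 0)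
  obtain ⟨c1, c2⟩ := sgn s5 s6 (by linarith : w 0 * _ + w 1 * _ = 0)
  apply hw
  have h0 : w 0 = 0 := by
    by_contra h0
    have h1 : w 1 ≠ 0 := fun h => h0 (c2.mpr h)
    have h2 : w 2 ≠ 0 := fun h => h0 (b2.mpr h)
    have a1' := lt_of_le_of_ne a1 (mul_ne_zero h1 h2)
    have b1' := lt_of_le_of_ne b1 (mul_ne_zero h0 h2)
    have c1' := lt_of_le_of_ne c1 (mul_ne_zero h0 h1)
    have := mul_pos_of_neg_of_neg a1' b1'
    nlinarith [sq_nonneg (w 2), mul_nonneg this.le (sq_nonneg (w 2)), sq_pos_of_pos this,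
      mul_neg_of_pos_of_neg (mul_pos_of_neg_of_neg a1' b1') c1', sq_nonneg (w 0 * w 1 * w 2)]
  funext l
  fin_cases l
  · exact h0
  · exact c2.mp h0
  · exact b2.mp h0

/-- A linear form that is not constant on a facet does not attain its maximum over the facet at the
chosen relative interior point. -/
theorem exists_dotProduct_lt (i : Fin 6) (g d : Fin 3 → ℝ) (hd : S.N i ⬝ᵥ d = 0)
    (hg : 0 < g ⬝ᵥ d) :
    ∃ v ∈ S.V, S.gap i v = 0 ∧ g ⬝ᵥ toReal (S.p i) < g ⬝ᵥ toReal v := by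
  by_contra! hcon
  let C : Set (Fin 3 → ℝ) := {x | 0 < S.b i - S.N i ⬝ᵥ x ∨
    (0 = S.b i - S.N i ⬝ᵥ x ∧ g ⬝ᵥ x ≤ g ⬝ᵥ toReal (S.p i))}
  have hC : Convex ℝ C := by
    intro x hx y hy s t hs ht hst
    have e1 : S.b i - S.N i ⬝ᵥ (s • x + t • y) =
        s * (S.b i - S.N i ⬝ᵥ x) + t * (S.b i - S.N i ⬝ᵥ y) := by
      rw [dotProduct_add, dotProduct_smul, dotProduct_smul, smul_eq_mul, smul_eq_mul]
      linear_combination (-S.b i) * hst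
    have e2 : g ⬝ᵥ (s • x + t • y) = s * (g ⬝ᵥ x) + t * (g ⬝ᵥ y) := by
      rw [dotProduct_add, dotProduct_smul, dotProduct_smul, smul_eq_mul, smul_eq_mul]
    show 0 < _ ∨ 0 = _ ∧ _ ≤ _
    rw [e1, e2]
    rcases hs.eq_or_lt with rfl | hs
    · have : t = 1 := by linarith
      subst this
      simpa [C] using hy
    rcases ht.eq_or_lt with rfl | ht
    · have : s = 1 := by linarith
      subst this
      simpa [C] using hx
    rcases hx with hx | ⟨hx, hx'⟩ <;> rcases hy with hy | ⟨hy, hy'⟩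
    · left; positivity
    · left; rw [← hy]; linarith [mul_pos hs hx]
    · left; rw [← hx]; linarith [mul_pos ht hy]
    · right
      rw [← hx, ← hy]
      refine ⟨by ring, ?_⟩
      have : g ⬝ᵥ toReal (S.p i) = s * (g ⬝ᵥ toReal (S.p i)) + t * (g ⬝ᵥ toReal (S.p i)) := by
        rw [← add_mul, hst, one_mul]
      rw [this]
      gcongr
  have hsub : {x | ∀ i, 0 ≤ S.b i - S.N i ⬝ᵥ x} ⊆ C := by
    refine S.hull.trans (convexHull_min ?_ hC)
    rintro _ ⟨v, hv, rfl⟩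
    rcases (hv i).eq_or_lt with h | h
    · exact Or.inr ⟨h, hcon v hv h.symm⟩
    · exact Or.inl h
  have hev : ∀ᶠ t : ℝ in nhdsWithin 0 (Ioi 0),
      ∀ j, 0 ≤ S.b j - S.N j ⬝ᵥ (toReal (S.p i) + t • d) := by
    rw [Filter.eventually_all]
    intro j
    by_cases e : j = i
    · subst e
      refine Filter.Eventually.of_forall fun t => ?_
      rw [dotProduct_add, dotProduct_smul, hd, smul_zero, add_zero, S.tight]
    · have hcont : Continuous fun t : ℝ => S.b j - S.N j ⬝ᵥ (toReal (S.p i) + t • d) := by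
        simp only [dotProduct_add, dotProduct_smul]
        fun_prop
      have h0 : 0 < S.b j - S.N j ⬝ᵥ (toReal (S.p i) + (0 : ℝ) • d) := by
        simpa using S.slack i j e
      have := (hcont.tendsto 0).eventually (lt_mem_nhds h0)
      exact (this.filter_mono nhdsWithin_le_nhds).mono fun t ht => le_of_lt ht
  obtain ⟨t, ht, ht0⟩ := (hev.and self_mem_nhdsWithin).exists
  rcases hsub ht with h | ⟨-, h⟩
  · rw [dotProduct_add, dotProduct_smul, hd, smul_zero, add_zero, S.tight] at h
    exact lt_irrefl _ h
  · rw [dotProduct_add, dotProduct_smul, smul_eq_mul] at h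
    have : 0 < t * (g ⬝ᵥ d) := mul_pos ht0 hg
    linarith

/-- The points of the polytope on the `i`-th facet, apart from the chosen interior point. -/
def W (S : SixFacets) (i : Fin 6) : Set (Fin 3 → ℤ) := {v | v ∈ S.V ∧ S.gap i v = 0 ∧ v ≠ S.p i}

/-- The signed area spanned by two integer vectors parallel to the `i`-th facet. -/
def area (S : SixFacets) (i : Fin 6) (a c : Fin 3 → ℤ) : ℝ := S.N i ⬝ᵥ toReal (a ⨯₃ c)

theorem toReal_sub (x y : Fin 3 → ℤ) : toReal (x - y) = toReal x - toReal y := by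
  funext j
  simp [toReal]

theorem toReal_cross (x y : Fin 3 → ℤ) : toReal (x ⨯₃ y) = toReal x ⨯₃ toReal y := by
  funext j
  fin_cases j <;> simp [toReal, cross_apply]

theorem toReal_ne_zero {x : Fin 3 → ℤ} (h : x ≠ 0) : toReal x ≠ 0 := by
  contrapose! h
  funext j
  have := congrFun h j
  simpa [toReal] using this

theorem exists_orthogonal (n : Fin 3 → ℝ) : ∃ d, d ≠ 0 ∧ n ⬝ᵥ d = 0 := by
  by_cases h : n 0 = 0 ∧ n 1 = 0
  · refine ⟨![1, 0, 0], fun e => by simpa using congrFun e 0, ?_⟩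
    rw [Matrix.vec3_dotProduct]
    simp [h.1]
  · refine ⟨![n 1, -n 0, 0], fun e => h ⟨?_, ?_⟩, ?_⟩
    · simpa using congrFun e 1
    · simpa using congrFun e 0
    · rw [Matrix.vec3_dotProduct]
      simp
      ring

theorem dotProduct_self_pos {d : Fin 3 → ℝ} (h : d ≠ 0) : 0 < d ⬝ᵥ d :=
  lt_of_le_of_ne (Finset.sum_nonneg fun j _ => mul_self_nonneg (d j))
    fun e => h (dotProduct_self_eq_zero.mp e.symm)

theorem exists_mem_W (i : Fin 6) : ∃ v, v ∈ S.W i := by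
  obtain ⟨d, hd, h⟩ := exists_orthogonal (S.N i)
  obtain ⟨v, hv, hvi, hlt⟩ := exists_dotProduct_lt i d d h (dotProduct_self_pos hd)
  exact ⟨v, hv, hvi, by rintro rfl; exact lt_irrefl _ hlt⟩

/-- There are lattice points of a facet on the positive side of each line through the chosen
relative interior point. -/
theorem exists_area_pos (i : Fin 6) {d : Fin 3 → ℤ} (h0 : d ≠ 0) (hd : S.N i ⬝ᵥ toReal d = 0) :
    ∃ v ∈ S.W i, 0 < S.area i d (v - S.p i) := by
  have hn : S.N i ⨯₃ toReal d ≠ 0 := by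
    intro h
    have := cross_dot_cross (S.N i) (toReal d) (S.N i) (toReal d)
    rw [h, zero_dotProduct, hd, zero_mul, sub_zero] at this
    exact (mul_pos (dotProduct_self_pos (N_ne_zero i))
      (dotProduct_self_pos (toReal_ne_zero h0))).ne this
  obtain ⟨v, hv, hvi, hlt⟩ := exists_dotProduct_lt i (S.N i ⨯₃ toReal d) (S.N i ⨯₃ toReal d)
    (dot_self_cross _ _) (dotProduct_self_pos hn)
  refine ⟨v, ⟨hv, hvi, by rintro rfl; exact lt_irrefl _ hlt⟩, ?_⟩
  have e : S.area i d (v - S.p i) =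
      (S.N i ⨯₃ toReal d) ⬝ᵥ toReal v - (S.N i ⨯₃ toReal d) ⬝ᵥ toReal (S.p i) := by
    rw [area, toReal_cross, toReal_sub]
    simp only [Matrix.vec3_dotProduct, cross_apply, Matrix.cons_val_zero, Matrix.cons_val_one,
      Matrix.cons_val, Pi.sub_apply]
    ring
  rw [e]
  linarith

theorem area_neg (i : Fin 6) (a c : Fin 3 → ℤ) : S.area i (-a) c = -S.area i a c := by
  have : toReal ((-a) ⨯₃ c) = -toReal (a ⨯₃ c) := by
    funext j
    fin_cases j <;> simp [toReal, cross_apply]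
  rw [area, this, dotProduct_neg, area]

theorem exists_area_neg (i : Fin 6) {d : Fin 3 → ℤ} (h0 : d ≠ 0) (hd : S.N i ⬝ᵥ toReal d = 0) :
    ∃ v ∈ S.W i, S.area i d (v - S.p i) < 0 := by
  have hneg : S.N i ⬝ᵥ toReal (-d) = 0 := by
    rw [show toReal (-d) = -toReal d by funext j; simp [toReal], dotProduct_neg, hd, neg_zero]
  obtain ⟨v, hv, h⟩ := exists_area_pos i (neg_ne_zero.mpr h0) hneg
  rw [area_neg] at h
  exact ⟨v, hv, by linarith⟩

/-- A facet is not determined, up to its chosen point, by another one. -/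
theorem exists_mem_W_gap_ne_zero {i k : Fin 6} (h : k ≠ i) : ∃ v ∈ S.W k, S.gap i v ≠ 0 := by
  obtain ⟨w, hw, hwk, hwp⟩ := exists_mem_W (S := S) k
  by_cases hwi : S.gap i w = 0
  · have hd : S.N k ⬝ᵥ toReal (S.p k - w) = 0 := by
      rw [N_dotProduct_sub, hwk, (relInt_p k).1, sub_zero]
    have hp := (relInt_p (S := S) k).2 i h.symm
    obtain ⟨v, hv, hvk, hlt⟩ := exists_dotProduct_lt k (-S.N i) (toReal (S.p k - w)) hd
      (by rw [neg_dotProduct, N_dotProduct_sub, hwi]; linarith)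
    rw [neg_dotProduct, neg_dotProduct] at hlt
    have hpv : S.gap i (S.p k) < S.gap i v := by simp only [gap]; linarith
    exact ⟨v, ⟨hv, hvk, by rintro rfl; exact lt_irrefl _ hpv⟩, (hp.trans hpv).ne'⟩
  · exact ⟨w, ⟨hw, hwk, hwp⟩, hwi⟩

theorem sub_cross_add {x y m : Fin 3 → ℤ} (h : x + y = m + m) (u e : Fin 3 → ℤ) :
    (x - u) ⨯₃ e + (y - u) ⨯₃ e = (m - u) ⨯₃ e + (m - u) ⨯₃ e := by
  rw [← LinearMap.add_apply, ← map_add, ← LinearMap.add_apply, ← map_add]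
  congr 2
  rw [sub_add_sub_comm, h, sub_add_sub_comm]

theorem self_add_eq_zero {x : Fin 3 → ℤ} (h : x + x = 0) : x = 0 := by
  funext j
  have := congrFun h j
  simp only [Pi.add_apply, Pi.zero_apply] at this ⊢
  omega

theorem sub_cross_mid {x y m u e : Fin 3 → ℤ} (h : x + y = m + m) (hx : (x - u) ⨯₃ e = 0)
    (hy : (y - u) ⨯₃ e = 0) : (m - u) ⨯₃ e = 0 := by
  have := sub_cross_add h u e
  rw [hx, hy, add_zero] at this
  exact self_add_eq_zero this.symm

theorem cross_comm_eq_zero {a c : Fin 3 → ℤ} (h : a ⨯₃ c = 0) : c ⨯₃ a = 0 := by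
  rw [← cross_anticomm, h, neg_zero]

theorem cross_swap {a c y : Fin 3 → ℤ} (h : (c - a) ⨯₃ (y - a) = 0) :
    (a - c) ⨯₃ (y - c) = 0 := by
  have : (a - c) ⨯₃ (y - c) = -((c - a) ⨯₃ (y - a)) := by
    rw [← neg_sub c a, ← sub_sub_sub_cancel_right y c a, map_sub, map_neg]
    simp
  rw [this, h, neg_zero]

theorem eq_of_two_lines {a c c' y : Fin 3 → ℤ} (h : (c - a) ⨯₃ (y - a) = 0)
    (h' : (c' - a) ⨯₃ (y - a) = 0) (hne : (c - a) ⨯₃ (c' - a) ≠ 0) : y = a :=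
  sub_eq_zero.mp (eq_zero_of_cross_eq_zero h h' hne)

/-- If all relative interior points of a facet are congruent, the facet point is the only one in its
class. -/
theorem eq_p_of_parity {i : Fin 6} (hi : ∀ r, S.RelInt i r → parity r = parity (S.p i))
    {q : Fin 3 → ℤ} (hq : q ∈ S.V) (h : parity q = parity (S.p i)) : q = S.p i := by
  refine sub_eq_zero.mp (eq_zero_of_halving
    (fun x => x ∈ S.V ∧ parity x = parity (S.p i)) (fun x => x - S.p i) ?_ ⟨hq, h⟩)
  rintro x ⟨hx, hxp⟩
  obtain ⟨m, hm⟩ := exists_midpoint hxp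
  refine ⟨m, ⟨mem_V_of_add hm hx (p_mem_V i), hi m ?_⟩, ?_⟩
  · exact (relInt_p i).mid hm hx ((relInt_p i).gap_eq_zero hx hxp)
  · rw [sub_add_sub_comm, ← hm, add_sub_add_right_eq_sub]

/-- If the relative interior of a facet meets only two classes, the points in these classes are
collinear. -/
theorem cross_eq_zero_of_parity {i : Fin 6} {p' : Fin 3 → ℤ} (hp' : S.RelInt i p')
    (hi : ∀ r, S.RelInt i r → parity r = parity (S.p i) ∨ parity r = parity p')
    {w : Fin 3 → ℤ} (hw : w ∈ S.V) (h : parity w = parity (S.p i) ∨ parity w = parity p') :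
    (w - S.p i) ⨯₃ (p' - S.p i) = 0 := by
  refine eq_zero_of_halving
    (fun x => x ∈ S.V ∧ (parity x = parity (S.p i) ∨ parity x = parity p'))
    (fun x => (x - S.p i) ⨯₃ (p' - S.p i)) ?_ ⟨hw, h⟩
  rintro x ⟨hx, hxp⟩
  have key : ∀ q, S.RelInt i q → parity x = parity q → (q - S.p i) ⨯₃ (p' - S.p i) = 0 →
      ∃ y, (y ∈ S.V ∧ (parity y = parity (S.p i) ∨ parity y = parity p')) ∧
        (x - S.p i) ⨯₃ (p' - S.p i) =
          (y - S.p i) ⨯₃ (p' - S.p i) + (y - S.p i) ⨯₃ (p' - S.p i) := by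
    intro q hq hxq hcr
    obtain ⟨m, hm⟩ := exists_midpoint hxq
    refine ⟨m, ⟨mem_V_of_add hm hx hq.mem_V, hi m ?_⟩, ?_⟩
    · exact hq.mid hm hx (hq.gap_eq_zero hx hxq)
    · rw [← sub_cross_add hm, hcr, add_zero]
  rcases hxp with e | e
  · exact key _ (relInt_p i) e (by simp)
  · exact key _ hp' e (cross_self _)

theorem line_of_parity {i : Fin 6} {x u v : Fin 3 → ℤ} {A : Fin 3 → ZMod 2}
    (hA : ∀ v ∈ S.W i, v = x ∨ parity v = A) (huv : u ≠ v) (hu : u ∈ S.W i) (hv : v ∈ S.W i)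
    (hu' : parity u = A) (hv' : parity v = A) :
    (v - u) ⨯₃ (S.p i - u) = 0 ∨ (v - u) ⨯₃ (x - u) = 0 := by
  by_contra! hcon
  refine huv (sub_eq_zero.mp (eq_zero_of_halving
    (fun w => (w ∈ S.V ∧ S.gap i w = 0) ∧ parity w = A ∧ (w - u) ⨯₃ (v - u) = 0) (fun w => w - u)
    ?_ ⟨⟨hv.1, hv.2.1⟩, hv', cross_self _⟩)).symm
  rintro w ⟨⟨hw, hwi⟩, hwA, hwc⟩
  obtain ⟨m, hm⟩ := exists_midpoint (hwA.trans hu'.symm)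
  have hmc : (m - u) ⨯₃ (v - u) = 0 := sub_cross_mid hm hwc (by simp)
  have hmV := mem_V_of_add hm hw hu.1
  have hmi := gap_mid_eq_zero hm hwi hu.2.1
  refine ⟨m, ⟨⟨hmV, hmi⟩, (hA m ⟨hmV, hmi, ?_⟩).resolve_left ?_, hmc⟩, ?_⟩
  · rintro rfl
    exact hcon.1 (cross_comm_eq_zero hmc)
  · rintro rfl
    exact hcon.2 (cross_comm_eq_zero hmc)
  · rw [sub_add_sub_comm, ← hm, add_sub_add_right_eq_sub]

theorem area_sub_right (i : Fin 6) (e x y z : Fin 3 → ℤ) :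
    S.area i e (x - y) = S.area i e (x - z) - S.area i e (y - z) := by
  have : toReal (e ⨯₃ (x - y)) = toReal (e ⨯₃ (x - z)) - toReal (e ⨯₃ (y - z)) := by
    rw [← toReal_sub, ← map_sub, sub_sub_sub_cancel_right]
  rw [area, this, dotProduct_sub, area, area]

theorem area_eq_zero {i : Fin 6} {a c : Fin 3 → ℤ} (h : a ⨯₃ c = 0) : S.area i a c = 0 := by
  rw [area, h, show toReal 0 = 0 by funext j; simp [toReal], dotProduct_zero]

theorem W_sub (i : Fin 6) {x y : Fin 3 → ℤ} (hx : S.gap i x = 0) (hy : S.gap i y = 0) :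
    S.N i ⬝ᵥ toReal (x - y) = 0 := by rw [N_dotProduct_sub, hx, hy, sub_zero]

/-- Two points other than the vertices of a triangle do not meet all three lines spanned by its
edges. -/
theorem false_of_triangle {u v v' p x : Fin 3 → ℤ} (hn : (v' - v) ⨯₃ (u - v) ≠ 0)
    (pu : p ≠ u) (pv : p ≠ v) (pv' : p ≠ v') (xu : x ≠ u) (xv : x ≠ v) (xv' : x ≠ v')
    (l : (v' - v) ⨯₃ (p - v) = 0 ∨ (v' - v) ⨯₃ (x - v) = 0)
    (l1 : (v - u) ⨯₃ (p - u) = 0 ∨ (v - u) ⨯₃ (x - u) = 0)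
    (l2 : (v' - u) ⨯₃ (p - u) = 0 ∨ (v' - u) ⨯₃ (x - u) = 0) : False := by
  have hn' : (v - v') ⨯₃ (u - v') ≠ 0 := fun h => hn (cross_swap h)
  have hn'' : (v - u) ⨯₃ (v' - u) ≠ 0 := fun h => hn (cross_comm_eq_zero (cross_swap h))
  have key : ∀ y, y ≠ u → y ≠ v → y ≠ v' →
      ((v - u) ⨯₃ (y - u) = 0 → (v' - u) ⨯₃ (y - u) = 0 → False) ∧
      ((v - u) ⨯₃ (y - u) = 0 → (v' - v) ⨯₃ (y - v) = 0 → False) ∧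
      ((v' - u) ⨯₃ (y - u) = 0 → (v' - v) ⨯₃ (y - v) = 0 → False) := by
    intro y hyu hyv hyv'
    refine ⟨fun h h' => hyu (eq_of_two_lines h h' hn''),
      fun h h' => hyv (eq_of_two_lines h' (cross_swap h) hn),
      fun h h' => hyv' (eq_of_two_lines (cross_swap h') (cross_swap h) hn')⟩
  obtain ⟨p1, p2, p3⟩ := key p pu pv pv'
  obtain ⟨x1, x2, x3⟩ := key x xu xv xv'
  rcases l with l | l <;> rcases l1 with l1 | l1
  · exact p2 l1 l
  · exact l2.elim (fun h => p3 h l) (fun h => x1 l1 h)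
  · exact l2.elim (fun h => p1 l1 h) (fun h => x3 h l)
  · exact x2 l1 l

theorem not_forall_parity_of_mem {i : Fin 6} {x : Fin 3 → ℤ} {A : Fin 3 → ZMod 2}
    (hx : x ∈ S.W i) (hA : ∀ v ∈ S.W i, v = x ∨ parity v = A) : False := by
  have hA' : ∀ v ∈ S.W i, v ≠ x → parity v = A := fun v hv h => (hA v hv).resolve_left h
  have hd := W_sub i hx.2.1 (relInt_p (S := S) i).1
  have hd0 : x - S.p i ≠ 0 := sub_ne_zero.mpr hx.2.2
  obtain ⟨v, hv, hvd⟩ := exists_area_pos i hd0 hd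
  obtain ⟨v', hv', hvd'⟩ := exists_area_neg i hd0 hd
  have hvx : v ≠ x := by rintro rfl; exact hvd.ne' (area_eq_zero (cross_self _))
  have hvx' : v' ≠ x := by rintro rfl; exact hvd'.ne (area_eq_zero (cross_self _))
  have hne : v ≠ v' := by rintro rfl; exact lt_asymm hvd hvd'
  have he := W_sub i hv'.2.1 hv.2.1
  have he0 : v' - v ≠ 0 := sub_ne_zero.mpr hne.symm
  have hvv := line_of_parity hA hne hv hv' (hA' v hv hvx) (hA' v' hv' hvx')
  obtain ⟨u1, hu1, h1⟩ := exists_area_pos i he0 he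
  obtain ⟨u2, hu2, h2⟩ := exists_area_neg i he0 he
  obtain ⟨u, hu, hux, hua⟩ : ∃ u ∈ S.W i, u ≠ x ∧ S.area i (v' - v) (u - v) ≠ 0 := by
    have e1 := area_sub_right (S := S) i (v' - v) u1 v (S.p i)
    have e2 := area_sub_right (S := S) i (v' - v) u2 v (S.p i)
    have e3 := area_sub_right (S := S) i (v' - v) (S.p i) v (S.p i)
    rw [sub_self (S.p i), area_eq_zero (c := 0) (by simp)] at e3
    rcases lt_trichotomy (S.area i (v' - v) (v - S.p i)) 0 with h | h | h
    · refine ⟨u1, hu1, ?_, by linarith⟩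
      rintro rfl
      rcases hvv with hvv | hvv <;> have := area_eq_zero (S := S) (i := i) hvv <;> linarith
    · by_cases hx1 : u1 = x
      · refine ⟨u2, hu2, ?_, by linarith⟩
        rintro rfl
        rw [hx1] at h1
        exact lt_asymm h1 h2
      · exact ⟨u1, hu1, hx1, by linarith⟩
    · refine ⟨u2, hu2, ?_, by linarith⟩
      rintro rfl
      rcases hvv with hvv | hvv <;> have := area_eq_zero (S := S) (i := i) hvv <;> linarith
  have hn : (v' - v) ⨯₃ (u - v) ≠ 0 := fun h => hua (area_eq_zero h)
  have huv : u ≠ v := by rintro rfl; exact hn (by simp)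
  have huv' : u ≠ v' := by rintro rfl; exact hn (cross_self _)
  have huA := hA' u hu hux
  have l1 := line_of_parity hA huv hu hv huA (hA' v hv hvx)
  have l2 := line_of_parity hA huv' hu hv' huA (hA' v' hv' hvx')
  exact false_of_triangle hn hu.2.2.symm hv.2.2.symm hv'.2.2.symm hux.symm hvx.symm hvx'.symm
    hvv l1 l2

/-- The lattice points of a facet, other than the chosen one and one further point, do not all lie
in one class. -/
theorem not_forall_parity {i : Fin 6} (x : Fin 3 → ℤ) {A : Fin 3 → ZMod 2}
    (hA : ∀ v ∈ S.W i, v = x ∨ parity v = A) : False := by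
  by_cases hx : x ∈ S.W i
  · exact not_forall_parity_of_mem hx hA
  · obtain ⟨y, hy⟩ := exists_mem_W (S := S) i
    refine not_forall_parity_of_mem hy fun v hv => Or.inr ((hA v hv).resolve_left ?_)
    rintro rfl
    exact hx hv

/-- A line through the chosen point of another facet meets a facet at most once. -/
theorem eq_of_line {i k : Fin 6} (hk : k ≠ i) {e x y : Fin 3 → ℤ} (he : e ≠ 0)
    (hx : S.gap k x = 0) (hy : S.gap k y = 0) (hxe : (x - S.p i) ⨯₃ e = 0)
    (hye : (y - S.p i) ⨯₃ e = 0) : x = y := by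
  by_contra hxy
  have h : (x - S.p i) ⨯₃ (y - S.p i) = 0 :=
    by_contra fun h => he (eq_zero_of_cross_eq_zero hxe hye h)
  have := gap_eq_zero_of_cross (cross_comm_eq_zero (cross_swap h)) hxy hx hy
  exact hk (gap_p_eq_zero_iff.mp this)

theorem exists_eq_of_line {i k : Fin 6} (hk : k ≠ i) {e : Fin 3 → ℤ} (he : e ≠ 0) :
    ∃ x, ∀ v, S.gap k v = 0 → (v - S.p i) ⨯₃ e = 0 → v = x := by
  by_cases h : ∃ x, S.gap k x = 0 ∧ (x - S.p i) ⨯₃ e = 0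
  · obtain ⟨x, hx, hxe⟩ := h
    exact ⟨x, fun v hv hve => eq_of_line hk he hv hx hve hxe⟩
  · push Not at h
    exact ⟨0, fun v hv hve => absurd hve (h v hv)⟩

theorem eq_of_relInt_parity {i j : Fin 6} {r r' : Fin 3 → ℤ} (hr : S.RelInt i r)
    (hr' : S.RelInt j r') (h : parity r = parity r') : i = j := by
  by_contra e
  exact (hr'.2 i e).ne' (hr.gap_eq_zero hr'.mem_V h.symm)

theorem card_parity : Fintype.card (Fin 3 → ZMod 2) = 8 := by simp [ZMod.card]

/-- The relative interior points of a facet are congruent to each other. -/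
theorem parity_of_relInt {i : Fin 6} {r : Fin 3 → ℤ} (hr : S.RelInt i r) :
    parity r = parity (S.p i) := by
  by_contra hne
  have hne' : r - S.p i ≠ 0 := sub_ne_zero.mpr fun h => hne (congrArg parity h)
  obtain ⟨A, hAp, hA⟩ : ∃ A, (∀ j, A ≠ parity (S.p j)) ∧
      ∀ c, c ≠ A → c ≠ parity r → ∃ j, c = parity (S.p j) := by
    classical
    let s := insert (parity r) (Finset.univ.image fun j => parity (S.p j))
    have hs : s.card = 7 := by
      rw [Finset.card_insert_of_notMem, Finset.card_image_of_injective _ parity_p_injective]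
      · simp
      · simp only [Finset.mem_image, Finset.mem_univ, true_and, not_exists]
        intro j hj
        exact hne (eq_of_relInt_parity (relInt_p j) hr hj ▸ hj.symm)
    have hc : sᶜ.card = 1 := by rw [Finset.card_compl, card_parity, hs]
    obtain ⟨A, hA⟩ := Finset.card_eq_one.mp hc
    refine ⟨A, fun j hj => ?_, fun c hcA hcr => ?_⟩
    · have : A ∈ sᶜ := hA ▸ Finset.mem_singleton_self A
      rw [Finset.mem_compl, hj] at this
      exact this (Finset.mem_insert_of_mem (Finset.mem_image_of_mem _ (Finset.mem_univ j)))
    have : c ∈ s := by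
      by_contra h
      rw [← Finset.mem_compl, hA, Finset.mem_singleton] at h
      exact hcA h
    simpa [s, hcr, eq_comm] using this
  have hcl : ∀ j q, S.RelInt j q → j ≠ i → parity q ≠ A → parity q = parity (S.p j) := by
    intro j q hq hj hqA
    obtain ⟨l, hl⟩ := hA _ hqA fun h => hj (eq_of_relInt_parity hq hr h)
    exact eq_of_relInt_parity (relInt_p l) hq hl.symm ▸ hl
  have hcli : ∀ q, S.RelInt i q → parity q ≠ A →
      parity q = parity (S.p i) ∨ parity q = parity r := by
    intro q hq hqA
    by_cases hqr : parity q = parity r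
    · exact Or.inr hqr
    · obtain ⟨l, hl⟩ := hA _ hqA hqr
      exact Or.inl (eq_of_relInt_parity (relInt_p l) hq hl.symm ▸ hl)
  have hW : ∀ k v, v ∈ S.W k → ∀ l, parity v = parity (S.p l) → l ≠ i →
      (∀ q, S.RelInt l q → parity q ≠ A) → False := by
    intro k v hv l hl hli hlA
    have := eq_p_of_parity (fun q hq => hcl l q hq hli (hlA q hq)) hv.1 hl
    subst this
    exact hv.2.2 (congrArg S.p (gap_p_eq_zero_iff.mp hv.2.1)).symm
  by_cases hex : ∃ j q, S.RelInt j q ∧ parity q = A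
  · obtain ⟨j, q, hq, hqA⟩ := hex
    have hlA : ∀ l, l ≠ j → ∀ q', S.RelInt l q' → parity q' ≠ A := fun l hl q' hq' h =>
      hl (eq_of_relInt_parity hq' hq (h.trans hqA.symm))
    by_cases hji : j = i
    · subst hji
      obtain ⟨k, hk⟩ := exists_ne j
      obtain ⟨v, hv, hvi⟩ := exists_mem_W_gap_ne_zero (S := S) hk
      by_cases hvA : parity v = A
      · exact hvi (hq.gap_eq_zero hv.1 (hvA.trans hqA.symm))
      by_cases hvr : parity v = parity r
      · exact hvi (hr.gap_eq_zero hv.1 hvr)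
      obtain ⟨l, hl⟩ := hA _ hvA hvr
      by_cases hlj : l = j
      · exact hvi ((relInt_p j).gap_eq_zero hv.1 (hlj ▸ hl))
      · exact hW k v hv l hl hlj (hlA l hlj)
    · obtain ⟨k, hki, hkj⟩ : ∃ k, k ≠ i ∧ k ≠ j :=
        (by decide : ∀ i j : Fin 6, ∃ k, k ≠ i ∧ k ≠ j) i j
      have hqj : q - S.p j ≠ 0 := by
        refine sub_ne_zero.mpr fun h => ?_
        exact hAp j (by rw [← hqA, h])
      obtain ⟨x, hx⟩ := exists_eq_of_line (S := S) hki hne'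
      obtain ⟨y, hy⟩ := exists_eq_of_line (S := S) hkj hqj
      refine not_forall_parity (S := S) (i := k) x (A := parity y) fun v hv => ?_
      have hlj : (parity v = parity (S.p j) ∨ parity v = parity q) → parity v = parity y := by
        refine fun h => congrArg parity (hy v hv.2.1 (cross_eq_zero_of_parity hq ?_ hv.1 h))
        intro q' hq'
        by_cases h : parity q' = A
        · exact Or.inr (h.trans hqA.symm)
        · exact Or.inl (hcl j q' hq' hji h)
      have hli : (parity v = parity (S.p i) ∨ parity v = parity r) → v = x := fun h =>
        hx v hv.2.1 (cross_eq_zero_of_parity hr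
          (fun q' hq' => hcli q' hq' (hlA i (Ne.symm hji) q' hq')) hv.1 h)
      by_cases hvA : parity v = A
      · exact Or.inr (hlj (Or.inr (hvA.trans hqA.symm)))
      by_cases hvr : parity v = parity r
      · exact Or.inl (hli (Or.inr hvr))
      obtain ⟨l, hl⟩ := hA _ hvA hvr
      by_cases hil : l = i
      · exact Or.inl (hli (Or.inl (hil ▸ hl)))
      by_cases hjl : l = j
      · exact Or.inr (hlj (Or.inl (hjl ▸ hl)))
      · exact (hW k v hv l hl hil (hlA l hjl)).elim
  · push Not at hex
    obtain ⟨k, hk⟩ := exists_ne i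
    obtain ⟨x, hx⟩ := exists_eq_of_line (S := S) hk hne'
    refine not_forall_parity (S := S) (i := k) x (A := A) fun v hv => ?_
    by_cases hvA : parity v = A
    · exact Or.inr hvA
    refine Or.inl (hx v hv.2.1 (cross_eq_zero_of_parity hr (fun q hq => hcli q hq (hex i q hq))
      hv.1 ?_))
    by_cases hvr : parity v = parity r
    · exact Or.inr hvr
    obtain ⟨l, hl⟩ := hA _ hvA hvr
    by_cases hli : l = i
    · exact Or.inl (hli ▸ hl)
    · exact (hW k v hv l hl hli (hex l)).elim

theorem eq_p {i : Fin 6} {q : Fin 3 → ℤ} (hq : q ∈ S.V) (h : parity q = parity (S.p i)) :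
    q = S.p i :=
  eq_p_of_parity (fun _ hr => parity_of_relInt hr) hq h

/-- The two classes not represented by the chosen facet points. -/
structure FreeClasses (S : SixFacets) (A B : Fin 3 → ZMod 2) : Prop where
  ne : A ≠ B
  left : ∀ j, A ≠ parity (S.p j)
  right : ∀ j, B ≠ parity (S.p j)
  cover : ∀ c, c = A ∨ c = B ∨ ∃ j, c = parity (S.p j)

theorem FreeClasses.symm {A B : Fin 3 → ZMod 2} (h : S.FreeClasses A B) : S.FreeClasses B A :=
  ⟨h.ne.symm, h.right, h.left, fun c => or_left_comm.mp (h.cover c)⟩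

theorem exists_freeClasses (S : SixFacets) : ∃ A B, S.FreeClasses A B := by
  classical
  let s := Finset.univ.image fun j => parity (S.p j)
  have hs : s.card = 6 := by
    rw [Finset.card_image_of_injective _ parity_p_injective]
    simp
  have hc : sᶜ.card = 2 := by rw [Finset.card_compl, card_parity, hs]
  obtain ⟨A, B, hne, hAB⟩ := Finset.card_eq_two.mp hc
  have hm : ∀ c, (∀ j, c ≠ parity (S.p j)) ↔ c = A ∨ c = B := by
    intro c
    have : c ∈ sᶜ ↔ c ∈ ({A, B} : Finset _) := by rw [hAB]
    simpa [s, eq_comm] using this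
  refine ⟨A, B, hne, (hm A).mpr (Or.inl rfl), (hm B).mpr (Or.inr rfl), fun c => ?_⟩
  by_cases h : ∃ j, c = parity (S.p j)
  · exact Or.inr (Or.inr h)
  · push Not at h
    exact ((hm c).mp h).imp_right Or.inl

theorem FreeClasses.mem_cases {A B : Fin 3 → ZMod 2} (h : S.FreeClasses A B) {q : Fin 3 → ℤ}
    (hq : q ∈ S.V) : parity q = A ∨ parity q = B ∨ ∃ j, q = S.p j :=
  (h.cover (parity q)).imp_right (Or.imp_right fun ⟨j, hj⟩ => ⟨j, eq_p hq hj⟩)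

theorem FreeClasses.gap_cases {A B : Fin 3 → ZMod 2} (h : S.FreeClasses A B) {q : Fin 3 → ℤ}
    {i : Fin 6} (hq : q ∈ S.V) (hi : S.gap i q = 0) : parity q = A ∨ parity q = B ∨ q = S.p i := by
  refine (h.mem_cases hq).imp_right (Or.imp_right ?_)
  rintro ⟨j, rfl⟩
  rw [gap_p_eq_zero_iff.mp hi]

theorem parity_add (x y : Fin 3 → ℤ) : parity (x + y) = parity x + parity y := by
  funext j
  simp [parity]

/-- Two points of one free class whose midpoint lies in the other free class. -/
structure Bad (S : SixFacets) (A B : Fin 3 → ZMod 2) (x y z : Fin 3 → ℤ) : Prop where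
  free : S.FreeClasses A B
  hx : x ∈ S.V
  hy : y ∈ S.V
  ne : x ≠ y
  px : parity x = A
  py : parity y = A
  pz : parity z = B
  mid : x + y = z + z

namespace Bad

variable {A B : Fin 3 → ZMod 2} {x y z : Fin 3 → ℤ}

theorem hz (h : S.Bad A B x y z) : z ∈ S.V := mem_V_of_add h.mid h.hx h.hy

theorem ne_xz (h : S.Bad A B x y z) : x ≠ z := by
  rintro rfl
  exact h.free.ne (h.px.symm.trans h.pz)

theorem cross_y (h : S.Bad A B x y z) : (y - z) ⨯₃ (x - z) = 0 := by
  have : y - z = -(x - z) := by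
    have := h.mid
    rw [neg_sub, sub_eq_sub_iff_add_eq_add, add_comm y x, this]
  rw [this, map_neg, LinearMap.neg_apply, cross_self, neg_zero]

theorem cross_of_left (h : S.Bad A B x y z) {i : Fin 6} (hi : S.gap i z = 0) {q : Fin 3 → ℤ}
    (hq : q ∈ S.V) (hqi : S.gap i q = 0) (hqA : parity q = A) : (q - z) ⨯₃ (x - z) = 0 := by
  have hxi := gap_eq_zero_left h.mid h.hx h.hy hi
  have hyi := gap_eq_zero_right h.mid h.hx h.hy hi
  refine eq_zero_of_halving (fun w => (w ∈ S.V ∧ S.gap i w = 0) ∧ parity w = A)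
    (fun w => (w - z) ⨯₃ (x - z)) ?_ ⟨⟨hq, hqi⟩, hqA⟩
  rintro w ⟨⟨hw, hwi⟩, hwA⟩
  obtain ⟨m₁, e₁⟩ := exists_midpoint (hwA.trans h.px.symm)
  obtain ⟨m₂, e₂⟩ := exists_midpoint (hwA.trans h.py.symm)
  have v₁ := mem_V_of_add e₁ hw h.hx
  have v₂ := mem_V_of_add e₂ hw h.hy
  have g₁ := gap_mid_eq_zero e₁ hwi hxi
  have g₂ := gap_mid_eq_zero e₂ hwi hyi
  have key : parity m₁ = A ∨ parity m₂ = A := by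
    have e : m₂ + x = m₁ + z := by
      funext l
      have a₁ := congrFun e₁ l
      have a₂ := congrFun e₂ l
      have a₃ := congrFun h.mid l
      simp only [Pi.add_apply] at a₁ a₂ a₃ ⊢
      omega
    have e' : parity m₂ + A = parity m₁ + B := by
      rw [← h.pz, ← h.px, ← parity_add, ← parity_add, e]
    have two : ∀ c : Fin 3 → ZMod 2, c + c = 0 := fun c => funext fun _ =>
      CharTwo.add_self_eq_zero _
    rcases h.free.gap_cases v₁ g₁ with c₁ | c₁ | c₁
    · exact Or.inl c₁
    · rw [c₁, two B, ← two A] at e'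
      exact Or.inr (add_right_cancel e')
    · rcases h.free.gap_cases v₂ g₂ with c₂ | c₂ | c₂
      · exact Or.inr c₂
      · rw [c₁, c₂, add_comm] at e'
        exact absurd (add_right_cancel e') (h.free.left i)
      · rw [c₁, c₂] at e'
        exact absurd (add_left_cancel e') h.free.ne
  rcases key with k | k
  · exact ⟨m₁, ⟨⟨v₁, g₁⟩, k⟩, by rw [← sub_cross_add e₁, cross_self, add_zero]⟩
  · exact ⟨m₂, ⟨⟨v₂, g₂⟩, k⟩, by rw [← sub_cross_add e₂, h.cross_y, add_zero]⟩

theorem cross_of_right (h : S.Bad A B x y z) {i : Fin 6} (hi : S.gap i z = 0) {q : Fin 3 → ℤ}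
    (hq : q ∈ S.V) (hqi : S.gap i q = 0) (hqB : parity q = B) (hqp : q + z ≠ S.p i + S.p i) :
    (q - z) ⨯₃ (x - z) = 0 := by
  refine eq_zero_of_halving
    (fun w => (w ∈ S.V ∧ S.gap i w = 0) ∧ parity w = B ∧ w + z ≠ S.p i + S.p i)
    (fun w => (w - z) ⨯₃ (x - z)) ?_ ⟨⟨hq, hqi⟩, hqB, hqp⟩
  rintro w ⟨⟨hw, hwi⟩, hwB, hwp⟩
  obtain ⟨m, hm⟩ := exists_midpoint (hwB.trans h.pz.symm)
  have hmV := mem_V_of_add hm hw h.hz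
  have hmi := gap_mid_eq_zero hm hwi hi
  have hμ : (w - z) ⨯₃ (x - z) = (m - z) ⨯₃ (x - z) + (m - z) ⨯₃ (x - z) := by
    rw [← sub_cross_add hm, sub_self z, map_zero, LinearMap.zero_apply, add_zero]
  rcases h.free.gap_cases hmV hmi with c | c | c
  · refine ⟨w, ⟨⟨hw, hwi⟩, hwB, hwp⟩, ?_⟩
    rw [hμ, h.cross_of_left hi hmV hmi c]
    simp
  · refine ⟨m, ⟨⟨hmV, hmi⟩, c, fun e => ?_⟩, hμ⟩
    obtain ⟨n, hn⟩ := exists_midpoint (hwB.trans c.symm)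
    have hnV := mem_V_of_add hn hw hmV
    have hnp : n = S.p i := by
      refine eq_p hnV (parity_eq_iff.mpr fun l => ?_)
      have a₁ := congrFun hm l
      have a₂ := congrFun e l
      have a₃ := congrFun hn l
      simp only [Pi.add_apply] at a₁ a₂ a₃
      omega
    refine h.free.right i ?_
    rw [← h.pz, ← hnp]
    congr 1
    funext l
    have a₁ := congrFun hm l
    have a₂ := congrFun e l
    have a₃ := congrFun hn l
    have a₄ := congrFun hnp l
    simp only [Pi.add_apply] at a₁ a₂ a₃
    omega
  · exact absurd (c ▸ hm) hwp

theorem gap_of_cross (h : S.Bad A B x y z) {i : Fin 6} (hi : S.gap i z = 0) {q : Fin 3 → ℤ}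
    (hq : (q - z) ⨯₃ (x - z) = 0) : S.gap i q = 0 :=
  gap_eq_zero_of_cross (cross_comm_eq_zero hq) h.ne_xz.symm hi (gap_eq_zero_left h.mid h.hx h.hy hi)

theorem cross_p_ne_zero (h : S.Bad A B x y z) {i j : Fin 6} (hij : i ≠ j) (hj : S.gap j z = 0) :
    (S.p i - z) ⨯₃ (x - z) ≠ 0 := fun e =>
  hij (gap_p_eq_zero_iff.mp (h.gap_of_cross hj e)).symm

theorem gap_ne_zero (h : S.Bad A B x y z) {i j k : Fin 6} (hij : i ≠ j) (hi : S.gap i z = 0)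
    (hj : S.gap j z = 0) (hki : k ≠ i) (hkj : k ≠ j) : S.gap k z ≠ 0 := fun hk =>
  h.ne_xz (eq_of_three_facets hij hki.symm hkj.symm (gap_eq_zero_left h.mid h.hx h.hy hi)
    (gap_eq_zero_left h.mid h.hx h.hy hj) (gap_eq_zero_left h.mid h.hx h.hy hk) hi hj hk)

theorem right_cases (h : S.Bad A B x y z) {i j : Fin 6} (hij : i ≠ j) (hi : S.gap i z = 0)
    (hj : S.gap j z = 0) {q : Fin 3 → ℤ} (hq : q ∈ S.V) (hqB : parity q = B) :
    (q - z) ⨯₃ (x - z) = 0 ∨ q + z = S.p i + S.p i ∨ q + z = S.p j + S.p j := by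
  obtain ⟨m, hm⟩ := exists_midpoint (hqB.trans h.pz.symm)
  obtain ⟨l, hl⟩ := exists_gap_eq_zero (mem_V_of_add hm hq h.hz)
  have hlq := gap_eq_zero_left hm hq h.hz hl
  have hlz := gap_eq_zero_right hm hq h.hz hl
  by_contra! hcon
  by_cases hli : l = i
  · subst hli
    exact hcon.1 (h.cross_of_right hlz hq hlq hqB hcon.2.1)
  by_cases hlj : l = j
  · subst hlj
    exact hcon.1 (h.cross_of_right hlz hq hlq hqB hcon.2.2)
  exact h.gap_ne_zero hij hi hj hli hlj hlz

/-- A facet off the line of the bad triple contains at most one point of the second class if it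
contains none of the reflections at `p j`. -/
theorem false_of_forall_ne (h : S.Bad A B x y z) {i j k : Fin 6} (hij : i ≠ j)
    (hi : S.gap i z = 0) (hj : S.gap j z = 0) (hki : k ≠ i) (hkj : k ≠ j)
    (hk : ∀ t, S.gap k t = 0 → t + z ≠ S.p j + S.p j) : False := by
  have hkz := h.gap_ne_zero hij hi hj hki hkj
  have hline : ∀ u ∈ S.W k, ∀ v ∈ S.W k, parity v = B → (u - z) ⨯₃ (x - z) = 0 →
      parity u = B → u = v := by
    intro u hu v hv hvB hul huB
    by_contra huv
    rcases h.right_cases hij hi hj hv.1 hvB with e | e | e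
    · have huv' : (u - z) ⨯₃ (v - z) = 0 := by_contra fun hne =>
        sub_ne_zero.mpr h.ne_xz (eq_zero_of_cross_eq_zero hul e hne)
      exact hkz (gap_eq_zero_of_cross (cross_comm_eq_zero (cross_swap huv')) huv hu.2.1 hv.2.1)
    · have hpn := h.cross_p_ne_zero hij hj
      have hvn : (v - z) ⨯₃ (x - z) ≠ 0 := fun e' => hpn (sub_cross_mid e e' (by simp))
      have hui := h.gap_of_cross hi hul
      have hvi : S.gap i v = 0 := gap_eq_zero_left e hv.1 h.hz (relInt_p i).1
      obtain ⟨n, hn⟩ := exists_midpoint (hvB.trans huB.symm)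
      have hnV := mem_V_of_add hn hv.1 hu.1
      have hni := gap_mid_eq_zero hn hvi hui
      have hnn : (n - z) ⨯₃ (x - z) ≠ 0 := by
        intro e'
        have := sub_cross_add hn z (x - z)
        rw [hul, e', add_zero, add_zero] at this
        exact hvn this
      rcases h.free.gap_cases hnV hni with c | c | c
      · exact hnn (h.cross_of_left hi hnV hni c)
      · refine hnn (h.cross_of_right hi hnV hni c fun e' => huv ?_)
        rw [← add_right_cancel (e'.trans e.symm)] at hn
        rw [← add_right_cancel (e'.trans e.symm)]
        exact add_left_cancel hn
      · rw [c, ← e] at hn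
        exact hkz (add_left_cancel hn ▸ hu.2.1)
    · exact hk v hv.2.1 e
  have honly : ∀ u ∈ S.W k, ∀ v ∈ S.W k, parity u = B → parity v = B → u = v := by
    intro u hu v hv huB hvB
    rcases h.right_cases hij hi hj hu.1 huB with e | e | e
    · exact hline u hu v hv hvB e huB
    · rcases h.right_cases hij hi hj hv.1 hvB with e' | e' | e'
      · exact (hline v hv u hu huB e' hvB).symm
      · exact add_right_cancel (e.trans e'.symm)
      · exact absurd e' (hk v hv.2.1)
    · exact absurd e (hk u hu.2.1)
  have hcl : ∀ v ∈ S.W k, parity v ≠ B → parity v = A := fun v hv hvB =>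
    (h.free.gap_cases hv.1 hv.2.1).resolve_right fun c => c.elim hvB hv.2.2
  by_cases hex : ∃ t ∈ S.W k, parity t = B
  · obtain ⟨t, ht, htB⟩ := hex
    refine not_forall_parity (S := S) (i := k) t (A := A) fun v hv => ?_
    by_cases hvB : parity v = B
    · exact Or.inl (honly v hv t ht hvB htB)
    · exact Or.inr (hcl v hv hvB)
  · push Not at hex
    exact not_forall_parity (S := S) (i := k) 0 (A := A) fun v hv => Or.inr (hcl v hv (hex v hv))

theorem false (h : S.Bad A B x y z) : False := by
  obtain ⟨i, hi⟩ := exists_gap_eq_zero h.hz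
  obtain ⟨j, hji, hj⟩ : ∃ j, j ≠ i ∧ S.gap j z = 0 := by
    by_contra! hcon
    exact h.free.right i (h.pz ▸ parity_of_relInt ⟨hi, fun j hj =>
      lt_of_le_of_ne (h.hz j) (hcon j hj).symm⟩)
  have hall : ∀ k, k ≠ i → k ≠ j → (∃ t, S.gap k t = 0 ∧ t + z = S.p i + S.p i) ∧
      ∃ t, S.gap k t = 0 ∧ t + z = S.p j + S.p j := by
    intro k hki hkj
    by_contra! hcon
    by_cases h1 : ∃ t, S.gap k t = 0 ∧ t + z = S.p i + S.p i
    · exact h.false_of_forall_ne hji.symm hi hj hki hkj (hcon h1)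
    · push Not at h1
      exact h.false_of_forall_ne hji hj hi hkj hki h1
  obtain ⟨k₁, k₂, k₃, h₁₂, h₁₃, h₂₃, a₁, b₁, a₂, b₂, a₃, b₃⟩ :
      ∃ k₁ k₂ k₃ : Fin 6, k₁ ≠ k₂ ∧ k₁ ≠ k₃ ∧ k₂ ≠ k₃ ∧ k₁ ≠ i ∧ k₁ ≠ j ∧ k₂ ≠ i ∧ k₂ ≠ j ∧
        k₃ ≠ i ∧ k₃ ≠ j :=
    (by decide : ∀ i j : Fin 6, ∃ k₁ k₂ k₃ : Fin 6, k₁ ≠ k₂ ∧ k₁ ≠ k₃ ∧ k₂ ≠ k₃ ∧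
      k₁ ≠ i ∧ k₁ ≠ j ∧ k₂ ≠ i ∧ k₂ ≠ j ∧ k₃ ≠ i ∧ k₃ ≠ j) i j
  obtain ⟨⟨s, s₁, s'⟩, ⟨t, t₁, t'⟩⟩ := hall k₁ a₁ b₁
  obtain ⟨⟨s₂, s₃, s''⟩, ⟨t₂, t₃, t''⟩⟩ := hall k₂ a₂ b₂
  obtain ⟨⟨s₄, s₅, s'''⟩, ⟨t₄, t₅, t'''⟩⟩ := hall k₃ a₃ b₃
  obtain rfl := add_right_cancel (s''.trans s'.symm)
  obtain rfl := add_right_cancel (s'''.trans s'.symm)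
  obtain rfl := add_right_cancel (t''.trans t'.symm)
  obtain rfl := add_right_cancel (t'''.trans t'.symm)
  have := eq_of_three_facets h₁₂ h₁₃ h₂₃ s₁ s₃ s₅ t₁ t₃ t₅
  subst this
  have e := s'.symm.trans t'
  refine hji (p_injective (S := S) ?_).symm
  funext l
  have := congrFun e l
  simp only [Pi.add_apply] at this
  omega

end Bad

/-- Distinct lattice points in the same class are opposite with respect to a facet point. -/
theorem FreeClasses.exists_add_eq {A B : Fin 3 → ZMod 2} (h : S.FreeClasses A B)
    {x y : Fin 3 → ℤ} (hx : x ∈ S.V) (hy : y ∈ S.V) (hxy : x ≠ y) (hxA : parity x = A)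
    (hyA : parity y = A) : ∃ i, x + y = S.p i + S.p i := by
  by_contra! hcon
  refine hxy.symm (sub_eq_zero.mp (eq_zero_of_halving
    (fun w => w ∈ S.V ∧ parity w = A ∧ ∀ i, x + w ≠ S.p i + S.p i) (fun w => w - x) ?_
    ⟨hy, hyA, hcon⟩))
  rintro w ⟨hw, hwA, hwp⟩
  by_cases hxw : x = w
  · exact ⟨w, ⟨hw, hwA, hwp⟩, by simp [hxw]⟩
  obtain ⟨m, hm⟩ := exists_midpoint (hxA.trans hwA.symm)
  have hmV := mem_V_of_add hm hx hw
  have hmA : parity m = A := by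
    rcases h.mem_cases hmV with c | c | ⟨j, rfl⟩
    · exact c
    · exact (Bad.false ⟨h, hx, hw, hxw, hxA, hwA, c, hm⟩).elim
    · exact absurd hm (hwp j)
  have hmx : m - x + (m - x) = w - x := by
    rw [sub_add_sub_comm, ← hm, add_sub_add_left_eq_sub]
  refine ⟨m, ⟨hmV, hmA, fun i hi => ?_⟩, hmx.symm⟩
  obtain ⟨n, hn⟩ := exists_midpoint (hmA.trans hwA.symm)
  have hnV := mem_V_of_add hn hmV hw
  have hxm : x ≠ m := fun e => hxw (sub_eq_zero.mp (by rw [← hmx, ← e]; simp)).symm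
  have hni : n = S.p i := by
    refine eq_p hnV (parity_eq_iff.mpr fun l => ?_)
    have a₁ := congrFun hm l
    have a₂ := congrFun hi l
    have a₃ := congrFun hn l
    have a₄ := parity_eq_iff.mp (hxA.trans hmA.symm) l
    simp only [Pi.add_apply] at a₁ a₂ a₃
    omega
  apply hxm
  funext l
  have a₁ := congrFun hm l
  have a₂ := congrFun hi l
  have a₃ := congrFun hn l
  have a₄ := congrFun hni l
  simp only [Pi.add_apply] at a₁ a₂ a₃
  omega

end SixFacets

namespace SixFacets

variable {S : SixFacets} {A B : Fin 3 → ZMod 2}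

theorem FreeClasses.exists_mem_W (h : S.FreeClasses A B) (i : Fin 6) (x : Fin 3 → ℤ) :
    ∃ v ∈ S.W i, v ≠ x ∧ parity v = A := by
  by_contra! hcon
  refine not_forall_parity (S := S) (i := i) x (A := B) fun v hv => ?_
  by_cases hvx : v = x
  · exact Or.inl hvx
  · exact Or.inr (((h.gap_cases hv.1 hv.2.1).resolve_left (hcon v hv hvx)).resolve_right hv.2.2)

theorem FreeClasses.add_eq (h : S.FreeClasses A B) {i : Fin 6} {x y : Fin 3 → ℤ} (hx : x ∈ S.V)
    (hy : y ∈ S.V) (hxy : x ≠ y) (hxA : parity x = A) (hyA : parity y = A) (hxi : S.gap i x = 0)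
    (hyi : S.gap i y = 0) : x + y = S.p i + S.p i := by
  obtain ⟨j, hj⟩ := h.exists_add_eq hx hy hxy hxA hyA
  rwa [gap_p_eq_zero_iff.mp (gap_mid_eq_zero hj hxi hyi)]

theorem add_self_inj {x y : Fin 3 → ℤ} (h : x + x = y + y) : x = y := by
  funext l
  have := congrFun h l
  simp only [Pi.add_apply] at this
  omega

/-- The end points of the edges of a tetrahedron. -/
def edge : Fin 6 → Fin 4 × Fin 4 := ![(0, 1), (0, 2), (0, 3), (2, 3), (1, 3), (1, 2)]

/-- The incidence of edges and vertices of a tetrahedron. -/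
def inc (k : Fin 6) (j : Fin 4) : ℤ := if j = (edge k).1 ∨ j = (edge k).2 then 1 else 0

/-- An enumeration of the lattice points in a free class as the vertices of a tetrahedron whose
edges have the facet points as midpoints. -/
structure Frame (S : SixFacets) (A : Fin 3 → ZMod 2) (a : Fin 4 → Fin 3 → ℤ) (f : Fin 6 → Fin 6) :
    Prop where
  inj : Function.Injective a
  mem : ∀ i, a i ∈ S.V
  parity_eq : ∀ i, parity (a i) = A
  surj : ∀ v ∈ S.V, parity v = A → ∃ i, v = a i
  bij : Function.Bijective f
  add_eq : ∀ k, S.p (f k) + S.p (f k) = a (edge k).1 + a (edge k).2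

theorem FreeClasses.card_eq (h : S.FreeClasses A B) (F : Finset (Fin 3 → ℤ))
    (hF : ∀ v, v ∈ F ↔ v ∈ S.V ∧ parity v = A) : F.card = 4 := by
  classical
  let g : Fin 6 → Finset (Fin 3 → ℤ) := fun i => F.filter fun v => S.gap i v = 0
  have hg : ∀ i x y, x ∈ F → y ∈ F → x ≠ y → x + y = S.p i + S.p i → g i = {x, y} := by
    intro i x y hx hy hxy e
    rw [hF] at hx hy
    have hxi := gap_eq_zero_left e hx.1 hy.1 (relInt_p i).1
    have hyi := gap_eq_zero_right e hx.1 hy.1 (relInt_p i).1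
    ext v
    simp only [g, Finset.mem_filter, Finset.mem_insert, Finset.mem_singleton, hF]
    constructor
    · rintro ⟨⟨hv, hvA⟩, hvi⟩
      by_contra! hcon
      have e' := h.add_eq hx.1 hv hcon.1.symm hx.2 hvA hxi hvi
      exact hcon.2 (add_left_cancel (e'.trans e.symm))
    · rintro (rfl | rfl)
      · exact ⟨hx, hxi⟩
      · exact ⟨hy, hyi⟩
  have hg' : ∀ i, ∃ x y, x ∈ F ∧ y ∈ F ∧ x ≠ y ∧ x + y = S.p i + S.p i := by
    intro i
    obtain ⟨x, hx, -, hxA⟩ := h.exists_mem_W i 0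
    obtain ⟨y, hy, hyx, hyA⟩ := h.exists_mem_W i x
    exact ⟨x, y, (hF x).mpr ⟨hx.1, hxA⟩, (hF y).mpr ⟨hy.1, hyA⟩, hyx.symm,
      h.add_eq hx.1 hy.1 hyx.symm hxA hyA hx.2.1 hy.2.1⟩
  have hcard : (F.powersetCard 2).card = 6 := by
    have : F.powersetCard 2 = Finset.univ.image g := by
      ext t
      simp only [Finset.mem_powersetCard, Finset.mem_image, Finset.mem_univ, true_and]
      constructor
      · rintro ⟨ht, hc⟩
        obtain ⟨x, y, hxy, rfl⟩ := Finset.card_eq_two.mp hc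
        have hx : x ∈ F := ht (by simp)
        have hy : y ∈ F := ht (by simp)
        have hx' := (hF x).mp hx
        have hy' := (hF y).mp hy
        obtain ⟨i, hi⟩ := h.exists_add_eq hx'.1 hy'.1 hxy hx'.2 hy'.2
        exact ⟨i, hg i x y hx hy hxy hi⟩
      · rintro ⟨i, rfl⟩
        obtain ⟨x, y, hx, hy, hxy, e⟩ := hg' i
        exact ⟨Finset.filter_subset _ _, by rw [hg i x y hx hy hxy e, Finset.card_pair hxy]⟩
    rw [this, Finset.card_image_of_injective]
    · simp
    intro i j hij
    obtain ⟨x, y, hx, hy, hxy, e⟩ := hg' i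
    have hs := hg i x y hx hy hxy e
    rw [hij] at hs
    obtain ⟨x', y', hx', hy', hxy', e'⟩ := hg' j
    rw [hg j x' y' hx' hy' hxy' e'] at hs
    have : x' + y' = x + y := by
      have h1 := Finset.sum_pair (f := id) hxy'
      rw [hs, Finset.sum_pair hxy] at h1
      exact h1.symm
    exact p_injective (add_self_inj (e.symm.trans (this.symm.trans e')))
  rw [Finset.card_powersetCard] at hcard
  have hlt : F.card ≤ 5 := by
    by_contra! h6
    have := Nat.choose_le_choose 2 h6
    rw [hcard] at this
    revert this
    decide
  interval_cases F.card <;> simp_all [Nat.choose]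

theorem FreeClasses.exists_frame (h : S.FreeClasses A B) : ∃ a f, S.Frame A a f := by
  classical
  have hfin : {v | v ∈ S.V ∧ parity v = A}.Finite := S.finite.subset fun v hv => hv.1
  let F := hfin.toFinset
  have hF : ∀ v, v ∈ F ↔ v ∈ S.V ∧ parity v = A := fun v => by simp [F]
  let e := Finset.equivFinOfCardEq (h.card_eq F hF)
  let a : Fin 4 → Fin 3 → ℤ := fun i => (e.symm i).1
  have hinj : Function.Injective a := Subtype.val_injective.comp e.symm.injective
  have ha : ∀ i, a i ∈ S.V ∧ parity (a i) = A := fun i => (hF _).mp (e.symm i).2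
  have hne : ∀ k, (edge k).1 ≠ (edge k).2 := by decide
  choose f hf using fun k => h.exists_add_eq (ha (edge k).1).1 (ha (edge k).2).1
    (fun e => hne k (hinj e)) (ha (edge k).1).2 (ha (edge k).2).2
  refine ⟨a, f, hinj, fun i => (ha i).1, fun i => (ha i).2, fun v hv hvA => ?_, ?_,
    fun k => (hf k).symm⟩
  · exact ⟨e ⟨v, (hF v).mpr ⟨hv, hvA⟩⟩, by simp [a]⟩
  refine Finite.injective_iff_bijective.mp fun k l hkl => ?_
  by_contra hne'
  have hgap : ∀ k, S.gap (f k) (a (edge k).1) = 0 ∧ S.gap (f k) (a (edge k).2) = 0 := fun k =>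
    ⟨gap_eq_zero_left (hf k) (ha _).1 (ha _).1 (relInt_p _).1,
      gap_eq_zero_right (hf k) (ha _).1 (ha _).1 (relInt_p _).1⟩
  have hthird : ∀ j, S.gap (f k) (a j) = 0 → j = (edge k).1 ∨ j = (edge k).2 := by
    intro j hj
    by_contra! hcon
    have := h.add_eq (ha (edge k).1).1 (ha j).1 (fun e => hcon.1 (hinj e).symm) (ha _).2 (ha j).2
      (hgap k).1 hj
    exact hcon.2 (hinj (add_left_cancel (this.trans (hf k).symm)))
  exact (by decide : ∀ k l, k ≠ l → ¬(((edge l).1 = (edge k).1 ∨ (edge l).1 = (edge k).2) ∧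
    ((edge l).2 = (edge k).1 ∨ (edge l).2 = (edge k).2))) k l hne'
    ⟨hthird _ (hkl ▸ (hgap l).1), hthird _ (hkl ▸ (hgap l).2)⟩

theorem sum_inc (a : Fin 4 → Fin 3 → ℤ) (k : Fin 6) :
    a (edge k).1 + a (edge k).2 = ∑ j, inc k j • a j := by
  fin_cases k <;> simp [edge, inc, Fin.sum_univ_four]

theorem Frame.sum_eq {a : Fin 4 → Fin 3 → ℤ} {f : Fin 6 → Fin 6} (h : S.Frame A a f) :
    (2 : ℤ) • ∑ i, S.p i = (3 : ℤ) • ∑ j, a j := by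
  rw [← h.bij.sum_comp S.p]
  have e := h.add_eq
  funext l
  have e' := fun k => congrFun (e k) l
  have e0 := e' 0
  have e1 := e' 1
  have e2 := e' 2
  have e3 := e' 3
  have e4 := e' 4
  have e5 := e' 5
  simp [edge] at e0 e1 e2 e3 e4 e5
  simp only [Fin.sum_univ_six, Fin.sum_univ_four, Pi.smul_apply, Pi.add_apply, smul_eq_mul]
  omega

/-- The vertices of the two tetrahedra are opposite to each other. -/
theorem FreeClasses.exists_opposite (h : S.FreeClasses A B) {a b : Fin 4 → Fin 3 → ℤ}
    {f g : Fin 6 → Fin 6} (ha : S.Frame A a f) (hb : S.Frame B b g) (i : Fin 4) :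
    ∃ k, (2 : ℤ) • (b i + a k) = ∑ j, a j := by
  have hs : ∑ j, b j = ∑ j, a j := by
    have := ha.sum_eq.symm.trans hb.sum_eq
    funext l
    have := congrFun this l
    simp only [Pi.smul_apply, smul_eq_mul] at this
    omega
  choose t ht using fun k => ha.bij.2 (g k)
  have ht' : ∀ k, ∑ j, inc (t k) j • a j = b (edge k).1 + b (edge k).2 := fun k => by
    rw [← sum_inc, ← ha.add_eq, ht, hb.add_eq]
  have htinj : Function.Injective t := fun k l hkl => hb.bij.1 (by rw [← ht, ← ht, hkl])
  have hcompl : ∀ k, t (k + 3) = t k + 3 := by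
    intro k
    by_contra hne
    obtain ⟨β, ε, hβε, hinc⟩ := (by decide : ∀ u w : Fin 6, w ≠ u → w ≠ u + 3 → ∃ β ε : Fin 4,
      β ≠ ε ∧ ∀ j, inc u j + inc w j = 1 + (if j = β then 1 else 0) - (if j = ε then 1 else 0))
      (t k) (t (k + 3)) (fun e => (by decide : ∀ k : Fin 6, k + 3 ≠ k) k (htinj e)) hne
    have e : ∑ j, (inc (t k) j + inc (t (k + 3)) j) • a j = ∑ j, b j := by
      simp only [add_smul, Finset.sum_add_distrib, ht']
      clear hne hinc
      fin_cases k <;> simp [edge, Fin.sum_univ_four] <;> abel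
    simp only [hinc, sub_smul, add_smul, one_smul, ite_smul, zero_smul, Finset.sum_sub_distrib,
      Finset.sum_add_distrib, Finset.sum_ite_eq', Finset.mem_univ, if_true, hs] at e
    refine hβε (ha.inj ?_)
    rw [add_sub_assoc, add_eq_left, sub_eq_zero] at e
    exact e
  obtain ⟨x, y, z, hxy, hxy', hxz, hxz', hyz, hyz', hinc⟩ : ∃ x y z : Fin 6, x ≠ y ∧ x ≠ y + 3 ∧
      x ≠ z ∧ x ≠ z + 3 ∧ y ≠ z ∧ y ≠ z + 3 ∧
      ∀ j, inc x j + inc y j + inc z j = 1 + if j = i then 2 else 0 := by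
    revert i
    decide
  have e : ∑ j, (inc (t x) j + inc (t y) j + inc (t z) j) • a j = ∑ j, b j + (2 : ℤ) • b i := by
    simp only [add_smul, Finset.sum_add_distrib, ht', sum_inc]
    simp only [← Finset.sum_add_distrib, ← add_smul, hinc]
    simp only [add_smul, one_smul, ite_smul, zero_smul,
      Finset.sum_add_distrib, Finset.sum_ite_eq', Finset.mem_univ, if_true]
  obtain ⟨k, hk⟩ := (by decide +kernel : ∀ x y z : Fin 6, x ≠ y → x ≠ y + 3 → x ≠ z → x ≠ z + 3 →
    y ≠ z → y ≠ z + 3 → ∃ k : Fin 4,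
      (∀ j, inc x j + inc y j + inc z j = 1 + if j = k then 2 else 0) ∨
      (∀ j, inc x j + inc y j + inc z j = 2 - if j = k then 2 else 0)) (t x) (t y) (t z)
    (htinj.ne hxy) (by rw [← hcompl]; exact htinj.ne hxy') (htinj.ne hxz)
    (by rw [← hcompl]; exact htinj.ne hxz') (htinj.ne hyz) (by rw [← hcompl]; exact htinj.ne hyz')
  rw [hs] at e
  refine ⟨k, ?_⟩
  rcases hk with hk | hk
  · simp only [hk, add_smul, one_smul, ite_smul, zero_smul,
      Finset.sum_add_distrib, Finset.sum_ite_eq', Finset.mem_univ, if_true] at e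
    exfalso
    refine h.ne ?_
    rw [← ha.parity_eq k, ← hb.parity_eq i]
    congr 1
    funext l
    have := congrFun (add_left_cancel e) l
    simp only [Pi.smul_apply, smul_eq_mul] at this
    omega
  · simp only [hk, sub_smul, ite_smul, zero_smul, ← Finset.smul_sum,
      Finset.sum_sub_distrib, Finset.sum_ite_eq', Finset.mem_univ, if_true] at e
    rw [smul_add]
    funext l
    have := congrFun e l
    simp only [Pi.smul_apply, Pi.add_apply, Pi.sub_apply, smul_eq_mul] at this ⊢
    omega

/-- The lattice points lie in a parallelepiped whose vertices are lattice points of the polytope;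
its edge directions are `-h₁ + h₂ + h₃`, `h₁ - h₂ + h₃` and `h₁ + h₂ - h₃`. -/
theorem exists_box (S : SixFacets) : ∃ a h₁ h₂ h₃ : Fin 3 → ℤ,
    (∀ n₁ n₂ n₃ : ℤ, (n₂ + n₃ = 0 ∨ n₂ + n₃ = 2) → (n₁ + n₃ = 0 ∨ n₁ + n₃ = 2) →
      (n₁ + n₂ = 0 ∨ n₁ + n₂ = 2) → a + n₁ • h₁ + n₂ • h₂ + n₃ • h₃ ∈ S.V) ∧
    ∀ v ∈ S.V, ∃ n₁ n₂ n₃ : ℤ, v = a + n₁ • h₁ + n₂ • h₂ + n₃ • h₃ ∧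
      (0 ≤ n₂ + n₃ ∧ n₂ + n₃ ≤ 2) ∧ (0 ≤ n₁ + n₃ ∧ n₁ + n₃ ≤ 2) ∧
      (0 ≤ n₁ + n₂ ∧ n₁ + n₂ ≤ 2) := by
  obtain ⟨A, B, hAB⟩ := exists_freeClasses S
  obtain ⟨a, f, ha⟩ := hAB.exists_frame
  obtain ⟨b, g, hb⟩ := hAB.symm.exists_frame
  choose k hk using fun i => hAB.exists_opposite ha hb i
  choose c hc using fun i => hAB.symm.exists_opposite hb ha i
  have hcc : ∀ i, (2 : ℤ) • (b (c i) + a i) = ∑ j, a j := by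
    intro i
    rw [add_comm, hc]
    have := ha.sum_eq.symm.trans hb.sum_eq
    funext l
    have := congrFun this l
    simp only [Pi.smul_apply, smul_eq_mul] at this
    omega
  have hbv : ∀ i, ∃ j, b i = b (c j) := by
    intro i
    refine ⟨k i, ?_⟩
    have := (hk i).trans (hcc (k i)).symm
    funext l
    have := congrFun this l
    simp only [Pi.smul_apply, Pi.add_apply, smul_eq_mul] at this
    omega
  have e := ha.add_eq
  have key : ∀ (v : Fin 3 → ℤ) (n₁ n₂ n₃ : ℤ),
      (∀ l, v l = a 0 l + n₁ * (S.p (f 0) l - a 0 l) + n₂ * (S.p (f 1) l - a 0 l) +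
        n₃ * (S.p (f 2) l - a 0 l)) →
      v = a 0 + n₁ • (S.p (f 0) - a 0) + n₂ • (S.p (f 1) - a 0) + n₃ • (S.p (f 2) - a 0) := by
    intro v n₁ n₂ n₃ h
    funext l
    rw [h l]
    simp
  have hp : ∀ k l, S.p (f k) l + S.p (f k) l = a (edge k).1 l + a (edge k).2 l := fun k l =>
    congrFun (e k) l
  have hp0 := hp 0
  have hp1 := hp 1
  have hp2 := hp 2
  have hp3 := hp 3
  have hp4 := hp 4
  have hp5 := hp 5
  have hb' : ∀ i l, 2 * (b (c i) l + a i l) = a 0 l + a 1 l + a 2 l + a 3 l := by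
    intro i l
    have := congrFun (hcc i) l
    simpa [Fin.sum_univ_four] using this
  have hb0 := hb' 0
  have hb1 := hb' 1
  have hb2 := hb' 2
  have hb3 := hb' 3
  simp only [edge, Matrix.cons_val] at hp0 hp1 hp2 hp3 hp4 hp5
  have a0 : a 0 = _ := key (a 0) 0 0 0 fun l => by ring
  have a1 : a 1 = _ := key (a 1) 2 0 0 fun l => by linarith [hp0 l]
  have a2 : a 2 = _ := key (a 2) 0 2 0 fun l => by linarith [hp1 l]
  have a3 : a 3 = _ := key (a 3) 0 0 2 fun l => by linarith [hp2 l]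
  have b0 : b (c 0) = _ := key _ 1 1 1 fun l => by linarith [hp0 l, hp1 l, hp2 l, hb0 l]
  have b1 : b (c 1) = _ := key _ (-1) 1 1 fun l => by linarith [hp0 l, hp1 l, hp2 l, hb1 l]
  have b2 : b (c 2) = _ := key _ 1 (-1) 1 fun l => by linarith [hp0 l, hp1 l, hp2 l, hb2 l]
  have b3 : b (c 3) = _ := key _ 1 1 (-1) fun l => by linarith [hp0 l, hp1 l, hp2 l, hb3 l]
  have p0 : S.p (f 0) = _ := key _ 1 0 0 fun l => by ring
  have p1 : S.p (f 1) = _ := key _ 0 1 0 fun l => by ring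
  have p2 : S.p (f 2) = _ := key _ 0 0 1 fun l => by ring
  have p3 : S.p (f 3) = _ := key _ 0 1 1 fun l => by linarith [hp1 l, hp2 l, hp3 l]
  have p4 : S.p (f 4) = _ := key _ 1 0 1 fun l => by linarith [hp0 l, hp2 l, hp4 l]
  have p5 : S.p (f 5) = _ := key _ 1 1 0 fun l => by linarith [hp0 l, hp1 l, hp5 l]
  refine ⟨a 0, S.p (f 0) - a 0, S.p (f 1) - a 0, S.p (f 2) - a 0, ?_, ?_⟩
  · have out : ∀ {v : Fin 3 → ℤ} {m₁ m₂ m₃ n₁ n₂ n₃ : ℤ},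
        v = a 0 + m₁ • (S.p (f 0) - a 0) + m₂ • (S.p (f 1) - a 0) + m₃ • (S.p (f 2) - a 0) →
        v ∈ S.V → n₁ = m₁ → n₂ = m₂ → n₃ = m₃ →
        a 0 + n₁ • (S.p (f 0) - a 0) + n₂ • (S.p (f 1) - a 0) + n₃ • (S.p (f 2) - a 0) ∈ S.V := by
      rintro v m₁ m₂ m₃ n₁ n₂ n₃ e hv rfl rfl rfl
      exact e ▸ hv
    rintro n₁ n₂ n₃ (c₁ | c₁) (c₂ | c₂) (c₃ | c₃)
    · exact out a0 (ha.mem 0) (by lia) (by lia) (by lia)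
    · exact out b3 (hb.mem _) (by lia) (by lia) (by lia)
    · exact out b2 (hb.mem _) (by lia) (by lia) (by lia)
    · exact out a1 (ha.mem 1) (by lia) (by lia) (by lia)
    · exact out b1 (hb.mem _) (by lia) (by lia) (by lia)
    · exact out a2 (ha.mem 2) (by lia) (by lia) (by lia)
    · exact out a3 (ha.mem 3) (by lia) (by lia) (by lia)
    · exact out b0 (hb.mem _) (by lia) (by lia) (by lia)
  · intro v hv
    rcases hAB.mem_cases hv with hvA | hvB | ⟨j, rfl⟩
    · obtain ⟨i, rfl⟩ := ha.surj v hv hvA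
      fin_cases i
      · exact ⟨_, _, _, a0, by norm_num⟩
      · exact ⟨_, _, _, a1, by norm_num⟩
      · exact ⟨_, _, _, a2, by norm_num⟩
      · exact ⟨_, _, _, a3, by norm_num⟩
    · obtain ⟨i, rfl⟩ := hb.surj v hv hvB
      obtain ⟨j, hj⟩ := hbv i
      rw [hj]
      fin_cases j
      · exact ⟨_, _, _, b0, by norm_num⟩
      · exact ⟨_, _, _, b1, by norm_num⟩
      · exact ⟨_, _, _, b2, by norm_num⟩
      · exact ⟨_, _, _, b3, by norm_num⟩
    · obtain ⟨k, rfl⟩ := ha.bij.2 j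
      fin_cases k
      · exact ⟨_, _, _, p0, by norm_num⟩
      · exact ⟨_, _, _, p1, by norm_num⟩
      · exact ⟨_, _, _, p2, by norm_num⟩
      · exact ⟨_, _, _, p3, by norm_num⟩
      · exact ⟨_, _, _, p4, by norm_num⟩
      · exact ⟨_, _, _, p5, by norm_num⟩

end SixFacets

theorem mem_M12_iff {x : Fin 3 → ℝ} : x ∈ M12 ↔ x 1 - x 0 ∈ Icc (0 : ℝ) 2 ∧
    x 0 + x 1 - x 2 ∈ Icc (0 : ℝ) 2 ∧ x 2 ∈ Icc (0 : ℝ) 2 := by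
  constructor
  · rintro ⟨σ₁, σ₂, σ₃, ⟨h1, h1'⟩, ⟨h2, h2'⟩, ⟨h3, h3'⟩, rfl⟩
    simp
    refine ⟨⟨?_, ?_⟩, ⟨?_, ?_⟩, ?_, ?_⟩ <;> linarith
  · rintro ⟨⟨h1, h1'⟩, ⟨h2, h2'⟩, ⟨h3, h3'⟩⟩
    refine ⟨(x 1 - x 0) / 2, (x 0 + x 1 - x 2) / 2, x 2 / 2, ⟨by linarith, by linarith⟩,
      ⟨by linarith, by linarith⟩, ⟨by linarith, by linarith⟩, ?_⟩
    funext l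
    fin_cases l <;> simp <;> ring

theorem convex_M12 : Convex ℝ M12 := by
  intro x hx y hy s t hs ht hst
  rw [mem_M12_iff] at hx hy ⊢
  have key : ∀ {X Y Z : ℝ}, X ∈ Icc (0 : ℝ) 2 → Y ∈ Icc (0 : ℝ) 2 → Z = s • X + t • Y →
      Z ∈ Icc (0 : ℝ) 2 := fun hX hY h => h ▸ convex_Icc (0 : ℝ) 2 hX hY hs ht hst
  refine ⟨key hx.1 hy.1 ?_, key hx.2.1 hy.2.1 ?_, key hx.2.2 hy.2.2 ?_⟩ <;> simp <;> ring

theorem affMap_combo {d : ℕ} (U : Matrix (Fin d) (Fin d) ℤ) (t x y : Fin d → ℝ) {r s : ℝ}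
    (h : r + s = 1) : affMap U t (r • x + s • y) = r • affMap U t x + s • affMap U t y := by
  funext i
  simp only [affMap, Pi.add_apply, Pi.smul_apply, smul_eq_mul, mul_add, Finset.mul_sum,
    Finset.sum_add_distrib]
  have : t i = r * t i + s * t i := by rw [← add_mul, h, one_mul]
  rw [add_add_add_comm, ← this]
  simp only [mul_left_comm]

theorem convex_image_affMap {d : ℕ} (U : Matrix (Fin d) (Fin d) ℤ) (t : Fin d → ℝ)
    {K : Set (Fin d → ℝ)} (hK : Convex ℝ K) : Convex ℝ (affMap U t '' K) := by
  rintro _ ⟨x, hx, rfl⟩ _ ⟨y, hy, rfl⟩ r s hr hs hrs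
  exact ⟨r • x + s • y, hK hx hy hr hs hrs, affMap_combo U t x y hrs⟩

namespace SixFacets

variable (S : SixFacets)

/-- The polytope. -/
def body : Set (Fin 3 → ℝ) := {x | ∀ i, 0 ≤ S.b i - S.N i ⬝ᵥ x}

variable {S}

theorem toReal_mem_body {z : Fin 3 → ℤ} : toReal z ∈ S.body ↔ z ∈ S.V := Iff.rfl

/-- No nonzero linear form is constant on the lattice points. -/
theorem exists_dotProduct_ne {w : Fin 3 → ℝ} (hw : w ≠ 0) :
    ∃ u ∈ S.V, ∃ v ∈ S.V, w ⬝ᵥ toReal u ≠ w ⬝ᵥ toReal v := by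
  by_contra! hcon
  let n := S.N 0
  let d := (n ⬝ᵥ n) • w - (n ⬝ᵥ w) • n
  have hnd : n ⬝ᵥ d = 0 := by
    simp only [d, dotProduct_sub, dotProduct_smul, smul_eq_mul]
    ring
  have hdd : d ⬝ᵥ d = (n ⬝ᵥ n) * (w ⬝ᵥ d) := by
    conv_lhs =>
      enter [1]
      simp only [d]
    rw [sub_dotProduct, smul_dotProduct, smul_dotProduct, hnd, smul_zero, sub_zero, smul_eq_mul]
  have hn := dotProduct_self_pos (N_ne_zero (S := S) 0)
  by_cases hd : d = 0
  · have hnw : n ⬝ᵥ w ≠ 0 := by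
      intro h
      simp only [d, h, zero_smul, sub_zero] at hd
      exact (smul_ne_zero hn.ne' hw) hd
    have e : ∀ v, (n ⬝ᵥ n) * (w ⬝ᵥ toReal v) = (n ⬝ᵥ w) * (n ⬝ᵥ toReal v) := by
      intro v
      rw [← smul_eq_mul, ← smul_eq_mul, ← smul_dotProduct, ← smul_dotProduct, sub_eq_zero.mp hd]
    have h01 := hcon _ (p_mem_V 0) _ (p_mem_V 1)
    have := mul_left_cancel₀ hnw ((e (S.p 0)).symm.trans ((congrArg _ h01).trans (e (S.p 1))))
    have hpos := (relInt_p (S := S) 1).2 0 (by decide)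
    have hzero := (relInt_p (S := S) 0).1
    simp only [gap] at hpos hzero
    change S.N 0 ⬝ᵥ _ = S.N 0 ⬝ᵥ _ at this
    linarith
  · have hwd : 0 < w ⬝ᵥ d := by
      have := dotProduct_self_pos hd
      rw [hdd] at this
      exact (mul_pos_iff_of_pos_left hn).mp this
    obtain ⟨v, hv, -, hlt⟩ := exists_dotProduct_lt 0 w d hnd hwd
    exact hlt.ne (hcon _ (p_mem_V 0) _ hv)

theorem affine_nonneg {α β σ : ℝ} (h₀ : 0 ≤ α) (h₁ : 0 ≤ α + β) (h : σ ∈ Icc (0 : ℝ) 1) :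
    0 ≤ α + β * σ := by
  nlinarith [mul_nonneg h₀ (sub_nonneg.mpr h.2), mul_nonneg h₁ h.1]

theorem gap_combo (i : Fin 6) (a h₁ h₂ h₃ : Fin 3 → ℤ) (n₁ n₂ n₃ : ℤ) :
    S.gap i (a + n₁ • h₁ + n₂ • h₂ + n₃ • h₃) = S.gap i a - n₁ * (S.N i ⬝ᵥ toReal h₁) -
      n₂ * (S.N i ⬝ᵥ toReal h₂) - n₃ * (S.N i ⬝ᵥ toReal h₃) := by
  simp only [gap, Matrix.vec3_dotProduct, toReal, Pi.add_apply, Pi.smul_apply, smul_eq_mul]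
  push_cast
  ring

theorem body_eq (S : SixFacets) : ∃ (U : Matrix (Fin 3) (Fin 3) ℤ) (v : Fin 3 → ℤ),
    |U.det| = 1 ∧ S.body = affMap U (fun i => (v i : ℝ)) '' M12 := by
  obtain ⟨a, h₁, h₂, h₃, hvert, hV⟩ := S.exists_box
  let U : Matrix (Fin 3) (Fin 3) ℤ := Matrix.of fun j => ![h₁ j - h₂ j, h₃ j, h₂ j - h₃ j]
  have hU : ∀ x j, affMap U (toReal a) x j =
      (h₁ j - h₂ j) * x 0 + h₃ j * x 1 + (h₂ j - h₃ j) * x 2 + a j := by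
    intro x j
    simp [affMap, U, Fin.sum_univ_three, toReal]
  have hbody : S.body = affMap U (toReal a) '' M12 := by
    apply Subset.antisymm
    · refine S.hull.trans (convexHull_min ?_ (convex_image_affMap _ _ convex_M12))
      rintro _ ⟨v, hv, rfl⟩
      obtain ⟨n₁, n₂, n₃, rfl, ⟨e₁, e₁'⟩, ⟨e₂, e₂'⟩, ⟨e₃, e₃'⟩⟩ := hV v hv
      refine ⟨toReal ![n₁, n₁ + n₂ + n₃, n₁ + n₂], mem_M12_iff.mpr ?_, ?_⟩
      · simp only [toReal, Matrix.cons_val, mem_Icc]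
        norm_cast
        refine ⟨⟨?_, ?_⟩, ⟨?_, ?_⟩, ?_, ?_⟩ <;> lia
      · funext j
        rw [hU]
        simp [toReal]
        ring
    · rintro _ ⟨x, ⟨σ₁, σ₂, σ₃, s₁, s₂, s₃, rfl⟩, rfl⟩ i
      let α₁ := S.N i ⬝ᵥ toReal h₁
      let α₂ := S.N i ⬝ᵥ toReal h₂
      let α₃ := S.N i ⬝ᵥ toReal h₃
      have e : S.b i - S.N i ⬝ᵥ affMap U (toReal a)
          (σ₁ • ![(-1:ℝ),1,0] + σ₂ • ![(1:ℝ),1,0] + σ₃ • ![(1:ℝ),1,2]) =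
          S.gap i a + (α₁ - α₂ - α₃) * σ₁ + (α₂ - α₁ - α₃) * σ₂ + (α₃ - α₁ - α₂) * σ₃ := by
        rw [Matrix.vec3_dotProduct, hU, hU, hU]
        simp only [α₁, α₂, α₃, gap, Matrix.vec3_dotProduct, toReal, Pi.add_apply, Pi.smul_apply,
          smul_eq_mul, Matrix.cons_val]
        ring
      rw [e]
      have hv : ∀ n₁ n₂ n₃ : ℤ, (n₂ + n₃ = 0 ∨ n₂ + n₃ = 2) → (n₁ + n₃ = 0 ∨ n₁ + n₃ = 2) →
          (n₁ + n₂ = 0 ∨ n₁ + n₂ = 2) → 0 ≤ S.gap i a - n₁ * α₁ - n₂ * α₂ - n₃ * α₃ := by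
        intro n₁ n₂ n₃ c₁ c₂ c₃
        rw [← gap_combo]
        exact hvert n₁ n₂ n₃ c₁ c₂ c₃ i
      have v0 := hv 0 0 0 (by norm_num) (by norm_num) (by norm_num)
      have v1 := hv 2 0 0 (by norm_num) (by norm_num) (by norm_num)
      have v2 := hv 0 2 0 (by norm_num) (by norm_num) (by norm_num)
      have v3 := hv 0 0 2 (by norm_num) (by norm_num) (by norm_num)
      have v4 := hv 1 1 1 (by norm_num) (by norm_num) (by norm_num)
      have v5 := hv (-1) 1 1 (by norm_num) (by norm_num) (by norm_num)
      have v6 := hv 1 (-1) 1 (by norm_num) (by norm_num) (by norm_num)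
      have v7 := hv 1 1 (-1) (by norm_num) (by norm_num) (by norm_num)
      push_cast at v0 v1 v2 v3 v4 v5 v6 v7
      refine affine_nonneg (affine_nonneg (affine_nonneg ?_ ?_ s₁) ?_ s₂) ?_ s₃
      · linarith
      · linarith
      · rw [add_right_comm]
        exact affine_nonneg (by linarith) (by linarith) s₁
      · rw [add_right_comm, add_right_comm (S.gap i a)]
        refine affine_nonneg (affine_nonneg (by linarith) (by linarith) s₁) ?_ s₂
        rw [add_right_comm]
        exact affine_nonneg (by linarith) (by linarith) s₁
  refine ⟨U, a, ?_, hbody⟩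
  have hdet : (U.map ((↑) : ℤ → ℝ)).det ≠ 0 := by
    intro h
    obtain ⟨w, hw, hw0⟩ := Matrix.exists_vecMul_eq_zero_iff.mpr h
    obtain ⟨u, hu, v, hv, hne⟩ := exists_dotProduct_ne (S := S) hw
    have hc : ∀ q ∈ S.V, w ⬝ᵥ toReal q = w ⬝ᵥ toReal a := by
      intro q hq
      obtain ⟨x, -, hx⟩ := hbody ▸ toReal_mem_body.mpr hq
      have : affMap U (toReal a) x = U.map ((↑) : ℤ → ℝ) *ᵥ x + toReal a := by
        funext j
        simp [affMap, Matrix.mulVec, dotProduct]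
      rw [← hx, this, dotProduct_add, Matrix.dotProduct_mulVec, hw0, zero_dotProduct, zero_add]
    exact hne ((hc u hu).trans (hc v hv).symm)
  have hsurjR : Function.Surjective (U.map ((↑) : ℤ → ℝ)).mulVec :=
    Matrix.mulVec_surjective_iff_isUnit.mpr ((Matrix.isUnit_iff_isUnit_det _).mpr hdet.isUnit)
  have hsurj : Function.Surjective U.mulVec := by
    intro z
    obtain ⟨y, hy⟩ := hsurjR (toReal z)
    let k₁ := ⌊(y 1 - y 0) / 2⌋
    let k₂ := ⌊(y 0 + y 1 - y 2) / 2⌋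
    let k₃ := ⌊y 2 / 2⌋
    let m : Fin 3 → ℤ := ![-k₁ + k₂ + k₃, k₁ + k₂ + k₃, 2 * k₃]
    have hmem : toReal (z + a - U *ᵥ m) ∈ S.body := by
      rw [hbody]
      refine ⟨y - toReal m, mem_M12_iff.mpr ?_, ?_⟩
      · have f₁ := Int.floor_le ((y 1 - y 0) / 2)
        have f₂ := Int.floor_le ((y 0 + y 1 - y 2) / 2)
        have f₃ := Int.floor_le (y 2 / 2)
        have f₁' := Int.lt_floor_add_one ((y 1 - y 0) / 2)
        have f₂' := Int.lt_floor_add_one ((y 0 + y 1 - y 2) / 2)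
        have f₃' := Int.lt_floor_add_one (y 2 / 2)
        simp only [toReal, m, Pi.sub_apply, Matrix.cons_val, mem_Icc]
        push_cast
        refine ⟨⟨?_, ?_⟩, ⟨?_, ?_⟩, ?_, ?_⟩ <;> linarith
      · funext j
        have hyj := congrFun hy j
        rw [hU]
        simp [Matrix.mulVec, dotProduct, Fin.sum_univ_three, U, toReal] at hyj ⊢
        linarith
    obtain ⟨n₁, n₂, n₃, hn, -⟩ := hV _ (toReal_mem_body.mp hmem)
    refine ⟨m + ![n₁, n₁ + n₂ + n₃, n₁ + n₂], ?_⟩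
    rw [Matrix.mulVec_add]
    funext j
    have hnj := congrFun hn j
    have : (U *ᵥ ![n₁, n₁ + n₂ + n₃, n₁ + n₂]) j = n₁ * h₁ j + n₂ * h₂ j + n₃ * h₃ j := by
      simp [Matrix.mulVec, dotProduct, Fin.sum_univ_three, U]
      ring
    simp only [Pi.add_apply, Pi.sub_apply, Pi.smul_apply, smul_eq_mul, this] at hnj ⊢
    linarith
  exact Int.isUnit_iff_abs_eq.mp
    ((Matrix.isUnit_iff_isUnit_det _).mp (Matrix.mulVec_surjective_iff_isUnit.mp hsurj))

end SixFacets

namespace Inequalities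

open Filter Topology

/-- The solution set of a system of linear inequalities. -/
def sol {ι : Type*} (A : ι → Fin 3 → ℝ) (b : ι → ℝ) : Set (Fin 3 → ℝ) := {x | ∀ i, A i ⬝ᵥ x ≤ b i}

/-- The subset of the solution set where the inequality with index `i` is tight. -/
def face {ι : Type*} (A : ι → Fin 3 → ℝ) (b : ι → ℝ) (i : ι) : Set (Fin 3 → ℝ) :=
  {x | x ∈ sol A b ∧ A i ⬝ᵥ x = b i}

variable {ι : Type*} {A : ι → Fin 3 → ℝ} {b : ι → ℝ}

theorem dotProduct_line (a x d : Fin 3 → ℝ) (t : ℝ) : a ⬝ᵥ (x + t • d) = a ⬝ᵥ x + t * (a ⬝ᵥ d) := by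
  rw [dotProduct_add, dotProduct_smul, smul_eq_mul]

theorem dotProduct_combo (a x y : Fin 3 → ℝ) (r s : ℝ) :
    a ⬝ᵥ (r • x + s • y) = r * (a ⬝ᵥ x) + s * (a ⬝ᵥ y) := by
  rw [dotProduct_add, dotProduct_smul, dotProduct_smul, smul_eq_mul, smul_eq_mul]

theorem convex_sol (A : ι → Fin 3 → ℝ) (b : ι → ℝ) : Convex ℝ (sol A b) := by
  intro x hx y hy r s hr hs hrs i
  have h₁ := mul_le_mul_of_nonneg_left (hx i) hr
  have h₂ := mul_le_mul_of_nonneg_left (hy i) hs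
  have : r * b i + s * b i = b i := by rw [← add_mul, hrs, one_mul]
  rw [dotProduct_combo]
  linarith

theorem eventually_line {a x : Fin 3 → ℝ} {β : ℝ} (d : Fin 3 → ℝ) (h : a ⬝ᵥ x < β) :
    ∀ᶠ t : ℝ in 𝓝[>] 0, a ⬝ᵥ (x + t • d) < β := by
  refine eventually_nhdsWithin_of_eventually_nhds ?_
  have hc : Continuous fun t : ℝ => a ⬝ᵥ (x + t • d) := by
    simp only [dotProduct_line]
    fun_prop
  refine (hc.tendsto 0).eventually (gt_mem_nhds ?_)
  simpa using h

theorem exists_step [Finite ι] {x : Fin 3 → ℝ} (d : Fin 3 → ℝ)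
    (h : ∀ k, A k ⬝ᵥ x < b k ∨ A k ⬝ᵥ x ≤ b k ∧ A k ⬝ᵥ d = 0) :
    ∃ t : ℝ, 0 < t ∧ x + t • d ∈ sol A b := by
  have key : ∀ᶠ t : ℝ in 𝓝[>] 0, ∀ k, A k ⬝ᵥ (x + t • d) ≤ b k := by
    rw [eventually_all]
    intro k
    rcases h k with h | ⟨h, h'⟩
    · exact (eventually_line d h).mono fun _ => le_of_lt
    · refine Eventually.of_forall fun t => ?_
      rw [dotProduct_line, h', mul_zero, add_zero]
      exact h
  obtain ⟨t, ht, ht'⟩ := (key.and self_mem_nhdsWithin).exists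
  exact ⟨t, ht', ht⟩

theorem lt_of_mem_interior {a x : Fin 3 → ℝ} {β : ℝ} {K : Set (Fin 3 → ℝ)} (ha : a ≠ 0)
    (hK : ∀ y ∈ K, a ⬝ᵥ y ≤ β) (hx : x ∈ interior K) : a ⬝ᵥ x < β := by
  have key : ∀ᶠ t : ℝ in 𝓝[>] 0, x + t • a ∈ K := by
    refine eventually_nhdsWithin_of_eventually_nhds ?_
    have hc : Continuous fun t : ℝ => x + t • a := by fun_prop
    refine (hc.tendsto 0).eventually (mem_interior_iff_mem_nhds.1 ?_)
    simpa using hx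
  obtain ⟨t, ht, ht'⟩ := (key.and self_mem_nhdsWithin).exists
  have h := hK _ ht
  rw [dotProduct_line] at h
  have := mul_pos ht' (SixFacets.dotProduct_self_pos ha)
  linarith

theorem mem_interior_sol [Finite ι] {x : Fin 3 → ℝ} (h : ∀ i, A i ⬝ᵥ x < b i) :
    x ∈ interior (sol A b) := by
  have ho : IsOpen {x | ∀ i, A i ⬝ᵥ x < b i} := by
    rw [ofPred_forall]
    exact isOpen_iInter_of_finite fun i => isOpen_lt (by fun_prop) continuous_const
  exact interior_maximal (fun y hy i => (hy i).le) ho h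

theorem exists_irredundant {n : ℕ} (A : Fin n → Fin 3 → ℝ) (b : Fin n → ℝ) :
    ∃ s : Finset (Fin n), sol A b = sol (fun i : s => A i) (fun i : s => b i) ∧
      ∀ i : s, ∃ y, b i < A i ⬝ᵥ y ∧ ∀ k : s, k ≠ i → A k ⬝ᵥ y ≤ b k := by
  obtain ⟨s, hs, hmin⟩ := exists_minimal_of_wellFoundedLT
    (fun s : Finset (Fin n) => sol A b = sol (fun i : s => A i) (fun i : s => b i))
    ⟨Finset.univ, by ext x; simp [sol]⟩
  refine ⟨s, hs, fun i => ?_⟩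
  by_contra! hi
  refine Finset.notMem_erase i.1 s (hmin ?_ (Finset.erase_subset i.1 s) i.2)
  rw [hs]
  ext x
  refine ⟨fun hx k => hx ⟨k, Finset.mem_of_mem_erase k.2⟩, fun hx k => ?_⟩
  have hx' : ∀ k : s, k ≠ i → A k ⬝ᵥ x ≤ b k := fun k hk =>
    hx ⟨k, Finset.mem_erase.2 ⟨fun h => hk (Subtype.ext h), k.2⟩⟩
  by_cases hk : k = i
  · subst hk
    by_contra! h
    obtain ⟨k, hk, hk'⟩ := hi x h
    exact absurd (hx' k hk) (not_le.2 hk')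
  · exact hx' k hk

theorem exists_relInt_face {x y : Fin 3 → ℝ} {i : ι} (hx : ∀ k, A k ⬝ᵥ x < b k)
    (hy : b i < A i ⬝ᵥ y) (hy' : ∀ k, k ≠ i → A k ⬝ᵥ y ≤ b k) :
    ∃ q, A i ⬝ᵥ q = b i ∧ ∀ k, k ≠ i → A k ⬝ᵥ q < b k := by
  have hD : 0 < A i ⬝ᵥ y - A i ⬝ᵥ x := by linarith [hx i]
  set r := (A i ⬝ᵥ y - b i) / (A i ⬝ᵥ y - A i ⬝ᵥ x) with hr
  set s := (b i - A i ⬝ᵥ x) / (A i ⬝ᵥ y - A i ⬝ᵥ x) with hs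
  have hr0 : 0 < r := div_pos (by linarith) hD
  have hs0 : 0 < s := div_pos (by linarith [hx i]) hD
  have hrs : r + s = 1 := by
    rw [hr, hs]
    field_simp
    ring
  refine ⟨r • x + s • y, ?_, fun k hk => ?_⟩
  · rw [dotProduct_combo, hr, hs]
    field_simp
    ring
  · have h₁ := mul_lt_mul_of_pos_left (hx k) hr0
    have h₂ := mul_le_mul_of_nonneg_left (hy' k hk) hs0.le
    have : r * b k + s * b k = b k := by rw [← add_mul, hrs, one_mul]
    rw [dotProduct_combo]
    linarith

theorem mem_of_isExtreme {P F : Set (Fin 3 → ℝ)} (h : IsExtreme ℝ P F) {x y : Fin 3 → ℝ} {t : ℝ}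
    (ht : 0 < t) (hy : y ∈ F) (hx : x ∈ P) (hxy : y + t • (y - x) ∈ P) : x ∈ F := by
  refine h.left_mem_of_mem_openSegment hx hxy hy
    ⟨t / (1 + t), 1 / (1 + t), by positivity, by positivity, by field_simp; ring, ?_⟩
  ext j
  simp only [Pi.add_apply, Pi.smul_apply, Pi.sub_apply, smul_eq_mul]
  field_simp
  ring

theorem exists_all_lt [Finite ι] {F : Set (Fin 3 → ℝ)} (hF : Convex ℝ F) (hF0 : F.Nonempty)
    (hsub : F ⊆ sol A b) (p : ι → Prop) (h : ∀ k, p k → ∃ x ∈ F, A k ⬝ᵥ x < b k) :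
    ∃ x ∈ F, ∀ k, p k → A k ⬝ᵥ x < b k := by
  refine Set.Finite.induction_on_subset (motive := fun s _ => ∃ x ∈ F, ∀ k ∈ s, A k ⬝ᵥ x < b k)
    _ (toFinite {k | p k}) ⟨hF0.some, hF0.some_mem, by simp⟩ ?_
  · rintro k s hk - - ⟨x, hx, hxs⟩
    obtain ⟨y, hy, hyk⟩ := h k hk
    refine ⟨(1 / 2 : ℝ) • x + (1 / 2 : ℝ) • y,
      hF hx hy (by norm_num) (by norm_num) (by norm_num), fun l hl => ?_⟩
    rw [dotProduct_combo]
    rcases hl with rfl | hl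
    · linarith [hsub hx l]
    · linarith [hxs l hl, hsub hy l]

/-- The hyperplane through the origin orthogonal to a vector. -/
def normalHyperplane (a : Fin 3 → ℝ) : Submodule ℝ (Fin 3 → ℝ) :=
  LinearMap.ker (dotProductEquiv ℝ (Fin 3) a)

theorem mem_normalHyperplane {a x : Fin 3 → ℝ} : x ∈ normalHyperplane a ↔ a ⬝ᵥ x = 0 := Iff.rfl

theorem finrank_normalHyperplane {a : Fin 3 → ℝ} (ha : a ≠ 0) :
    Module.finrank ℝ (normalHyperplane a) = 2 := by
  have h := Module.Dual.finrank_ker_add_one_of_ne_zero (f := dotProductEquiv ℝ (Fin 3) a)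
    (by simpa using ha)
  rw [Module.finrank_fin_fun] at h
  unfold normalHyperplane
  omega

theorem vectorSpan_le {a : Fin 3 → ℝ} {β : ℝ} {F : Set (Fin 3 → ℝ)} (h : ∀ x ∈ F, a ⬝ᵥ x = β) :
    vectorSpan ℝ F ≤ normalHyperplane a := by
  rw [vectorSpan_def, Submodule.span_le]
  rintro _ ⟨x, hx, y, hy, rfl⟩
  change a ⬝ᵥ (x - y) = 0
  rw [dotProduct_sub, h x hx, h y hy, sub_self]

theorem mem_vectorSpan {F : Set (Fin 3 → ℝ)} {x d : Fin 3 → ℝ} {t : ℝ} (ht : 0 < t) (hx : x ∈ F)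
    (hd : x + t • d ∈ F) : d ∈ vectorSpan ℝ F := by
  have h := vsub_mem_vectorSpan ℝ hd hx
  rw [vsub_eq_sub, add_sub_cancel_left] at h
  exact ((vectorSpan ℝ F).smul_mem_iff ht.ne').1 h

theorem isFacet_face [Finite ι] {i : ι} {q : Fin 3 → ℝ} (hA : A i ≠ 0) (hq : A i ⬝ᵥ q = b i)
    (hq' : ∀ k, k ≠ i → A k ⬝ᵥ q < b k) : IsFacet (sol A b) (face A b i) := by
  have hqm : q ∈ sol A b := fun k => by
    by_cases hk : k = i
    · rw [hk, hq]
    · exact (hq' k hk).le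
  refine ⟨⟨fun x hx => hx.1, ?_⟩, ?_, ?_⟩
  · rintro x hx y hy _ hz ⟨r, s, hr, hs, hrs, rfl⟩
    refine ⟨hx, (hx i).antisymm ?_⟩
    have h := hz.2
    rw [dotProduct_combo] at h
    have h₂ := mul_le_mul_of_nonneg_left (hy i) hs.le
    have : r * b i + s * b i = b i := by rw [← add_mul, hrs, one_mul]
    exact le_of_mul_le_mul_left (by linarith) hr
  · intro x hx y hy r s hr hs hrs
    refine ⟨convex_sol A b hx.1 hy.1 hr hs hrs, ?_⟩
    rw [dotProduct_combo, hx.2, hy.2, ← add_mul, hrs, one_mul]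
  · suffices h : vectorSpan ℝ (face A b i) = normalHyperplane (A i) by
      rw [h, finrank_normalHyperplane hA]
    refine (vectorSpan_le fun x hx => hx.2).antisymm fun d hd => ?_
    rw [mem_normalHyperplane] at hd
    obtain ⟨t, ht, h⟩ := exists_step (A := A) (b := b) (x := q) d fun k => by
      by_cases hk : k = i
      · exact Or.inr ⟨hqm k, hk ▸ hd⟩
      · exact Or.inl (hq' k hk)
    refine mem_vectorSpan ht (⟨hqm, hq⟩ : q ∈ face A b i) ⟨h, ?_⟩
    rw [dotProduct_line, hd, mul_zero, add_zero, hq]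

theorem exists_eq_face [Finite ι] {F : Set (Fin 3 → ℝ)} (hA : ∀ i, A i ≠ 0)
    (hq : ∀ i, ∃ q, A i ⬝ᵥ q = b i ∧ ∀ k, k ≠ i → A k ⬝ᵥ q < b k)
    (hF : IsFacet (sol A b) F) : ∃ i, face A b i = F := by
  obtain ⟨hext, hconv, hrank⟩ := hF
  have hF0 : F.Nonempty := by
    by_contra h
    rw [not_nonempty_iff_eq_empty] at h
    rw [h, vectorSpan_empty, finrank_bot] at hrank
    omega
  have hi : ∃ i, ∀ x ∈ F, A i ⬝ᵥ x = b i := by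
    by_contra! hne
    obtain ⟨y, hy, hlt⟩ := exists_all_lt hconv hF0 hext.subset (fun _ => True) fun k _ => by
      obtain ⟨x, hx, h⟩ := hne k
      exact ⟨x, hx, lt_of_le_of_ne (hext.subset hx k) h⟩
    have hall : ∀ x ∈ sol A b, x ∈ F := fun x hx => by
      obtain ⟨t, ht, h⟩ := exists_step (A := A) (b := b) (x := y) (y - x)
        fun k => Or.inl (hlt k trivial)
      exact mem_of_isExtreme hext ht hy hx h
    have htop : vectorSpan ℝ F = ⊤ := by
      refine eq_top_iff.2 fun d _ => ?_
      obtain ⟨t, ht, h⟩ := exists_step (A := A) (b := b) (x := y) d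
        fun k => Or.inl (hlt k trivial)
      exact mem_vectorSpan ht hy (hall _ h)
    rw [htop, finrank_top, Module.finrank_fin_fun] at hrank
    omega
  obtain ⟨i, hi⟩ := hi
  have hspan : ∀ k, (∀ x ∈ F, A k ⬝ᵥ x = b k) → vectorSpan ℝ F = normalHyperplane (A k) :=
    fun k hk => Submodule.eq_of_le_of_finrank_eq (vectorSpan_le hk)
      (hrank.trans (finrank_normalHyperplane (hA k)).symm)
  obtain ⟨y, hy, hlt⟩ := exists_all_lt hconv hF0 hext.subset (fun k => k ≠ i) fun k hk => by
    by_contra! hge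
    have hk' : ∀ x ∈ F, A k ⬝ᵥ x = b k := fun x hx => (hext.subset hx k).antisymm (hge x hx)
    obtain ⟨q, hqi, hqk⟩ := hq i
    obtain ⟨x, hx⟩ := hF0
    have h : q - x ∈ normalHyperplane (A i) := by
      rw [mem_normalHyperplane, dotProduct_sub, hqi, hi x hx, sub_self]
    rw [← hspan i hi, hspan k hk', mem_normalHyperplane, dotProduct_sub, hk' x hx] at h
    linarith [hqk k hk]
  refine ⟨i, subset_antisymm (fun x hx => ?_) fun x hx => ⟨hext.subset hx, hi x hx⟩⟩
  obtain ⟨t, ht, h⟩ := exists_step (A := A) (b := b) (x := y) (y - x) fun k => by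
    by_cases hk : k = i
    · refine Or.inr ⟨hext.subset hy k, ?_⟩
      rw [hk, dotProduct_sub, hi y hy, hx.2, sub_self]
    · exact Or.inl (hlt k hk)
  exact mem_of_isExtreme hext ht hy hx.1 h

theorem ncard_facets [Finite ι] (hA : ∀ i, A i ≠ 0)
    (hq : ∀ i, ∃ q, A i ⬝ᵥ q = b i ∧ ∀ k, k ≠ i → A k ⬝ᵥ q < b k) :
    {F | IsFacet (sol A b) F}.ncard = Nat.card ι := by
  have hinj : Function.Injective (face A b) := fun i j hij => by
    by_contra hne
    obtain ⟨q, hqi, hqk⟩ := hq i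
    have hmem : q ∈ face A b i := ⟨fun k => by
      by_cases hk : k = i
      · rw [hk, hqi]
      · exact (hqk k hk).le, hqi⟩
    rw [hij] at hmem
    exact (hqk j (Ne.symm hne)).ne hmem.2
  rw [← Set.ncard_range_of_injective hinj]
  congr 1
  ext F
  refine ⟨exists_eq_face hA hq, ?_⟩
  rintro ⟨i, rfl⟩
  obtain ⟨q, hqi, hqk⟩ := hq i
  exact isFacet_face (hA i) hqi hqk

theorem finite_toReal_mem {s : Set (Fin 3 → ℝ)} (hs : Bornology.IsBounded s) :
    {z : Fin 3 → ℤ | toReal z ∈ s}.Finite := by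
  obtain ⟨R, hR⟩ := hs.exists_norm_le
  refine (finite_Icc (fun _ => ⌊-R⌋) (fun _ => ⌈R⌉)).subset fun z hz => ?_
  have h : ∀ j, |(z j : ℝ)| ≤ R := fun j => (norm_le_pi_norm (toReal z) j).trans (hR _ hz)
  refine ⟨fun j => ?_, fun j => ?_⟩
  · have h₁ : (⌊-R⌋ : ℝ) ≤ z j := (Int.floor_le _).trans (neg_le_of_abs_le (h j))
    exact_mod_cast h₁
  · have h₁ : (z j : ℝ) ≤ ⌈R⌉ := (le_of_abs_le (h j)).trans (Int.le_ceil _)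
    exact_mod_cast h₁

theorem mem_intPts_iff {x : Fin 3 → ℝ} : x ∈ intPts 3 ↔ ∃ z, toReal z = x := by
  refine ⟨fun h => ?_, ?_⟩
  · choose z hz using h
    exact ⟨z, funext fun j => (hz j).symm⟩
  · rintro ⟨z, rfl⟩ j
    exact ⟨z j, rfl⟩

/-- Every facet of a maximal lattice-free polytope has an integer point in its relative interior. -/
theorem exists_int_relInt_face [Finite ι] {x y : Fin 3 → ℝ} {i : ι} (hA : ∀ k, A k ≠ 0)
    (hb : Bornology.IsBounded (sol A b)) (hfree : interior (sol A b) ∩ intPts 3 = ∅)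
    (hmax : ∀ K : Set (Fin 3 → ℝ), Convex ℝ K → interior K ∩ intPts 3 = ∅ → sol A b ⊆ K →
      sol A b = K)
    (hx : ∀ k, A k ⬝ᵥ x < b k) (hy : b i < A i ⬝ᵥ y) (hy' : ∀ k, k ≠ i → A k ⬝ᵥ y ≤ b k) :
    ∃ z, A i ⬝ᵥ toReal z = b i ∧ ∀ k, k ≠ i → A k ⬝ᵥ toReal z < b k := by
  by_contra! hz
  obtain ⟨R, hR⟩ := (hb.union (Bornology.isBounded_singleton (x := y))).subset_closedBall 0
  have hfin := finite_toReal_mem (Metric.isBounded_closedBall (x := (0 : Fin 3 → ℝ)) (r := R))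
  obtain ⟨η, hη, hη0⟩ : ∃ η : ℝ, (∀ z ∈ {z : Fin 3 → ℤ | toReal z ∈ Metric.closedBall 0 R},
      b i < A i ⬝ᵥ toReal z → b i + η < A i ⬝ᵥ toReal z) ∧ 0 < η := by
    refine Eventually.exists (f := 𝓝[>] 0) (((eventually_all_finite hfin).2 fun z _ => ?_).and
      self_mem_nhdsWithin)
    by_cases h : b i < A i ⬝ᵥ toReal z
    · have : ∀ᶠ η : ℝ in 𝓝[>] 0, η < A i ⬝ᵥ toReal z - b i :=
        eventually_nhdsWithin_of_eventually_nhds (gt_mem_nhds (by linarith))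
      filter_upwards [this] with η hη _
      linarith
    · exact Eventually.of_forall fun _ h' => absurd h' h
  set K : Set (Fin 3 → ℝ) := sol A (fun k => b k + open Classical in if k = i then η else 0) ∩
    Metric.closedBall 0 R
  have hle : ∀ k, b k ≤ b k + open Classical in if k = i then η else 0 := fun k => by
    split_ifs <;> linarith
  have hPK : sol A b ⊆ K := fun w hw => ⟨fun k => (hw k).trans (hle k), hR (Or.inl hw)⟩
  have hint : interior K ∩ intPts 3 = ∅ := by
    rw [eq_empty_iff_forall_notMem]
    rintro w ⟨hw, hw'⟩
    obtain ⟨z, rfl⟩ := mem_intPts_iff.1 hw'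
    have hlt : ∀ k, A k ⬝ᵥ toReal z < b k + open Classical in if k = i then η else 0 := fun k =>
      lt_of_mem_interior (hA k) (fun w hw => hw.1 k) hw
    have hltk : ∀ k, k ≠ i → A k ⬝ᵥ toReal z < b k := fun k hk => by
      simpa [hk] using hlt k
    have hlti := hlt i
    rw [if_pos rfl] at hlti
    rcases lt_trichotomy (A i ⬝ᵥ toReal z) (b i) with h | h | h
    · refine (eq_empty_iff_forall_notMem.1 hfree) (toReal z) ⟨mem_interior_sol fun k => ?_, hw'⟩
      by_cases hk : k = i
      · rw [hk]
        exact h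
      · exact hltk k hk
    · obtain ⟨k, hk, hk'⟩ := hz z h
      exact absurd (hltk k hk) (not_lt.2 hk')
    · exact absurd (hη z (interior_subset hw).2 h) (not_lt.2 hlti.le)
  have hPeq := hmax K ((convex_sol A _).inter (convex_closedBall 0 R)) hint hPK
  have hD : 0 < A i ⬝ᵥ y - A i ⬝ᵥ x := by linarith [hx i]
  set δ := min η (A i ⬝ᵥ y - b i)
  have hδ0 : 0 < δ := lt_min hη0 (by linarith)
  have hδ1 : δ ≤ η := min_le_left _ _
  have hδ2 : δ ≤ A i ⬝ᵥ y - b i := min_le_right _ _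
  set r := (A i ⬝ᵥ y - b i - δ) / (A i ⬝ᵥ y - A i ⬝ᵥ x) with hr
  set s := (b i + δ - A i ⬝ᵥ x) / (A i ⬝ᵥ y - A i ⬝ᵥ x) with hs
  have hr0 : 0 ≤ r := div_nonneg (by linarith) hD.le
  have hs0 : 0 ≤ s := div_nonneg (by linarith [hx i]) hD.le
  have hrs : r + s = 1 := by
    rw [hr, hs]
    field_simp
    ring
  have hwi : A i ⬝ᵥ (r • x + s • y) = b i + δ := by
    rw [dotProduct_combo, hr, hs]
    field_simp
    ring
  have hw : r • x + s • y ∈ K := by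
    refine ⟨fun k => ?_, convex_closedBall 0 R (hR (Or.inl fun k => (hx k).le)) (hR (Or.inr rfl))
      hr0 hs0 hrs⟩
    by_cases hk : k = i
    · rw [hk, hwi]
      simpa using hδ1
    · have h₁ := mul_le_mul_of_nonneg_left (hx k).le hr0
      have h₂ := mul_le_mul_of_nonneg_left (hy' k hk) hs0
      have : r * b k + s * b k = b k := by rw [← add_mul, hrs, one_mul]
      rw [dotProduct_combo]
      simp only [if_neg hk]
      linarith
  rw [← hPeq] at hw
  linarith [hw i]

end Inequalities

open Inequalities in
/-- A polytope in `𝓜³` with six facets is described by a `SixFacets` system. -/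
theorem MemM3.exists_sixFacets {P : Set (Fin 3 → ℝ)} (hP : MemM3 P)
    (h6 : {F : Set (Fin 3 → ℝ) | IsFacet P F}.ncard = 6) : ∃ S : SixFacets, P = S.body := by
  obtain ⟨⟨n, A₀, b₀, hP₀⟩, hb, hintegral, ⟨x, hx⟩, hfree, hmax⟩ := hP
  obtain ⟨s, hs, hirr⟩ := exists_irredundant A₀ b₀
  set A : s → Fin 3 → ℝ := fun i => A₀ i
  set b : s → ℝ := fun i => b₀ i
  obtain rfl : P = sol A b := by
    rw [← hs, hP₀]
    rfl
  have hA : ∀ i, A i ≠ 0 := fun i h => by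
    obtain ⟨y, hy, -⟩ := hirr i
    have h₁ := interior_subset hx i
    change b i < A i ⬝ᵥ y at hy
    rw [h, zero_dotProduct] at h₁ hy
    linarith
  have hx' : ∀ k, A k ⬝ᵥ x < b k := fun k =>
    lt_of_mem_interior (hA k) (fun y (hy : y ∈ sol A b) => hy k) hx
  have hcard : Nat.card s = 6 := by
    rw [← h6, ncard_facets hA fun i => ?_]
    obtain ⟨y, hy, hy'⟩ := hirr i
    exact exists_relInt_face hx' hy hy'
  have e : Fin 6 ≃ s := (Finite.equivFinOfCardEq hcard).symm
  have hp : ∀ i, ∃ z, A i ⬝ᵥ toReal z = b i ∧ ∀ k, k ≠ i → A k ⬝ᵥ toReal z < b k := fun i => by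
    obtain ⟨y, hy, hy'⟩ := hirr i
    exact exists_int_relInt_face hA hb hfree hmax hx' hy hy'
  choose p hp hp' using hp
  have hmem : ∀ w, w ∈ sol A b ↔ ∀ i, 0 ≤ b (e i) - A (e i) ⬝ᵥ w := fun w => by
    simp only [sub_nonneg]
    exact e.symm.forall_congr (by simp)
  refine ⟨⟨fun i => A (e i), fun i => b (e i), fun i => p (e i), fun i => ?_, fun i j hij => ?_,
    fun z => ?_, ?_, ?_⟩, ?_⟩
  · rw [hp, sub_self]
  · exact sub_pos.2 (hp' _ _ (e.injective.ne hij))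
  · by_contra! h
    refine (eq_empty_iff_forall_notMem.1 hfree) (toReal z)
      ⟨mem_interior_sol fun k => ?_, mem_intPts_iff.2 ⟨z, rfl⟩⟩
    have := h (e.symm k)
    rw [e.apply_symm_apply] at this
    linarith
  · simpa only [hmem] using finite_toReal_mem hb
  · intro w hw
    have hw' := (hmem w).2 hw
    rw [hintegral] at hw'
    refine convexHull_mono ?_ hw'
    rintro v ⟨hv, hv'⟩
    obtain ⟨z, rfl⟩ := mem_intPts_iff.1 hv'
    exact ⟨z, (hmem _).1 hv, rfl⟩
  · ext w
    exact hmem w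

/-- Every maximal lattice-free integral polytope in `ℝ³` with exactly six facets is,
up to a unimodular transformation, the parallelepiped `M₁₂`. -/
theorem M3_six_facets_is_parallelepiped (P : Set (Fin 3 → ℝ)) (hP : MemM3 P)
    (h6 : {F : Set (Fin 3 → ℝ) | IsFacet P F}.ncard = 6) :
    ∃ (U : Matrix (Fin 3) (Fin 3) ℤ) (v : Fin 3 → ℤ),
      |U.det| = 1 ∧ P = affMap U (fun i => (v i : ℝ)) '' M12 := by
  obtain ⟨S, rfl⟩ := hP.exists_sixFacets h6
  exact S.body_eq
end

section
/- Let P ∈ 𝓜³ be a maximal lattice-free integral polytope that is a pyramid P = conv(F ∪ {a}) whose base F is a quadrilateral contained in the plane ℝ² × {0} and whose apex a = (a₁, a₂, a₃) satisfies a₃ = 2. Then there exist a matrix U ∈ ℤ^{3×3} with |det U| = 1 and a vector v ∈ ℤ³ such that P = U·M₈ + v, where M₈ = conv{(2,0,0), (−2,0,0), (0,2,0), (0,−2,0), (1,1,2)}. -/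
open Set

def M8 : Set (Fin 3 → ℝ) :=
  convexHull ℝ ({![2,0,0], ![-2,0,0], ![0,2,0], ![0,-2,0], ![1,1,2]} : Set (Fin 3 → ℝ))

/-- Twice the signed area of the triangle `p q r`. -/
def cr (p q r : ℤ × ℤ) : ℤ :=
  (q.1 - p.1) * (r.2 - p.2) - (q.2 - p.2) * (r.1 - p.1)

/-- The points `p, q, r, s` are the vertices of a convex quadrilateral in counterclockwise order. -/
def CCW (p q r s : ℤ × ℤ) : Prop :=
  0 < cr p q r ∧ 0 < cr q r s ∧ 0 < cr r s p ∧ 0 < cr s p q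

lemma CCW.rotate {p q r s : ℤ × ℤ} (h : CCW p q r s) : CCW q r s p :=
  ⟨h.2.1, h.2.2.1, h.2.2.2, h.1⟩

lemma cr_rotate (p q r : ℤ × ℤ) : cr q r p = cr p q r := by
  simp only [cr]; ring

/-- No nontrivial nonnegative integer weights on `q, r, s` have barycentre `p`. -/
def NotInHull (p q r s : ℤ × ℤ) : Prop :=
  ∀ x y z : ℤ, 0 ≤ x → 0 ≤ y → 0 ≤ z → 0 < x + y + z →
    (x + y + z) * p.1 = x * q.1 + y * r.1 + z * s.1 →
    (x + y + z) * p.2 = x * q.2 + y * r.2 + z * s.2 → False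

/-- If four integers with vanishing alternating sum are not all zero and none of `A, -B, C, -D` is
the only one of its sign, then two of them are positive and two are negative. -/
lemma sign_pattern_two_two (A B C D : ℤ) (hsum : A - B + C - D = 0)
    (hne : ¬ (D = 0 ∧ C = 0 ∧ B = 0 ∧ A = 0))
    (hA : 0 < A → ¬ (0 ≤ B ∧ C ≤ 0 ∧ 0 ≤ D)) (hA' : A < 0 → ¬ (B ≤ 0 ∧ 0 ≤ C ∧ D ≤ 0))
    (hB : 0 < B → ¬ (0 ≤ A ∧ 0 ≤ C ∧ D ≤ 0)) (hB' : B < 0 → ¬ (A ≤ 0 ∧ C ≤ 0 ∧ 0 ≤ D))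
    (hC : C < 0 → ¬ (0 ≤ A ∧ B ≤ 0 ∧ D ≤ 0)) (hC' : 0 < C → ¬ (A ≤ 0 ∧ 0 ≤ B ∧ 0 ≤ D))
    (hD : 0 < D → ¬ (0 ≤ A ∧ B ≤ 0 ∧ 0 ≤ C)) (hD' : D < 0 → ¬ (A ≤ 0 ∧ 0 ≤ B ∧ C ≤ 0)) :
    (0 < A ∧ 0 < B ∧ 0 < C ∧ 0 < D) ∨ (0 < A ∧ 0 < B ∧ C < 0 ∧ D < 0) ∨
      (0 < A ∧ B < 0 ∧ C < 0 ∧ 0 < D) ∨ (A < 0 ∧ 0 < B ∧ 0 < C ∧ D < 0) ∨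
      (A < 0 ∧ B < 0 ∧ 0 < C ∧ 0 < D) ∨ (A < 0 ∧ B < 0 ∧ C < 0 ∧ D < 0) := by
  rcases lt_trichotomy A 0 with h | h | h <;> rcases lt_trichotomy B 0 with h' | h' | h' <;>
    rcases lt_trichotomy C 0 with h'' | h'' | h'' <;>
    rcases lt_trichotomy D 0 with h''' | h''' | h''' <;>
    simp_all [le_of_lt, not_lt_of_gt] <;> omega

lemma exists_ccw_order (p q r s : ℤ × ℤ)
    (hp : NotInHull p q r s) (hq : NotInHull q p r s) (hr : NotInHull r p q s)
    (hs : NotInHull s p q r)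
    (hne : ¬ (cr p q r = 0 ∧ cr p q s = 0 ∧ cr p r s = 0 ∧ cr q r s = 0)) :
    ∃ p' q' r' s' : ℤ × ℤ, ({p', q', r', s'} : Set (ℤ × ℤ)) = {p, q, r, s} ∧
      CCW p' q' r' s' := by
  have hsum : cr q r s - cr p r s + cr p q s - cr p q r = 0 := by simp only [cr]; ring
  have e1 : cr q r s * p.1 - cr p r s * q.1 + cr p q s * r.1 - cr p q r * s.1 = 0 := by
    simp only [cr]; ring
  have e2 : cr q r s * p.2 - cr p r s * q.2 + cr p q s * r.2 - cr p q r * s.2 = 0 := by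
    simp only [cr]; ring
  have p1 := hp (cr p r s) (-cr p q s) (cr p q r)
  have p2 := hp (-cr p r s) (cr p q s) (-cr p q r)
  have q1 := hq (cr q r s) (cr p q s) (-cr p q r)
  have q2 := hq (-cr q r s) (-cr p q s) (cr p q r)
  have r1 := hr (cr q r s) (-cr p r s) (-cr p q r)
  have r2 := hr (-cr q r s) (cr p r s) (cr p q r)
  have s1 := hs (cr q r s) (-cr p r s) (cr p q s)
  have s2 := hs (-cr q r s) (cr p r s) (-cr p q s)
  have hp' : 0 < cr q r s → ¬ (0 ≤ cr p r s ∧ cr p q s ≤ 0 ∧ 0 ≤ cr p q r) := fun h ⟨h1, h2, h3⟩ =>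
    p1 h1 (by linarith) h3 (by linarith) (by linear_combination e1 - p.1 * hsum)
      (by linear_combination e2 - p.2 * hsum)
  have hp'' : cr q r s < 0 → ¬ (cr p r s ≤ 0 ∧ 0 ≤ cr p q s ∧ cr p q r ≤ 0) :=
    fun h ⟨h1, h2, h3⟩ =>
    p2 (by linarith) (by linarith) (by linarith) (by linarith)
      (by linear_combination -e1 + p.1 * hsum) (by linear_combination -e2 + p.2 * hsum)
  have hq' : 0 < cr p r s → ¬ (0 ≤ cr q r s ∧ 0 ≤ cr p q s ∧ cr p q r ≤ 0) :=
    fun h ⟨h1, h2, h3⟩ =>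
    q1 (by linarith) (by linarith) (by linarith) (by linarith)
      (by linear_combination -e1 + q.1 * hsum) (by linear_combination -e2 + q.2 * hsum)
  have hq'' : cr p r s < 0 → ¬ (cr q r s ≤ 0 ∧ cr p q s ≤ 0 ∧ 0 ≤ cr p q r) :=
    fun h ⟨h1, h2, h3⟩ =>
    q2 (by linarith) (by linarith) (by linarith) (by linarith)
      (by linear_combination e1 - q.1 * hsum) (by linear_combination e2 - q.2 * hsum)
  have hr' : cr p q s < 0 → ¬ (0 ≤ cr q r s ∧ cr p r s ≤ 0 ∧ cr p q r ≤ 0) :=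
    fun h ⟨h1, h2, h3⟩ =>
    r1 (by linarith) (by linarith) (by linarith) (by linarith)
      (by linear_combination -e1 + r.1 * hsum) (by linear_combination -e2 + r.2 * hsum)
  have hr'' : 0 < cr p q s → ¬ (cr q r s ≤ 0 ∧ 0 ≤ cr p r s ∧ 0 ≤ cr p q r) :=
    fun h ⟨h1, h2, h3⟩ =>
    r2 (by linarith) (by linarith) (by linarith) (by linarith)
      (by linear_combination e1 - r.1 * hsum) (by linear_combination e2 - r.2 * hsum)
  have hs' : 0 < cr p q r → ¬ (0 ≤ cr q r s ∧ cr p r s ≤ 0 ∧ 0 ≤ cr p q s) :=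
    fun h ⟨h1, h2, h3⟩ =>
    s1 (by linarith) (by linarith) (by linarith) (by linarith)
      (by linear_combination -e1 + s.1 * hsum) (by linear_combination -e2 + s.2 * hsum)
  have hs'' : cr p q r < 0 → ¬ (cr q r s ≤ 0 ∧ 0 ≤ cr p r s ∧ cr p q s ≤ 0) :=
    fun h ⟨h1, h2, h3⟩ =>
    s2 (by linarith) (by linarith) (by linarith) (by linarith)
      (by linear_combination e1 - s.1 * hsum) (by linear_combination e2 - s.2 * hsum)
  clear p1 p2 q1 q2 r1 r2 s1 s2 hp hq hr hs e1 e2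
  have key := sign_pattern_two_two _ _ _ _ hsum (by tauto) hp' hp'' hq' hq'' hr' hr'' hs' hs''
  clear hp' hp'' hq' hq'' hr' hr'' hs' hs'' hsum hne
  rcases key with h | h | h | h | h | h
  · refine ⟨p, q, r, s, rfl, ?_⟩
    simp only [cr, CCW] at h ⊢
    refine ⟨?_, ?_, ?_, ?_⟩ <;> linarith
  · refine ⟨p, r, s, q, by ext; simp only [mem_insert_iff, mem_singleton_iff]; tauto, ?_⟩
    simp only [cr, CCW] at h ⊢
    refine ⟨?_, ?_, ?_, ?_⟩ <;> linarith
  · refine ⟨p, s, q, r, by ext; simp only [mem_insert_iff, mem_singleton_iff]; tauto, ?_⟩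
    simp only [cr, CCW] at h ⊢
    refine ⟨?_, ?_, ?_, ?_⟩ <;> linarith
  · refine ⟨p, r, q, s, by ext; simp only [mem_insert_iff, mem_singleton_iff]; tauto, ?_⟩
    simp only [cr, CCW] at h ⊢
    refine ⟨?_, ?_, ?_, ?_⟩ <;> linarith
  · refine ⟨p, q, s, r, by ext; simp only [mem_insert_iff, mem_singleton_iff]; tauto, ?_⟩
    simp only [cr, CCW] at h ⊢
    refine ⟨?_, ?_, ?_, ?_⟩ <;> linarith
  · refine ⟨p, s, r, q, by ext; simp only [mem_insert_iff, mem_singleton_iff]; tauto, ?_⟩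
    simp only [cr, CCW] at h ⊢
    refine ⟨?_, ?_, ?_, ?_⟩ <;> linarith

/-- The determinant of two integer vectors. -/
def det2 (u v : ℤ × ℤ) : ℤ := u.1 * v.2 - u.2 * v.1

/-- A lattice triangle `0, e, f` of normalized area larger than one contains a lattice point other
than its vertices. -/
lemma exists_lattice_point_of_one_lt_det2 (e f : ℤ × ℤ) (h : 1 < det2 e f) :
    ∃ m : ℤ × ℤ, 0 ≤ det2 m f ∧ 0 ≤ det2 e m ∧ det2 m f < det2 e f ∧ det2 e m < det2 e f ∧
      0 < det2 m f + det2 e m ∧ det2 m f + det2 e m ≤ det2 e f := by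
  set D := det2 e f with hD
  have hDpos : 0 < D := by linarith
  obtain ⟨g, hg⟩ : ∃ g : ℤ × ℤ, ¬ (D ∣ det2 g f ∧ D ∣ det2 e g) := by
    by_contra! hall
    obtain ⟨⟨x1, h1⟩, ⟨x2, h2⟩⟩ := hall (1, 0)
    obtain ⟨⟨x3, h3⟩, ⟨x4, h4⟩⟩ := hall (0, 1)
    simp only [det2] at h1 h2 h3 h4 hD
    have : D * (D * (x1 * x4 - x2 * x3)) = D * 1 := by
      have : (1 * f.2 - 0 * f.1) * (e.1 * 1 - e.2 * 0) - (e.1 * 0 - e.2 * 1) * (0 * f.2 - 1 * f.1)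
          = D := by rw [hD]; ring
      rw [h1, h2, h3, h4] at this
      linarith
    have h5 : D * (x1 * x4 - x2 * x3) = 1 := mul_left_cancel₀ hDpos.ne' this
    have := Int.le_of_dvd one_pos (Dvd.intro _ h5)
    linarith
  set α := det2 g f % D with hα
  set β := det2 e g % D with hβ
  have a0 : 0 ≤ α := Int.emod_nonneg _ hDpos.ne'
  have b0 : 0 ≤ β := Int.emod_nonneg _ hDpos.ne'
  have a1 : α < D := Int.emod_lt_of_pos _ hDpos
  have b1 : β < D := Int.emod_lt_of_pos _ hDpos
  have hpos : 0 < α + β := by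
    by_contra hc
    exact hg ⟨Int.dvd_of_emod_eq_zero (by omega), Int.dvd_of_emod_eq_zero (by omega)⟩
  set k := det2 g f / D
  set l := det2 e g / D
  have hk : det2 g f = D * k + α := (Int.mul_ediv_add_emod _ _).symm
  have hl : det2 e g = D * l + β := (Int.mul_ediv_add_emod _ _).symm
  have m1 : det2 (g - (k * e.1 + l * f.1, k * e.2 + l * f.2)) f = α := by
    have : det2 (g - (k * e.1 + l * f.1, k * e.2 + l * f.2)) f = det2 g f - D * k := by
      simp only [det2, hD, Prod.fst_sub, Prod.snd_sub]; ring
    linarith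
  have m2 : det2 e (g - (k * e.1 + l * f.1, k * e.2 + l * f.2)) = β := by
    have : det2 e (g - (k * e.1 + l * f.1, k * e.2 + l * f.2)) = det2 e g - D * l := by
      simp only [det2, hD, Prod.fst_sub, Prod.snd_sub]; ring
    linarith
  set m := g - (k * e.1 + l * f.1, k * e.2 + l * f.2)
  by_cases hle : α + β ≤ D
  · exact ⟨m, by rw [m1, m2]; exact ⟨a0, b0, a1, b1, hpos, hle⟩⟩
  · have n1 : det2 (e + f - m) f = D - α := by
      rw [← m1, hD]; simp only [det2, Prod.fst_sub, Prod.snd_sub, Prod.fst_add, Prod.snd_add]; ring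
    have n2 : det2 e (e + f - m) = D - β := by
      rw [← m2, hD]; simp only [det2, Prod.fst_sub, Prod.snd_sub, Prod.fst_add, Prod.snd_add]; ring
    exact ⟨e + f - m, by rw [n1, n2]; omega⟩

/-- The point `2 z - a`. -/
def refl2 (a z : ℤ × ℤ) : ℤ × ℤ := (2 * z.1 - a.1, 2 * z.2 - a.2)

/-- `w` lies in the relative interior of the edge `p q` of the convex quadrilateral `p q r s`. -/
def OnEdge (p q r s w : ℤ × ℤ) : Prop :=
  cr p q w = 0 ∧ 0 < cr q r w ∧ 0 < cr r s w ∧ 0 < cr s p w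

/-- `w` lies in the interior of the convex quadrilateral `p q r s`. -/
def InQuad (p q r s w : ℤ × ℤ) : Prop :=
  0 < cr p q w ∧ 0 < cr q r w ∧ 0 < cr r s w ∧ 0 < cr s p w

lemma OnEdge.exists_ratio {p q r s w : ℤ × ℤ} (h : CCW p q r s) (hw : OnEdge p q r s w) :
    ∃ t : ℚ, 0 < t ∧ t < 1 ∧ (w.1 : ℚ) = (1 - t) * p.1 + t * q.1 ∧
      (w.2 : ℚ) = (1 - t) * p.2 + t * q.2 := by
  obtain ⟨h1, h2, h3, h4⟩ := h
  obtain ⟨w1, w2, w3, w4⟩ := hw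
  have hA : (0 : ℚ) < cr p q r := by exact_mod_cast h1
  have hB : (0 : ℚ) < cr q r w := by exact_mod_cast w2
  have hC : (0 : ℚ) < cr s p q := by exact_mod_cast h4
  have hE : (0 : ℚ) < cr s p w := by exact_mod_cast w4
  have w1' : (cr p q w : ℚ) = 0 := by exact_mod_cast w1
  refine ⟨1 - cr q r w / cr p q r, ?_, ?_, ?_, ?_⟩
  · have : (cr p q r : ℚ) * cr s p w = (cr p q r - cr q r w) * cr s p q := by
      simp only [cr] at *; push_cast at *
      linear_combination ((p.1 - s.1) * (r.2 - q.2) - (p.2 - s.2) * (r.1 - q.1) : ℚ) * w1'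
    have h5 : 0 < (cr p q r - cr q r w : ℚ) := by
      have : 0 < (cr p q r - cr q r w : ℚ) * cr s p q := by rw [← this]; positivity
      exact pos_of_mul_pos_left this hC.le
    rw [sub_pos, div_lt_one hA]; linarith
  · have : (0 : ℚ) < cr q r w / cr p q r := by positivity
    linarith
  · field_simp
    simp only [cr] at *; push_cast at *
    linear_combination (r.1 - q.1 : ℚ) * w1'
  · field_simp
    simp only [cr] at *; push_cast at *
    linear_combination (r.2 - q.2 : ℚ) * w1'

lemma cr_pos_of_onEdge {p q r s u v w : ℤ × ℤ} (h : CCW p q r s) (hu : OnEdge p q r s u)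
    (hv : OnEdge q r s p v) (hw : OnEdge r s p q w) : 0 < cr u v w := by
  obtain ⟨x, x0, x1, hx1, hx2⟩ := hu.exists_ratio h
  obtain ⟨y, y0, y1, hy1, hy2⟩ := hv.exists_ratio h.rotate
  obtain ⟨z, z0, z1, hz1, hz2⟩ := hw.exists_ratio h.rotate.rotate
  obtain ⟨h1, h2, h3, h4⟩ := h
  have h1' : (0 : ℚ) < cr p q r := by exact_mod_cast h1
  have h2' : (0 : ℚ) < cr q r s := by exact_mod_cast h2
  have h3' : (0 : ℚ) < cr r s p := by exact_mod_cast h3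
  have h4' : (0 : ℚ) < cr s p q := by exact_mod_cast h4
  have x1' : 0 < 1 - x := by linarith
  have y1' : 0 < 1 - y := by linarith
  have z1' : 0 < 1 - z := by linarith
  have key : (cr u v w : ℚ) = (1 - x) * (1 - y) * (1 - z) * cr p q r
      + (1 - x) * (1 - y) * z * cr s p q + (1 - x) * y * z * cr r s p
      + x * y * z * cr q r s := by
    simp only [cr]; push_cast; rw [hx1, hx2, hy1, hy2, hz1, hz2]; ring
  have : (0 : ℚ) < cr u v w := by rw [key]; positivity
  exact_mod_cast this

lemma cr_refl2 (a u v w : ℤ × ℤ) :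
    cr (refl2 a u) (refl2 a v) (refl2 a w) = 4 * cr u v w := by
  simp only [cr, refl2]; ring

/-- Consecutive lattice points on the edges of a lattice-free quadrilateral span a unimodular
triangle. -/
lemma cr_eq_one_of_onEdge {a p q r s u v w : ℤ × ℤ} (h : CCW p q r s)
    (hfree : ∀ z, ¬ InQuad p q r s (refl2 a z)) (hu : OnEdge p q r s (refl2 a u))
    (hv : OnEdge q r s p (refl2 a v)) (hw : OnEdge r s p q (refl2 a w)) : cr u v w = 1 := by
  have hpos := cr_pos_of_onEdge h hu hv hw
  rw [cr_refl2] at hpos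
  by_contra hne
  have hD : det2 (v - u) (w - u) = cr u v w := by simp [det2, cr]
  obtain ⟨m, m1, m2, m3, m4, m5, m6⟩ :=
    exists_lattice_point_of_one_lt_det2 (v - u) (w - u) (by omega)
  have comb : ∀ x y : ℤ × ℤ, det2 (v - u) (w - u) * cr x y (refl2 a (u + m)) =
      (det2 (v - u) (w - u) - det2 m (w - u) - det2 (v - u) m) * cr x y (refl2 a u)
      + det2 m (w - u) * cr x y (refl2 a v) + det2 (v - u) m * cr x y (refl2 a w) := by
    intro x y
    simp only [det2, cr, refl2, Prod.fst_sub, Prod.snd_sub, Prod.fst_add, Prod.snd_add]; ring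
  obtain ⟨u1, u2, u3, u4⟩ := hu
  obtain ⟨v1, v2, v3, v4⟩ := hv
  obtain ⟨w1, w2, w3, w4⟩ := hw
  have hDpos : 0 < det2 (v - u) (w - u) := by omega
  set A := det2 m (w - u)
  set B := det2 (v - u) m
  set D := det2 (v - u) (w - u)
  have pos : ∀ X a b c : ℤ, D * X = (D - A - B) * a + A * b + B * c → 0 ≤ a → 0 ≤ b → 0 ≤ c →
      0 < a + b → 0 < b + c → 0 < a + c → 0 < X := by
    intro X a b c e ha hb hc hab hbc hac
    refine pos_of_mul_pos_right (a := D) ?_ hDpos.le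
    rw [e]
    have i1 : 0 ≤ (D - A - B) * a := mul_nonneg (by omega) ha
    have i2 : 0 ≤ A * b := mul_nonneg m1 hb
    have i3 : 0 ≤ B * c := mul_nonneg m2 hc
    by_contra hcon
    have j1 : (D - A - B) * a = 0 := by omega
    have j2 : A * b = 0 := by omega
    have j3 : B * c = 0 := by omega
    rw [mul_eq_zero] at j1 j2 j3
    omega
  exact hfree (u + m) ⟨pos _ _ _ _ (comb p q) (by omega) (by omega) (by omega) (by omega)
    (by omega) (by omega), pos _ _ _ _ (comb q r) (by omega) (by omega) (by omega) (by omega)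
    (by omega) (by omega), pos _ _ _ _ (comb r s) (by omega) (by omega) (by omega) (by omega)
    (by omega) (by omega), pos _ _ _ _ (comb s p) (by omega) (by omega) (by omega) (by omega)
    (by omega) (by omega)⟩

/-- An integral convex quadrilateral whose four edges pass through the four vertices of the square
with vertices `(0, 0), (2, 0), (2, 2), (0, 2)` is unique. -/
lemma eq_of_edges_through_square (p q r s : ℤ × ℤ)
    (p1 : cr p q (0, 0) = 0) (p2 : 0 < cr p q (2, 0)) (p4 : 0 < cr p q (0, 2))
    (q1 : cr q r (2, 0) = 0) (q2 : 0 < cr q r (2, 2)) (q4 : 0 < cr q r (0, 0))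
    (r1 : cr r s (2, 2) = 0) (r2 : 0 < cr r s (0, 2)) (r4 : 0 < cr r s (2, 0))
    (s1 : cr s p (0, 2) = 0) (s2 : 0 < cr s p (0, 0)) (s4 : 0 < cr s p (2, 2)) :
    p = (-1, 1) ∧ q = (1, -1) ∧ r = (3, 1) ∧ s = (1, 3) := by
  have aux : ∀ A B A' B' x y : ℤ, 0 < A → 0 < B → 0 < A' → 0 < B' → A * x + B * y = 0 →
      A' * (2 - x) + B' * y = 0 → x = 1 ∧ y < 0 := by
    intro A B A' B' x y hA hB hA' hB' e1 e2
    have hx0 : 0 < x := by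
      by_contra hx
      have : 0 ≤ y := by by_contra hy; nlinarith
      nlinarith
    have hy : y < 0 := by by_contra hy; nlinarith
    have hx2 : x < 2 := by by_contra hx; nlinarith
    exact ⟨by omega, hy⟩
  obtain ⟨px, py⟩ := p
  obtain ⟨qx, qy⟩ := q
  obtain ⟨rx, ry⟩ := r
  obtain ⟨sx, sy⟩ := s
  simp only [cr] at *
  obtain ⟨hq, hq'⟩ := aux (py - qy) (qx - px) (ry - qy) (rx - qx) qx qy (by linarith) (by linarith)
    (by linarith) (by linarith) (by linarith) (by linarith)
  obtain ⟨hr, hr'⟩ := aux (rx - qx) (ry - qy) (rx - sx) (sy - ry) ry (2 - rx) (by linarith)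
    (by linarith) (by linarith) (by linarith) (by linarith) (by linarith)
  obtain ⟨hs, hs'⟩ := aux (sy - py) (sx - px) (sy - ry) (rx - sx) sx (2 - sy) (by linarith)
    (by linarith) (by linarith) (by linarith) (by linarith) (by linarith)
  obtain ⟨hp, hp'⟩ := aux (qx - px) (py - qy) (sx - px) (sy - py) py px (by linarith)
    (by linarith) (by linarith) (by linarith) (by linarith) (by linarith)
  subst hq hr hs hp
  have e1 : px * qy = 1 := by linarith
  have e2 : (2 - rx) * (2 - sy) = 1 := by linarith
  have f1 := Int.eq_one_or_neg_one_of_mul_eq_one' e1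
  have f2 := Int.eq_one_or_neg_one_of_mul_eq_one' e2
  simp only [Prod.mk.injEq, and_true, true_and]
  refine ⟨?_, ?_, ?_, ?_⟩ <;> omega

/-- Classification of the integral convex quadrilaterals that are lattice-free with respect to
`2 ℤ² - a` and have a point of this lattice in the relative interior of each edge. -/
lemma exists_basis_of_lattice_free {a p q r s u v w x : ℤ × ℤ} (h : CCW p q r s)
    (hfree : ∀ z, ¬ InQuad p q r s (refl2 a z)) (hu : OnEdge p q r s (refl2 a u))
    (hv : OnEdge q r s p (refl2 a v)) (hw : OnEdge r s p q (refl2 a w))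
    (hx : OnEdge s p q r (refl2 a x)) :
    ∃ e f c : ℤ × ℤ, det2 e f = 1 ∧ c = refl2 a u + e + f ∧
      p = c - 2 * e ∧ q = c - 2 * f ∧ r = c + 2 * e ∧ s = c + 2 * f := by
  have hfree' : ∀ z, ¬ InQuad q r s p (refl2 a z) :=
    fun z hz => hfree z ⟨hz.2.2.2, hz.1, hz.2.1, hz.2.2.1⟩
  have hfree'' : ∀ z, ¬ InQuad s p q r (refl2 a z) :=
    fun z hz => hfree z ⟨hz.2.1, hz.2.2.1, hz.2.2.2, hz.1⟩
  have d1 := cr_eq_one_of_onEdge h hfree hu hv hw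
  have d2 := cr_eq_one_of_onEdge h.rotate hfree' hv hw hx
  have d3 := cr_eq_one_of_onEdge h.rotate.rotate.rotate hfree'' hx hu hv
  obtain ⟨ux, uy⟩ := u
  obtain ⟨vx, vy⟩ := v
  obtain ⟨wx, wy⟩ := w
  obtain ⟨xx, xy⟩ := x
  simp only [cr] at d1 d2 d3
  have g1 : xx = ux + wx - vx := by
    linear_combination -(vx - ux) * (d2 - d1) + (wx - vx) * (d3 - d1) - (xx - ux - wx + vx) * d1
  have g2 : xy = uy + wy - vy := by
    linear_combination -(vy - uy) * (d2 - d1) + (wy - vy) * (d3 - d1) - (xy - uy - wy + vy) * d1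
  subst g1 g2
  have hef : (vx - ux) * (wy - vy) - (vy - uy) * (wx - vx) = 1 := by linear_combination d1
  clear d1 d2 d3 hfree hfree' hfree''
  obtain ⟨e1, he1⟩ : ∃ t, t = vx - ux := ⟨_, rfl⟩
  obtain ⟨e2, he2⟩ : ∃ t, t = vy - uy := ⟨_, rfl⟩
  obtain ⟨f1, hf1⟩ : ∃ t, t = wx - vx := ⟨_, rfl⟩
  obtain ⟨f2, hf2⟩ : ∃ t, t = wy - vy := ⟨_, rfl⟩
  obtain rfl : vx = ux + e1 := by linarith
  obtain rfl : vy = uy + e2 := by linarith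
  obtain rfl : wx = ux + e1 + f1 := by linarith
  obtain rfl : wy = uy + e2 + f2 := by linarith
  rw [← he1, ← he2, ← hf1, ← hf2] at hef
  clear he1 he2 hf1 hf2
  set T : ℤ × ℤ → ℤ × ℤ := fun y => (det2 (y - refl2 a (ux, uy)) (f1, f2),
    det2 (e1, e2) (y - refl2 a (ux, uy))) with hT
  have hcr : ∀ y z t, cr (T y) (T z) (T t) = cr y z t := by
    intro y z t
    simp only [cr, T, det2, Prod.fst_sub, Prod.snd_sub]
    linear_combination ((z.1 - y.1) * (t.2 - y.2) - (z.2 - y.2) * (t.1 - y.1)) * hef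
  have T0 : T (refl2 a (ux, uy)) = (0, 0) := by simp [T, det2]
  have T1 : T (refl2 a (ux + e1, uy + e2)) = (2, 0) := by
    simp only [T, det2, refl2, Prod.fst_sub, Prod.snd_sub, Prod.mk.injEq]
    exact ⟨by linear_combination 2 * hef, by ring⟩
  have T2 : T (refl2 a (ux + e1 + f1, uy + e2 + f2)) = (2, 2) := by
    simp only [T, det2, refl2, Prod.fst_sub, Prod.snd_sub, Prod.mk.injEq]
    exact ⟨by linear_combination 2 * hef, by linear_combination 2 * hef⟩
  have T3 : T (refl2 a (ux + (ux + e1 + f1) - (ux + e1), uy + (uy + e2 + f2) - (uy + e2))) =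
      (0, 2) := by
    simp only [T, det2, refl2, Prod.fst_sub, Prod.snd_sub, Prod.mk.injEq]
    exact ⟨by ring, by linear_combination 2 * hef⟩
  simp only [OnEdge, ← hcr _ _ (refl2 _ _), T0, T1, T2, T3] at hu hv hw hx
  obtain ⟨hp, hq, hr, hs⟩ := eq_of_edges_through_square (T p) (T q) (T r) (T s)
    hu.1 hv.2.2.2 hx.2.1 hv.1 hw.2.2.2 hu.2.1 hw.1 hx.2.2.2 hv.2.1 hx.1 hu.2.2.2 hw.2.1
  have hinv : ∀ y, y = ((refl2 a (ux, uy)).1 + (T y).1 * e1 + (T y).2 * f1,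
      (refl2 a (ux, uy)).2 + (T y).1 * e2 + (T y).2 * f2) := by
    intro y
    simp only [T, det2, Prod.fst_sub, Prod.snd_sub, Prod.ext_iff]
    exact ⟨by linear_combination -(y.1 - (refl2 a (ux, uy)).1) * hef,
      by linear_combination -(y.2 - (refl2 a (ux, uy)).2) * hef⟩
  refine ⟨(e1, e2), (f1, f2), _, hef, rfl, ?_, ?_, ?_, ?_⟩
  · rw [hinv p, hp]; ext <;> simp <;> ring
  · rw [hinv q, hq]; ext <;> simp <;> ring
  · rw [hinv r, hr]; ext <;> simp <;> ring
  · rw [hinv s, hs]; ext <;> simp <;> ring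

/-- The point of the plane `x₃ = 0` with the given integer coordinates. -/
noncomputable def basePt (p : ℤ × ℤ) : Fin 3 → ℝ := ![(p.1 : ℝ), (p.2 : ℝ), 0]

/-- The point of the plane `x₃ = 2` with the given integer coordinates. -/
noncomputable def apexPt (a : ℤ × ℤ) : Fin 3 → ℝ := ![(a.1 : ℝ), (a.2 : ℝ), 2]

/-- The pyramid with base vertices `p, q, r, s` at height zero and apex `a` at height two. -/
noncomputable def pyramid (p q r s a : ℤ × ℤ) : Set (Fin 3 → ℝ) :=
  convexHull ℝ {basePt p, basePt q, basePt r, basePt s, apexPt a}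

/-- An affine function which for `ε = 0` vanishes on the plane through the edge `p q` and the
apex `a`; the parameter `ε` shifts its zero set while keeping the apex on it. -/
noncomputable def facet (p q a : ℤ × ℤ) (ε : ℝ) (x : Fin 3 → ℝ) : ℝ :=
  (q.1 - p.1) * (2 * x 1 - x 2 * a.2 - (2 - x 2) * p.2)
    - (q.2 - p.2) * (2 * x 0 - x 2 * a.1 - (2 - x 2) * p.1) + ε * (2 - x 2)

lemma facet_basePt (p q a v : ℤ × ℤ) (ε : ℝ) :
    facet p q a ε (basePt v) = 2 * cr p q v + 2 * ε := by
  simp [facet, basePt, cr]; ring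

lemma facet_apexPt (p q a : ℤ × ℤ) (ε : ℝ) : facet p q a ε (apexPt a) = 0 := by
  simp [facet, apexPt]

lemma facet_height_one (p q a z : ℤ × ℤ) (ε : ℝ) :
    facet p q a ε ![(z.1 : ℝ), (z.2 : ℝ), 1] = cr p q (refl2 a z) + ε := by
  simp [facet, cr, refl2]; ring

lemma continuous_facet (p q a : ℤ × ℤ) (ε : ℝ) : Continuous (facet p q a ε) := by
  unfold facet; fun_prop

lemma convex_facet_nonneg (p q a : ℤ × ℤ) (ε : ℝ) : Convex ℝ {x | 0 ≤ facet p q a ε x} := by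
  intro x hx y hy s t hs ht hst
  have : facet p q a ε (s • x + t • y) = s * facet p q a ε x + t * facet p q a ε y := by
    obtain rfl : s = 1 - t := by linarith
    simp [facet]; ring
  simp only [mem_ofPred_eq] at *
  rw [this]; positivity

lemma pos_of_mem_interior {K : Set (Fin 3 → ℝ)} {f : (Fin 3 → ℝ) → ℝ} (hf : ∀ x ∈ K, 0 ≤ f x)
    (d : Fin 3 → ℝ) {κ : ℝ} (hκ : 0 < κ) (hd : ∀ x t, f (x + t • d) = f x - t * κ)
    {x : Fin 3 → ℝ} (hx : x ∈ interior K) : 0 < f x := by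
  have hc : Continuous fun t : ℝ => x + t • d := by fun_prop
  have hnhds : ∀ᶠ t in nhds (0 : ℝ), x + t • d ∈ interior K :=
    hc.continuousAt.eventually (isOpen_interior.mem_nhds (by simpa using hx))
  obtain ⟨t, ht, htpos⟩ := ((hnhds.filter_mono nhdsWithin_le_nhds).and
    (self_mem_nhdsWithin (s := Ioi (0 : ℝ)))).exists
  have h0 := hf _ (interior_subset ht)
  rw [hd] at h0
  have : 0 < t * κ := mul_pos htpos hκ
  linarith

lemma facet_pos_of_mem_interior {K : Set (Fin 3 → ℝ)} {p q a : ℤ × ℤ} {ε : ℝ} (hpq : p ≠ q)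
    (hf : ∀ x ∈ K, 0 ≤ facet p q a ε x) {x : Fin 3 → ℝ} (hx : x ∈ interior K) :
    0 < facet p q a ε x := by
  refine pos_of_mem_interior hf ![((q.2 - p.2 : ℤ) : ℝ), -((q.1 - p.1 : ℤ) : ℝ), 0]
    (κ := 2 * (((q.1 - p.1 : ℤ) : ℝ) ^ 2 + ((q.2 - p.2 : ℤ) : ℝ) ^ 2)) ?_ ?_ hx
  · by_cases h : q.1 - p.1 = 0
    · have h2 : q.2 - p.2 ≠ 0 := fun h2 => hpq (Prod.ext (by omega) (by omega))
      have : ((q.2 - p.2 : ℤ) : ℝ) ≠ 0 := by exact_mod_cast h2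
      positivity
    · have : ((q.1 - p.1 : ℤ) : ℝ) ≠ 0 := by exact_mod_cast h
      positivity
  · intro x t
    simp [facet]; ring

lemma CCW.ne {p q r s : ℤ × ℤ} (h : CCW p q r s) : p ≠ q := by
  rintro rfl
  have := h.1
  simp [cr] at this

lemma mem_pyramid_of_triangle {S : Set (Fin 3 → ℝ)} {u v w a : ℤ × ℤ} (huvw : 0 < cr u v w)
    (hu : basePt u ∈ S) (hv : basePt v ∈ S) (hw : basePt w ∈ S) (ha : apexPt a ∈ S)
    {x : Fin 3 → ℝ} (h0 : 0 ≤ x 2) (h1 : 0 ≤ facet u v a 0 x) (h2 : 0 ≤ facet v w a 0 x)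
    (h3 : 0 ≤ facet w u a 0 x) : x ∈ convexHull ℝ S := by
  have hD : (0 : ℝ) < cr u v w := by exact_mod_cast huvw
  have hx : x = ∑ i : Fin 4, (![facet v w a 0 x / (2 * cr u v w), facet w u a 0 x / (2 * cr u v w),
      facet u v a 0 x / (2 * cr u v w), x 2 / 2] i : ℝ) •
      (![basePt u, basePt v, basePt w, apexPt a] i) := by
    simp only [Fin.sum_univ_four]
    ext i
    fin_cases i
    · simp [basePt, apexPt]
      field_simp
      simp [facet, cr]; ring
    · simp [basePt, apexPt]
      field_simp
      simp [facet, cr]; ring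
    · simp [basePt, apexPt]
  rw [hx]
  refine (convex_convexHull ℝ S).sum_mem ?_ ?_ ?_
  · intro i _
    fin_cases i <;> simp <;> positivity
  · simp only [Fin.sum_univ_four]
    simp
    field_simp
    simp [facet, cr]; ring
  · intro i _
    fin_cases i
    · exact subset_convexHull ℝ S hu
    · exact subset_convexHull ℝ S hv
    · exact subset_convexHull ℝ S hw
    · exact subset_convexHull ℝ S ha

lemma mem_pyramid_of_facet_nonneg {p q r s a : ℤ × ℤ} (h : CCW p q r s) {x : Fin 3 → ℝ}
    (h0 : 0 ≤ x 2) (h1 : 0 ≤ facet p q a 0 x) (h2 : 0 ≤ facet q r a 0 x)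
    (h3 : 0 ≤ facet r s a 0 x) (h4 : 0 ≤ facet s p a 0 x) : x ∈ pyramid p q r s a := by
  by_cases hd : 0 ≤ facet r p a 0 x
  · exact mem_pyramid_of_triangle h.1 (by simp) (by simp) (by simp) (by simp) h0 h1 h2 hd
  · have hd' : 0 ≤ facet p r a 0 x := by
      have : facet p r a 0 x = - facet r p a 0 x := by simp [facet]; ring
      linarith
    exact mem_pyramid_of_triangle h.2.2.1 (by simp) (by simp) (by simp) (by simp) h0 h3 h4 hd'

lemma facet_nonneg_of_mem_pyramid {p q r s a u v : ℤ × ℤ} {ε : ℝ}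
    (hp : 0 ≤ (cr u v p : ℝ) + ε) (hq : 0 ≤ (cr u v q : ℝ) + ε) (hr : 0 ≤ (cr u v r : ℝ) + ε)
    (hs : 0 ≤ (cr u v s : ℝ) + ε) {x : Fin 3 → ℝ} (hx : x ∈ pyramid p q r s a) :
    0 ≤ facet u v a ε x := by
  refine convexHull_min ?_ (convex_facet_nonneg u v a ε) hx
  simp only [insert_subset_iff, singleton_subset_iff, mem_ofPred_eq, facet_basePt, facet_apexPt,
    le_refl, and_true]
  refine ⟨?_, ?_, ?_, ?_⟩ <;> linarith

lemma height_mem_of_mem_pyramid {p q r s a : ℤ × ℤ} {x : Fin 3 → ℝ}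
    (hx : x ∈ pyramid p q r s a) : 0 ≤ x 2 ∧ x 2 ≤ 2 := by
  have hc : Convex ℝ {x : Fin 3 → ℝ | 0 ≤ x 2 ∧ x 2 ≤ 2} :=
    (convex_Icc (0 : ℝ) 2).is_linear_preimage (f := fun x : Fin 3 → ℝ => x 2) ⟨by simp, by simp⟩
  refine convexHull_min ?_ hc hx
  simp [insert_subset_iff, basePt, apexPt]

lemma not_inQuad_of_interior_disjoint {p q r s a : ℤ × ℤ} (h : CCW p q r s)
    (hfree : interior (pyramid p q r s a) ∩ intPts 3 = ∅) (z : ℤ × ℤ) :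
    ¬ InQuad p q r s (refl2 a z) := by
  rintro ⟨z1, z2, z3, z4⟩
  have hopen : IsOpen ({x : Fin 3 → ℝ | 0 < x 2} ∩ ({x | 0 < facet p q a 0 x} ∩
      ({x | 0 < facet q r a 0 x} ∩ ({x | 0 < facet r s a 0 x} ∩ {x | 0 < facet s p a 0 x})))) :=
    (isOpen_lt continuous_const (continuous_apply 2)).inter <|
    (isOpen_lt continuous_const (continuous_facet _ _ _ _)).inter <|
    (isOpen_lt continuous_const (continuous_facet _ _ _ _)).inter <|
    (isOpen_lt continuous_const (continuous_facet _ _ _ _)).inter <|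
    (isOpen_lt continuous_const (continuous_facet _ _ _ _))
  have hsub := interior_maximal (fun x hx => mem_pyramid_of_facet_nonneg h
    (le_of_lt hx.1) hx.2.1.le hx.2.2.1.le hx.2.2.2.1.le hx.2.2.2.2.le) hopen
  have hz : (![(z.1 : ℝ), (z.2 : ℝ), 1] : Fin 3 → ℝ) ∈ interior (pyramid p q r s a) := by
    apply hsub
    simp only [mem_inter_iff, mem_ofPred_eq, facet_height_one, add_zero]
    exact ⟨by simp, by exact_mod_cast z1, by exact_mod_cast z2, by exact_mod_cast z3,
      by exact_mod_cast z4⟩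
  have : (![(z.1 : ℝ), (z.2 : ℝ), 1] : Fin 3 → ℝ) ∈ interior (pyramid p q r s a) ∩ intPts 3 := by
    refine ⟨hz, fun i => ?_⟩
    fin_cases i
    · exact ⟨z.1, rfl⟩
    · exact ⟨z.2, rfl⟩
    · exact ⟨1, by simp⟩
  rw [hfree] at this
  exact this

lemma pyramid_rotate (p q r s a : ℤ × ℤ) : pyramid q r s p a = pyramid p q r s a := by
  unfold pyramid
  congr 1
  ext
  simp only [mem_insert_iff, mem_singleton_iff]
  tauto

/-- Every edge of the base of a maximal lattice-free pyramid of height two is, in the section at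
height one, blocked by a lattice point. -/
lemma exists_onEdge_of_maximal {p q r s a : ℤ × ℤ} (h : CCW p q r s)
    (hfree : interior (pyramid p q r s a) ∩ intPts 3 = ∅)
    (hmax : ∀ K : Set (Fin 3 → ℝ), Convex ℝ K → interior K ∩ intPts 3 = ∅ →
      pyramid p q r s a ⊆ K → pyramid p q r s a = K) :
    ∃ z, OnEdge p q r s (refl2 a z) := by
  by_contra! hno
  have hquad := not_inQuad_of_interior_disjoint h hfree
  set K : Set (Fin 3 → ℝ) := {x | 0 ≤ x 2 ∧ x 2 ≤ 2} ∩ ({x | 0 ≤ facet p q a 1 x} ∩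
    ({x | 0 ≤ facet q r a 0 x} ∩ ({x | 0 ≤ facet r s a 0 x} ∩ {x | 0 ≤ facet s p a 0 x}))) with hK
  have hKconv : Convex ℝ K := by
    refine Convex.inter ?_ ((convex_facet_nonneg _ _ _ _).inter
      ((convex_facet_nonneg _ _ _ _).inter ((convex_facet_nonneg _ _ _ _).inter
      (convex_facet_nonneg _ _ _ _))))
    exact (convex_Icc (0 : ℝ) 2).is_linear_preimage (f := fun x : Fin 3 → ℝ => x 2)
      ⟨by simp, by simp⟩
  obtain ⟨h1, h2, h3, h4⟩ := id h
  have h1' : (0 : ℝ) < cr p q r := by exact_mod_cast h1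
  have h2' : (0 : ℝ) < cr q r s := by exact_mod_cast h2
  have h3' : (0 : ℝ) < cr r s p := by exact_mod_cast h3
  have h4' : (0 : ℝ) < cr s p q := by exact_mod_cast h4
  have c1 : cr p q p = 0 ∧ cr p q q = 0 ∧ cr q r q = 0 ∧ cr q r r = 0 ∧ cr r s r = 0 ∧
      cr r s s = 0 ∧ cr s p s = 0 ∧ cr s p p = 0 := by 
    simp only [cr]
    refine ⟨?_, ?_, ?_, ?_, ?_, ?_, ?_, ?_⟩ <;> ring
  obtain ⟨i1, i2, i3, i4, i5, i6, i7, i8⟩ := c1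
  have r1 : cr p q s = cr s p q := cr_rotate s p q
  have r2 : cr q r p = cr p q r := cr_rotate p q r
  have r3 : cr r s q = cr q r s := cr_rotate q r s
  have r4 : cr s p r = cr r s p := cr_rotate r s p
  have hsub : pyramid p q r s a ⊆ K := by
    intro x hx
    refine ⟨height_mem_of_mem_pyramid hx, facet_nonneg_of_mem_pyramid ?_ ?_ ?_ ?_ hx,
      facet_nonneg_of_mem_pyramid ?_ ?_ ?_ ?_ hx, facet_nonneg_of_mem_pyramid ?_ ?_ ?_ ?_ hx,
      facet_nonneg_of_mem_pyramid ?_ ?_ ?_ ?_ hx⟩ <;>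
    (try simp only [i1, i2, i3, i4, i5, i6, i7, i8, r1, r2, r3, r4, Int.cast_zero]) <;> linarith
  have hKfree : interior K ∩ intPts 3 = ∅ := by
    rw [eq_empty_iff_forall_notMem]
    rintro x ⟨hx, hint⟩
    have f1 := facet_pos_of_mem_interior h.ne (fun y hy => (show y ∈ K from hy).2.1) hx
    have f2 := facet_pos_of_mem_interior h.rotate.ne (fun y hy => (show y ∈ K from hy).2.2.1) hx
    have f3 := facet_pos_of_mem_interior h.rotate.rotate.ne
      (fun y hy => (show y ∈ K from hy).2.2.2.1) hx
    have f4 := facet_pos_of_mem_interior h.rotate.rotate.rotate.ne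
      (fun y hy => (show y ∈ K from hy).2.2.2.2) hx
    have g1 : 0 < x 2 := pos_of_mem_interior (f := fun y => y 2)
      (fun y hy => (show y ∈ K from hy).1.1) ![0, 0, -1] one_pos
      (by intro y t; simp; ring) hx
    have g2 : 0 < 2 - x 2 := pos_of_mem_interior (f := fun y => 2 - y 2)
      (fun y hy => sub_nonneg.2 (show y ∈ K from hy).1.2) ![0, 0, 1] one_pos
      (by intro y t; simp; ring) hx
    obtain ⟨z0, e0⟩ := hint 0
    obtain ⟨z1, e1⟩ := hint 1
    obtain ⟨z2, e2⟩ := hint 2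
    have k1 : 0 < z2 := by rw [e2] at g1; exact_mod_cast g1
    have k2 : z2 < 2 := by rw [e2, sub_pos] at g2; exact_mod_cast g2
    obtain rfl : z2 = 1 := by omega
    have hx : x = ![(((z0, z1) : ℤ × ℤ).1 : ℝ), (((z0, z1) : ℤ × ℤ).2 : ℝ), 1] := by
      ext i
      fin_cases i
      · exact e0
      · exact e1
      · simpa using e2
    rw [hx, facet_height_one] at f1 f2 f3 f4
    rw [add_zero] at f2 f3 f4
    have m1 : -1 < cr p q (refl2 a (z0, z1)) := by
      have : (-1 : ℝ) < cr p q (refl2 a (z0, z1)) := by linarith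
      exact_mod_cast this
    have m2 : 0 < cr q r (refl2 a (z0, z1)) := by exact_mod_cast f2
    have m3 : 0 < cr r s (refl2 a (z0, z1)) := by exact_mod_cast f3
    have m4 : 0 < cr s p (refl2 a (z0, z1)) := by exact_mod_cast f4
    rcases (show 0 ≤ cr p q (refl2 a (z0, z1)) by omega).eq_or_lt with m | m
    · exact hno (z0, z1) ⟨m.symm, m2, m3, m4⟩
    · exact hquad (z0, z1) ⟨m, m2, m3, m4⟩
  have hPK := hmax K hKconv hKfree hsub
  obtain ⟨t, ht, ht1, ht2⟩ : ∃ t : ℝ, 0 < t ∧ 2 * (t * cr p q r) ≤ 1 ∧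
      2 * (t * cr r s p) ≤ cr s p q := by
    have hge : (1 : ℝ) ≤ cr s p q := by exact_mod_cast h4
    refine ⟨1 / (2 * (cr p q r + cr r s p)), by positivity, ?_, le_trans ?_ hge⟩ <;>
    · field_simp
      linarith
  have hyval : ∀ (u v : ℤ × ℤ) (ε : ℝ), facet u v a ε
      ((1 + t) • ((1 / 2 : ℝ) • (basePt p + basePt q)) - t • basePt r) =
      (1 + t) * (cr u v p + cr u v q) - 2 * t * cr u v r + 2 * ε := by
    intro u v ε
    simp [facet, basePt, cr]; ring
  set y := (1 + t) • ((1 / 2 : ℝ) • (basePt p + basePt q)) - t • basePt r with hy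
  have hyK : y ∈ K := by
    refine ⟨?_, ?_, ?_, ?_, ?_⟩
    · simp [hy, basePt]
    all_goals
      simp only [mem_ofPred_eq, hyval, i1, i2, i3, i4, i5, i8, r2, r3, r4, Int.cast_zero]
    · linarith
    · have : 0 < (1 + t) * cr p q r := by positivity
      linarith
    · have : 0 < (1 + t) * (cr r s p + cr q r s) := by positivity
      linarith
    · have : 0 < t * (cr s p q : ℝ) := by positivity
      linarith
  rw [← hPK] at hyK
  have hneg := facet_nonneg_of_mem_pyramid (u := p) (v := q) (ε := 0)
    (by simp [i1]) (by simp [i2]) (by simp [h1.le]) (by simp [r1, h4.le]) hyK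
  rw [hyval, i1, i2] at hneg
  have : 0 < t * (cr p q r : ℝ) := by positivity
  simp only [Int.cast_zero] at hneg
  linarith

lemma affMap_image_convexHull {d : ℕ} (U : Matrix (Fin d) (Fin d) ℤ) (t : Fin d → ℝ)
    (S : Set (Fin d → ℝ)) : affMap U t '' convexHull ℝ S = convexHull ℝ (affMap U t '' S) := by
  let f : (Fin d → ℝ) →ᵃ[ℝ] (Fin d → ℝ) :=
    (Matrix.toLin' (U.map (Int.cast : ℤ → ℝ))).toAffineMap + AffineMap.const ℝ _ t
  have hf : (f : (Fin d → ℝ) → (Fin d → ℝ)) = affMap U t := by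
    ext x i
    simp [f, affMap, Matrix.mulVec, dotProduct]
  rw [← hf]
  exact f.image_convexHull S

/-- The pyramids of the classification are unimodular images of `M8`. -/
lemma pyramid_eq_affMap_image_M8 {e f c a : ℤ × ℤ} (hef : det2 e f = 1) (z : ℤ × ℤ)
    (hc : c = refl2 a z + e + f) :
    ∃ (U : Matrix (Fin 3) (Fin 3) ℤ) (v : Fin 3 → ℤ), |U.det| = 1 ∧
      pyramid (c - 2 * e) (c - 2 * f) (c + 2 * e) (c + 2 * f) a =
        affMap U (fun i => (v i : ℝ)) '' M8 := by
  have hc1 : c.1 = 2 * z.1 - a.1 + e.1 + f.1 := by rw [hc]; rfl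
  have hc2 : c.2 = 2 * z.2 - a.2 + e.2 + f.2 := by rw [hc]; rfl
  refine ⟨!![e.1, f.1, a.1 - z.1 - e.1 - f.1; e.2, f.2, a.2 - z.2 - e.2 - f.2; 0, 0, 1],
    ![c.1, c.2, 0], ?_, ?_⟩
  · have : e.1 * f.2 - f.1 * e.2 = 1 := by rw [← hef, det2]; ring
    simp [Matrix.det_fin_three, this]
  · rw [M8, affMap_image_convexHull]
    simp only [image_insert_eq, image_singleton]
    rw [pyramid]
    set g := affMap !![e.1, f.1, a.1 - z.1 - e.1 - f.1; e.2, f.2, a.2 - z.2 - e.2 - f.2; 0, 0, 1]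
      (fun i => ((![c.1, c.2, 0] : Fin 3 → ℤ) i : ℝ)) with hg
    have g1 : g ![2, 0, 0] = basePt (c + 2 * e) := by
      ext i; fin_cases i <;> simp [hg, affMap, basePt, Fin.sum_univ_three] <;> ring
    have g2 : g ![-2, 0, 0] = basePt (c - 2 * e) := by
      ext i; fin_cases i <;> simp [hg, affMap, basePt, Fin.sum_univ_three] <;> ring
    have g3 : g ![0, 2, 0] = basePt (c + 2 * f) := by
      ext i; fin_cases i <;> simp [hg, affMap, basePt, Fin.sum_univ_three] <;> ring
    have g4 : g ![0, -2, 0] = basePt (c - 2 * f) := by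
      ext i; fin_cases i <;> simp [hg, affMap, basePt, Fin.sum_univ_three] <;> ring
    have g5 : g ![1, 1, 2] = apexPt a := by
      ext i; fin_cases i <;> simp [hg, affMap, apexPt, Fin.sum_univ_three, hc1, hc2] <;> ring
    rw [g1, g2, g3, g4, g5]
    congr 1
    ext
    simp only [mem_insert_iff, mem_singleton_iff]
    tauto

lemma extremePoints_subset_intPts {P F : Set (Fin 3 → ℝ)} {a : Fin 3 → ℝ}
    (hP : IsIntegralPoly P) (hF : Convex ℝ F) (hFplane : F ⊆ {x : Fin 3 → ℝ | x 2 = 0})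
    (ha : a 2 = 2) (hPyr : P = convexHull ℝ (F ∪ {a})) : extremePoints ℝ F ⊆ intPts 3 := by
  intro v hv
  have hne : F.Nonempty := ⟨v, hv.1⟩
  have hPeq : P = convexJoin ℝ {a} F := by
    rw [hPyr, union_singleton, convexHull_insert hne, hF.convexHull_eq]
  have hmem : ∀ x ∈ P, 0 ≤ x 2 ∧ (x 2 = 0 → x ∈ F) := by
    intro x hx
    rw [hPeq, mem_convexJoin] at hx
    obtain ⟨y, hy, f, hf, α, β, hα, hβ, hαβ, rfl⟩ := hx
    rw [mem_singleton_iff] at hy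
    subst hy
    have hf2 : f 2 = 0 := hFplane hf
    have hval : (α • y + β • f) 2 = 2 * α := by simp [ha, hf2]; ring
    rw [hval]
    refine ⟨by linarith, fun h => ?_⟩
    obtain rfl : α = 0 := by linarith
    obtain rfl : β = 1 := by linarith
    simpa using hf
  have hvP : v ∈ extremePoints ℝ P := by
    rw [mem_extremePoints]
    refine ⟨hPyr ▸ subset_convexHull ℝ _ (Or.inl hv.1), fun x hx y hy hxy => ?_⟩
    have hv2 : v 2 = 0 := hFplane hv.1
    obtain ⟨hx0, hxF⟩ := hmem x hx
    obtain ⟨hy0, hyF⟩ := hmem y hy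
    obtain ⟨α, β, hα, hβ, -, e⟩ := id hxy
    have e2 : α * x 2 + β * y 2 = 0 := by rw [← hv2, ← e]; simp
    have i1 : 0 ≤ α * x 2 := by positivity
    have i2 : 0 ≤ β * y 2 := by positivity
    have x0 : x 2 = 0 := by
      rcases mul_eq_zero.1 (show α * x 2 = 0 by linarith) with h | h
      · exact absurd h hα.ne'
      · exact h
    have y0 : y 2 = 0 := by
      rcases mul_eq_zero.1 (show β * y 2 = 0 by linarith) with h | h
      · exact absurd h hβ.ne'
      · exact h
    exact (mem_extremePoints.1 hv).2 x (hxF x0) y (hyF y0) hxy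
  rw [hP] at hvP
  exact (extremePoints_convexHull_subset hvP).2

lemma apex_mem_intPts {P F : Set (Fin 3 → ℝ)} {a : Fin 3 → ℝ}
    (hP : IsIntegralPoly P) (hF : Convex ℝ F) (hne : F.Nonempty)
    (hFplane : F ⊆ {x : Fin 3 → ℝ | x 2 = 0})
    (ha : a 2 = 2) (hPyr : P = convexHull ℝ (F ∪ {a})) : a ∈ intPts 3 := by
  have hPeq : P = convexJoin ℝ {a} F := by
    rw [hPyr, union_singleton, convexHull_insert hne, hF.convexHull_eq]
  by_contra hcon
  have hc : Convex ℝ {x : Fin 3 → ℝ | x 2 < 2} :=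
    (convex_Iio (2 : ℝ)).is_linear_preimage (f := fun x : Fin 3 → ℝ => x 2) ⟨by simp, by simp⟩
  have hsub : P ∩ intPts 3 ⊆ {x : Fin 3 → ℝ | x 2 < 2} := by
    rintro x ⟨hx, hint⟩
    rw [hPeq, mem_convexJoin] at hx
    obtain ⟨y, hy, f, hf, α, β, hα, hβ, hαβ, rfl⟩ := hx
    rw [mem_singleton_iff] at hy
    subst hy
    have hf2 : f 2 = 0 := hFplane hf
    have hval : (α • y + β • f) 2 = 2 * α := by simp [ha, hf2]; ring
    rw [mem_ofPred_eq, hval]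
    by_contra hle
    obtain rfl : α = 1 := by linarith
    obtain rfl : β = 0 := by linarith
    exact hcon (by simpa using hint)
  have haP : a ∈ P := hPyr ▸ subset_convexHull ℝ _ (Or.inr rfl)
  rw [hP] at haP
  have : a 2 < 2 := convexHull_min hsub hc haP
  linarith

lemma notInHull_of_mem_extremePoints {p q r s : ℤ × ℤ}
    (h : basePt p ∈ extremePoints ℝ (convexHull ℝ {basePt p, basePt q, basePt r, basePt s}))
    (hq : basePt p ≠ basePt q) (hr : basePt p ≠ basePt r) (hs : basePt p ≠ basePt s) :
    NotInHull p q r s := by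
  intro x y z hx hy hz hpos e1 e2
  have hx' : (0 : ℝ) ≤ x := by exact_mod_cast hx
  have hy' : (0 : ℝ) ≤ y := by exact_mod_cast hy
  have hz' : (0 : ℝ) ≤ z := by exact_mod_cast hz
  have hpos' : (0 : ℝ) < x + y + z := by exact_mod_cast hpos
  have e1' : (x + y + z : ℝ) * p.1 = x * q.1 + y * r.1 + z * s.1 := by exact_mod_cast e1
  have e2' : (x + y + z : ℝ) * p.2 = x * q.2 + y * r.2 + z * s.2 := by exact_mod_cast e2
  have hmem : basePt p ∈ convexHull ℝ {basePt q, basePt r, basePt s} := by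
    have hp : basePt p = ∑ i : Fin 3,
        (![(x : ℝ) / (x + y + z), (y : ℝ) / (x + y + z), (z : ℝ) / (x + y + z)] i) •
        (![basePt q, basePt r, basePt s] i) := by
      simp only [Fin.sum_univ_three]
      ext i
      fin_cases i
      · simp [basePt]
        field_simp
        linarith
      · simp [basePt]
        field_simp
        linarith
      · simp [basePt]
    rw [hp]
    refine (convex_convexHull ℝ _).sum_mem ?_ ?_ ?_
    · intro i _
      fin_cases i <;> simp <;> positivity
    · simp only [Fin.sum_univ_three]
      simp
      field_simp
    · intro i _
      fin_cases i <;> exact subset_convexHull ℝ _ (by simp)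
  have hsub : convexHull ℝ {basePt p, basePt q, basePt r, basePt s} =
      convexHull ℝ {basePt q, basePt r, basePt s} := by
    refine Subset.antisymm (convexHull_min ?_ (convex_convexHull ℝ _))
      (convexHull_mono (subset_insert _ _))
    exact insert_subset hmem (subset_convexHull ℝ _)
  rw [hsub] at h
  have := extremePoints_convexHull_subset h
  simp only [mem_insert_iff, mem_singleton_iff] at this
  tauto

lemma not_collinear_of_interior_nonempty {p q r s a : ℤ × ℤ} (hpq : p ≠ q)
    (hint : (interior (pyramid p q r s a)).Nonempty) : ¬ (cr p q r = 0 ∧ cr p q s = 0) := by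
  rintro ⟨hr, hs⟩
  obtain ⟨x, hx⟩ := hint
  have cp : cr p q p = 0 := by simp [cr]
  have cq : cr p q q = 0 := by simp only [cr]; ring
  have cp' : cr q p p = 0 := by simp only [cr]; ring
  have cq' : cr q p q = 0 := by simp [cr]
  have cr' : cr q p r = 0 := by simp only [cr] at hr ⊢; linarith
  have cs' : cr q p s = 0 := by simp only [cr] at hs ⊢; linarith
  have h1 := facet_pos_of_mem_interior (ε := 0) hpq (fun y hy => facet_nonneg_of_mem_pyramid
    (by simp [cp]) (by simp [cq]) (by simp [hr]) (by simp [hs]) hy) hx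
  have h2 := facet_pos_of_mem_interior (ε := 0) hpq.symm (fun y hy => facet_nonneg_of_mem_pyramid
    (by simp [cp']) (by simp [cq']) (by simp [cr']) (by simp [cs']) hy) hx
  have : facet q p a 0 x = - facet p q a 0 x := by simp [facet]; ring
  linarith

/-- A maximal lattice-free integral quadrangular pyramid in `ℝ³` with base in the plane
`x₃ = 0` and apex at height `2` is, up to a unimodular transformation, the pyramid `M₈`. -/
theorem M3_pyramid_height_two (P F : Set (Fin 3 → ℝ)) (a : Fin 3 → ℝ)
    (hP : MemM3 P)
    (hFpoly : ∃ V : Finset (Fin 3 → ℝ), F = convexHull ℝ (V : Set (Fin 3 → ℝ)))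
    (hFquad : (Set.extremePoints ℝ F).ncard = 4)
    (hFplane : F ⊆ {x : Fin 3 → ℝ | x 2 = 0})
    (ha : a 2 = 2)
    (hPyr : P = convexHull ℝ (F ∪ {a})) :
    ∃ (U : Matrix (Fin 3) (Fin 3) ℤ) (v : Fin 3 → ℤ),
      |U.det| = 1 ∧ P = affMap U (fun i => (v i : ℝ)) '' M8 := by
  obtain ⟨-, -, hint, hne, hfree, hmax⟩ := hP
  obtain ⟨V, hV⟩ := hFpoly
  have hFconv : Convex ℝ F := hV ▸ convex_convexHull ℝ _
  have hFcomp : IsCompact F := hV ▸ V.finite_toSet.isCompact_convexHull ℝ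
  have hFin : (extremePoints ℝ F).Finite := finite_of_ncard_ne_zero (by omega)
  have hFeq : F = convexHull ℝ (extremePoints ℝ F) := by
    conv_lhs => rw [← closure_convexHull_extremePoints hFcomp hFconv]
    exact (hFin.isClosed_convexHull ℝ).closure_eq
  have hext := extremePoints_subset_intPts hint hFconv hFplane ha hPyr
  have hbase : ∀ v ∈ extremePoints ℝ F, ∃ p : ℤ × ℤ, v = basePt p := by
    intro v hv
    obtain ⟨x, hx⟩ := hext hv 0
    obtain ⟨y, hy⟩ := hext hv 1
    refine ⟨(x, y), ?_⟩
    ext i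
    fin_cases i
    · exact hx
    · exact hy
    · exact hFplane hv.1
  obtain ⟨A, B, C, E, hAB, hAC, hAE, hBC, hBE, hCE, hS⟩ := ncard_eq_four.1 hFquad
  obtain ⟨p, rfl⟩ := hbase A (by simp [hS])
  obtain ⟨q, rfl⟩ := hbase B (by simp [hS])
  obtain ⟨r, rfl⟩ := hbase C (by simp [hS])
  obtain ⟨s, rfl⟩ := hbase E (by simp [hS])
  obtain ⟨b, rfl⟩ : ∃ b : ℤ × ℤ, a = apexPt b := by
    have hne : F.Nonempty := by
      have : basePt p ∈ extremePoints ℝ F := by simp [hS]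
      exact ⟨_, this.1⟩
    have haint := apex_mem_intPts hint hFconv hne hFplane ha hPyr
    obtain ⟨x, hx⟩ := haint 0
    obtain ⟨y, hy⟩ := haint 1
    refine ⟨(x, y), ?_⟩
    ext i
    fin_cases i
    · exact hx
    · exact hy
    · exact ha
  have hPpyr : P = pyramid p q r s b := by
    rw [hPyr, hFeq, hS, convexHull_convexHull_union_left, pyramid]
    congr 1
    ext
    simp only [mem_union, mem_insert_iff, mem_singleton_iff]
    tauto
  have hnot : ∀ p' q' r' s' : ℤ × ℤ, ({basePt p', basePt q', basePt r', basePt s'} :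
      Set (Fin 3 → ℝ)) = {basePt p, basePt q, basePt r, basePt s} → basePt p' ≠ basePt q' →
      basePt p' ≠ basePt r' → basePt p' ≠ basePt s' → NotInHull p' q' r' s' := by
    intro p' q' r' s' hset
    refine notInHull_of_mem_extremePoints ?_
    rw [hset, ← hS, ← hFeq, hS, ← hset]
    simp
  obtain ⟨p', q', r', s', hset, hccw⟩ := exists_ccw_order p q r s
    (hnot p q r s rfl hAB hAC hAE)
    (hnot q p r s (insert_comm _ _ _) hAB.symm hBC hBE)
    (hnot r p q s (by ext; simp only [mem_insert_iff, mem_singleton_iff]; tauto)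
      hAC.symm hBC.symm hCE)
    (hnot s p q r (by ext; simp only [mem_insert_iff, mem_singleton_iff]; tauto)
      hAE.symm hBE.symm hCE.symm)
    (fun h => not_collinear_of_interior_nonempty (by rintro rfl; exact hAB rfl) (hPpyr ▸ hne)
      ⟨h.1, h.2.1⟩)
  have hPpyr' : P = pyramid p' q' r' s' b := by
    have := congrArg (fun T => convexHull ℝ (insert (apexPt b) (basePt '' T))) hset
    simp only [image_insert_eq, image_singleton] at this
    rw [hPpyr, pyramid, pyramid]
    convert this.symm using 2 <;>
    · ext
      simp only [mem_insert_iff, mem_singleton_iff]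
      tauto
  rw [hPpyr'] at hfree hmax ⊢
  obtain ⟨u, hu⟩ := exists_onEdge_of_maximal hccw hfree hmax
  obtain ⟨v, hv⟩ := exists_onEdge_of_maximal (a := b) hccw.rotate
    (by rwa [pyramid_rotate]) (by rwa [pyramid_rotate])
  obtain ⟨w, hw⟩ := exists_onEdge_of_maximal (a := b) hccw.rotate.rotate
    (by rwa [pyramid_rotate, pyramid_rotate]) (by rwa [pyramid_rotate, pyramid_rotate])
  obtain ⟨x, hx⟩ := exists_onEdge_of_maximal (a := b) hccw.rotate.rotate.rotate
    (by rwa [pyramid_rotate, pyramid_rotate, pyramid_rotate])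
    (by rwa [pyramid_rotate, pyramid_rotate, pyramid_rotate])
  obtain ⟨e, f, c, hef, hc, rfl, rfl, rfl, rfl⟩ := exists_basis_of_lattice_free hccw
    (not_inQuad_of_interior_disjoint hccw hfree) hu hv hw hx
  exact pyramid_eq_affMap_image_M8 hef u hc
end
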